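/- There exist absolute constants c_1 > 0 and θ_0 ∈ (0,1) such that for every θ ∈ [θ_0, 1) there exists x_0 = x_0(θ) with the following property: for every real x ≥ x_0, every prime q with log q / log x = θ (that is, q = x^{θ}), and every integer a with gcd(a,q) = 1, one has π(x; q, a) < (2 − c_1(1−θ)²)·x/(φ(q)·log(x/q)). -/

import Mathlib

open Finset

/-- `π(x; q, a)`: the number of primes `n ≤ x` with `n ≡ a (mod q)`. -/
noncomputable def primesInAP (x : ℝ) (q : ℕ) (a : ℤ) : ℕ :=
  ((Finset.Icc 1 ⌊x⌋₊).filter fun n : ℕ => n.Prime ∧ ((n : ZMod q) = (a : ZMod q))).card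

namespace BrunTitchmarsh

lemma card_divisors_le_rpow {ε : ℝ} (hε : 0 < ε) :
    ∃ C : ℝ, 1 ≤ C ∧ ∀ n : ℕ, n ≠ 0 → (#n.divisors : ℝ) ≤ C * (n : ℝ) ^ ε := by
  have hl2 : 0 < Real.log 2 := Real.log_pos (by norm_num)
  set K : ℝ := 1 + 1 / (ε * Real.log 2) with hK
  have hK1 : 1 ≤ K := by
    have : 0 < 1 / (ε * Real.log 2) := by positivity
    linarith
  obtain ⟨P, hP⟩ := exists_nat_ge ((2 : ℝ) ^ (1 / ε))
  have hbase : ∀ p : ℕ, p.Prime → ∀ v : ℕ,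
      ((v : ℝ) + 1) ≤ (if p < P then K else 1) * ((p : ℝ) ^ ε) ^ v := by
    intro p hp v
    have hp2 : (2 : ℝ) ≤ p := by exact_mod_cast hp.two_le
    split_ifs with h
    · have h1 : (2 : ℝ) ^ ε ≤ (p : ℝ) ^ ε := Real.rpow_le_rpow (by norm_num) hp2 hε.le
      have h2 : 1 + (v : ℝ) * (ε * Real.log 2) ≤ ((2 : ℝ) ^ ε) ^ v := by
        have : ((2 : ℝ) ^ ε) ^ v = Real.exp ((v : ℝ) * (ε * Real.log 2)) := by
          rw [Real.rpow_def_of_pos (by norm_num), ← Real.exp_nat_mul]; ring_nf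
        rw [this]
        linarith [Real.add_one_le_exp ((v : ℝ) * (ε * Real.log 2))]
      have h3 : ((2 : ℝ) ^ ε) ^ v ≤ ((p : ℝ) ^ ε) ^ v := by gcongr
      have h4 : (v : ℝ) + 1 ≤ K * (1 + (v : ℝ) * (ε * Real.log 2)) := by
        have : K * (1 + (v : ℝ) * (ε * Real.log 2)) =
            1 + v + 1 / (ε * Real.log 2) + v * (ε * Real.log 2) := by
          rw [hK]; field_simp; ring
        rw [this]
        have : 0 < 1 / (ε * Real.log 2) := by positivity
        have : 0 ≤ v * (ε * Real.log 2) := by positivity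
        linarith
      calc (v : ℝ) + 1 ≤ K * (1 + (v : ℝ) * (ε * Real.log 2)) := h4
        _ ≤ K * ((p : ℝ) ^ ε) ^ v := by
          apply mul_le_mul_of_nonneg_left (h2.trans h3) (by linarith)
    · have hp' : (2 : ℝ) ^ (1 / ε) ≤ p := hP.trans (by exact_mod_cast not_lt.mp h)
      have h1 : (2 : ℝ) ≤ (p : ℝ) ^ ε := by
        calc (2 : ℝ) = ((2 : ℝ) ^ (1 / ε)) ^ ε := by
              rw [← Real.rpow_mul (by norm_num), one_div, inv_mul_cancel₀ hε.ne', Real.rpow_one]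
          _ ≤ _ := Real.rpow_le_rpow (by positivity) hp' hε.le
      have h2 : (2 : ℝ) ^ v ≤ ((p : ℝ) ^ ε) ^ v := by gcongr
      have h3 : (v : ℝ) + 1 ≤ 2 ^ v := by
        have := Nat.lt_two_pow_self (n := v)
        exact_mod_cast this
      linarith
  refine ⟨K ^ P, one_le_pow₀ hK1, fun n hn => ?_⟩
  rw [Nat.card_divisors hn]
  push_cast
  have h1 : ∏ p ∈ n.primeFactors, ((n.factorization p : ℝ) + 1) ≤
      ∏ p ∈ n.primeFactors, ((if p < P then K else 1) * ((p : ℝ) ^ ε) ^ (n.factorization p)) :=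
    Finset.prod_le_prod (fun p _ => by positivity)
      (fun p hp => hbase p (Nat.prime_of_mem_primeFactors hp) _)
  refine h1.trans ?_
  rw [Finset.prod_mul_distrib]
  have h2 : ∏ p ∈ n.primeFactors, ((p : ℝ) ^ ε) ^ (n.factorization p) = (n : ℝ) ^ ε := by
    conv_rhs => rw [← Nat.prod_factorization_pow_eq_self hn]
    rw [Finsupp.prod, Nat.support_factorization]
    push_cast
    rw [← Real.finsetProd_rpow _ _ (fun i _ => by positivity)]
    refine Finset.prod_congr rfl fun p _ => ?_
    rw [← Real.rpow_natCast, ← Real.rpow_natCast, ← Real.rpow_mul (by positivity),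
      ← Real.rpow_mul (by positivity), mul_comm]
  rw [h2]
  gcongr
  rw [Finset.prod_ite, Finset.prod_const, Finset.prod_const_one, mul_one]
  apply pow_le_pow_right₀ hK1
  calc _ ≤ #(Finset.range P) := Finset.card_le_card (fun p hp => by
        simp only [Finset.mem_filter] at hp; exact Finset.mem_range.mpr hp.2)
    _ = P := Finset.card_range P

/-- A natural number is powerful if each of its prime divisors divides it at least twice. -/
def IsPowerful (n : ℕ) : Prop := ∀ p : ℕ, p.Prime → p ∣ n → p ^ 2 ∣ n

lemma IsPowerful.exists_eq_sq_mul {n : ℕ} (hn : IsPowerful n) (hn0 : n ≠ 0) :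
    ∃ a b : ℕ, b ^ 2 * a = n ∧ a ∣ b := by
  obtain ⟨a, b, h, hsq⟩ := Nat.sq_mul_squarefree n
  have ha0 : a ≠ 0 := hsq.ne_zero
  have hb0 : b ≠ 0 := by rintro rfl; simp at h; exact hn0 h.symm
  refine ⟨a, b, h, ?_⟩
  have hsub : a.primeFactors ⊆ b.primeFactors := by
    intro p hp
    have hpp := Nat.prime_of_mem_primeFactors hp
    have hpa := Nat.dvd_of_mem_primeFactors hp
    rw [Nat.mem_primeFactors]
    refine ⟨hpp, ?_, hb0⟩
    by_contra hpb
    have h2 : p ^ 2 ∣ b ^ 2 * a := h ▸ hn p hpp (h ▸ hpa.mul_left _)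
    have hco : Nat.Coprime (p ^ 2) (b ^ 2) :=
      Nat.Coprime.pow 2 2 ((Nat.Prime.coprime_iff_not_dvd hpp).mpr hpb)
    have h3 := hco.dvd_of_dvd_mul_left h2
    rw [sq] at h3
    exact hpp.one_lt.ne' (Nat.isUnit_iff.mp (hsq p h3))
  rw [← Nat.prod_primeFactors_of_squarefree hsq]
  exact (Finset.prod_dvd_prod_of_subset _ _ _ hsub).trans (Nat.prod_primeFactors_dvd b)

open Classical in
lemma card_powerful_le {ε : ℝ} (hε : 0 < ε) :
    ∃ C : ℝ, 1 ≤ C ∧ ∀ B Y : ℕ, Y ≤ B ^ 2 →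
      (#{n ∈ Icc 1 Y | IsPowerful n} : ℝ) ≤ C * (B : ℝ) ^ (1 + ε) := by
  obtain ⟨C, hC1, hC⟩ := card_divisors_le_rpow hε
  refine ⟨C, hC1, fun B Y hBY => ?_⟩
  have hsub : {n ∈ Icc 1 Y | IsPowerful n} ⊆
      (Icc 1 B).biUnion fun b => b.divisors.image fun a => b ^ 2 * a := by
    intro n hn
    simp only [mem_filter, mem_Icc] at hn
    obtain ⟨a, b, h, hab⟩ := hn.2.exists_eq_sq_mul (by omega)
    have hb0 : b ≠ 0 := by rintro rfl; simp at h; omega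
    have ha0 : a ≠ 0 := by rintro rfl; simp at h; omega
    simp only [mem_biUnion, mem_image, mem_Icc, Nat.mem_divisors]
    refine ⟨b, ⟨by omega, ?_⟩, a, ⟨hab, hb0⟩, h⟩
    have h1 : b ^ 2 ≤ B ^ 2 := by
      calc b ^ 2 ≤ b ^ 2 * a := Nat.le_mul_of_pos_right _ (by omega)
        _ ≤ B ^ 2 := by rw [h]; omega
    exact (Nat.pow_le_pow_iff_left (by norm_num)).mp h1
  calc (#{n ∈ Icc 1 Y | IsPowerful n} : ℝ)
      ≤ ∑ b ∈ Icc 1 B, (#b.divisors : ℝ) := by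
        have := (card_le_card hsub).trans card_biUnion_le
        have h2 := this.trans (sum_le_sum fun b _ => card_image_le)
        exact_mod_cast h2
    _ ≤ ∑ b ∈ Icc 1 B, C * (B : ℝ) ^ ε := by
        refine sum_le_sum fun b hb => ?_
        rw [mem_Icc] at hb
        refine (hC b (by omega)).trans ?_
        have : (b : ℝ) ≤ B := by exact_mod_cast hb.2
        gcongr
    _ = C * (B : ℝ) ^ (1 + ε) := by
        rw [sum_const, Nat.card_Icc, nsmul_eq_mul]
        rcases Nat.eq_zero_or_pos B with rfl | hB
        · simp [Real.zero_rpow (by positivity : (1 + ε) ≠ 0)]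
        · rw [Real.rpow_add (by exact_mod_cast hB), Real.rpow_one]
          push_cast [Nat.add_sub_cancel]
          ring

lemma isPowerful_prod_of_sum_inv_eq_zero {ι : Type*} [Fintype ι] [DecidableEq ι]
    {σ : ι → ℤ} (hσ : ∀ i, |σ i| = 1) {x : ι → ℕ} {U q : ℕ} [Fact q.Prime]
    (hx : ∀ i, x i ∈ Icc 1 U) (hU : U < q)
    (hq : Fintype.card ι * U ^ (Fintype.card ι - 1) < q)
    (hs : ∑ i, (σ i : ZMod q) * (x i : ZMod q)⁻¹ = 0) : IsPowerful (∏ i, x i) := by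
  set Z : ℤ := ∑ i, σ i * ((∏ j ∈ univ.erase i, x j : ℕ) : ℤ) with hZ
  have hxq : ∀ i, (x i : ZMod q) ≠ 0 := by
    intro i h
    rw [ZMod.natCast_eq_zero_iff] at h
    have := hx i
    rw [mem_Icc] at this
    have := Nat.le_of_dvd (by omega) h
    omega
  have hZq : (Z : ZMod q) = 0 := by
    have : (Z : ZMod q) = (∏ i, (x i : ZMod q)) * ∑ i, (σ i : ZMod q) * (x i : ZMod q)⁻¹ := by
      rw [hZ]
      push_cast
      rw [mul_sum]
      refine sum_congr rfl fun i _ => ?_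
      rw [← mul_prod_erase univ (fun j => (x j : ZMod q)) (mem_univ i)]
      have := hxq i
      field_simp
    rw [this, hs, mul_zero]
  have hZabs : |Z| < q := by
    calc |Z| ≤ ∑ i, |σ i * ((∏ j ∈ univ.erase i, x j : ℕ) : ℤ)| := abs_sum_le_sum_abs _ _
      _ ≤ ∑ i : ι, ((U ^ (Fintype.card ι - 1) : ℕ) : ℤ) := by
          refine sum_le_sum fun i _ => ?_
          rw [abs_mul, hσ, one_mul, Nat.abs_cast]
          have : ∏ j ∈ univ.erase i, x j ≤ ∏ j ∈ univ.erase i, U :=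
            prod_le_prod' fun j _ => (mem_Icc.mp (hx j)).2
          rw [prod_const, card_erase_of_mem (mem_univ i), card_univ] at this
          exact_mod_cast this
      _ < q := by
          rw [sum_const, card_univ, nsmul_eq_mul]
          exact_mod_cast hq
  have hZ0 : Z = 0 := by
    rw [ZMod.intCast_zmod_eq_zero_iff_dvd] at hZq
    exact Int.eq_zero_of_abs_lt_dvd hZq hZabs
  intro p hp hdvd
  obtain ⟨i, -, hi⟩ := (Prime.dvd_finsetProd_iff hp.prime _).mp hdvd
  have h1 : (p : ℤ) ∣ σ i * ((∏ j ∈ univ.erase i, x j : ℕ) : ℤ) := by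
    have h2 : σ i * ((∏ j ∈ univ.erase i, x j : ℕ) : ℤ) =
        Z - ∑ l ∈ univ.erase i, σ l * ((∏ j ∈ univ.erase l, x j : ℕ) : ℤ) := by
      rw [hZ, ← add_sum_erase univ _ (mem_univ i)]; ring
    rw [h2, hZ0, zero_sub, dvd_neg]
    refine dvd_sum fun l hl => Dvd.dvd.mul_left ?_ _
    have hmem : i ∈ univ.erase l := by simp at hl ⊢; exact fun h => hl h.symm
    exact_mod_cast hi.trans (dvd_prod_of_mem x hmem)
  have h2 : p ∣ ∏ j ∈ univ.erase i, x j := by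
    have h3 : IsUnit (σ i) := Int.isUnit_iff_abs_eq.mpr (hσ i)
    exact_mod_cast h3.dvd_mul_left.mp h1
  rw [← mul_prod_erase univ x (mem_univ i), sq]
  exact mul_dvd_mul hi h2

/-- The number of solutions of `∑ 1/u_i ≡ ∑ 1/w_i (mod q)` with `u, w ∈ S ^ k`. -/
noncomputable def recipEnergy (q k : ℕ) (S : Finset ℕ) : ℕ :=
  #{z ∈ (Fintype.piFinset fun _ : Fin k => S) ×ˢ (Fintype.piFinset fun _ : Fin k => S) |
    ∑ i, (z.1 i : ZMod q)⁻¹ = ∑ i, (z.2 i : ZMod q)⁻¹}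

open Classical in
lemma card_prod_isPowerful_le (m : ℕ) {ε : ℝ} (hε : 0 < ε) :
    ∃ C : ℝ, 1 ≤ C ∧ ∀ (ι : Type) [Fintype ι] [DecidableEq ι], Fintype.card ι = 2 * m →
      ∀ U : ℕ, 1 ≤ U →
      (#{x ∈ Fintype.piFinset fun _ : ι => Icc 1 U | IsPowerful (∏ i, x i)} : ℝ)
        ≤ C * (U : ℝ) ^ ((m : ℝ) + ε) := by
  obtain ⟨e, he, hee⟩ : ∃ e : ℝ, 0 < e ∧ m * e + (2 * m) * (e * (2 * m)) ≤ ε := by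
    refine ⟨ε / (m + 4 * m ^ 2 + 1), by positivity, ?_⟩
    have : m * (ε / (m + 4 * m ^ 2 + 1)) + (2 * m) * (ε / (m + 4 * m ^ 2 + 1) * (2 * m))
      = ε * ((m + 4 * m ^ 2) / (m + 4 * m ^ 2 + 1)) := by ring
    rw [this]
    have h1 : ((m : ℝ) + 4 * m ^ 2) / (m + 4 * m ^ 2 + 1) ≤ 1 := by
      rw [div_le_one (by positivity)]; linarith
    nlinarith
  obtain ⟨C1, hC1, h1⟩ := card_powerful_le he
  obtain ⟨C2, hC2, h2⟩ := card_divisors_le_rpow he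
  refine ⟨C1 * C2 ^ (2 * m), one_le_mul_of_one_le_of_one_le hC1 (one_le_pow₀ hC2), ?_⟩
  intro ι _ _ hι U hU
  have hU1 : (1 : ℝ) ≤ U := by exact_mod_cast hU
  have hsub : {x ∈ Fintype.piFinset fun _ : ι => Icc 1 U | IsPowerful (∏ i, x i)} ⊆
      ({n ∈ Icc 1 (U ^ (2 * m)) | IsPowerful n}).biUnion
        fun n => Fintype.piFinset fun _ : ι => n.divisors := by
    intro x hx
    simp only [mem_filter, Fintype.mem_piFinset, mem_Icc] at hx
    simp only [mem_biUnion, mem_filter, mem_Icc, Fintype.mem_piFinset, Nat.mem_divisors]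
    have hpos : 0 < ∏ i, x i := prod_pos fun i _ => (hx.1 i).1
    refine ⟨∏ i, x i, ⟨⟨hpos, ?_⟩, hx.2⟩, fun i => ⟨dvd_prod_of_mem x (mem_univ i), hpos.ne'⟩⟩
    calc ∏ i, x i ≤ ∏ _i : ι, U := prod_le_prod' fun i _ => (hx.1 i).2
      _ = U ^ (2 * m) := by rw [prod_const, card_univ, hι]
  calc _ ≤ ∑ n ∈ {n ∈ Icc 1 (U ^ (2 * m)) | IsPowerful n}, (#n.divisors : ℝ) ^ (2 * m) := by
        have := (card_le_card hsub).trans card_biUnion_le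
        simp only [Fintype.card_piFinset, prod_const, card_univ, hι] at this
        exact_mod_cast this
    _ ≤ ∑ n ∈ {n ∈ Icc 1 (U ^ (2 * m)) | IsPowerful n},
          C2 ^ (2 * m) * (U : ℝ) ^ ((2 * m) * (e * (2 * m))) := by
        refine sum_le_sum fun n hn => ?_
        simp only [mem_filter, mem_Icc] at hn
        have h3 := h2 n (by omega)
        have h4 : (n : ℝ) ^ e ≤ (U : ℝ) ^ ((2 * m) * e) := by
          rw [Real.rpow_mul (by positivity)]
          refine Real.rpow_le_rpow (by positivity) ?_ he.le
          have : (n : ℝ) ≤ (U : ℝ) ^ (2 * m) := by exact_mod_cast hn.1.2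
          exact_mod_cast this
        calc (#n.divisors : ℝ) ^ (2 * m) ≤ (C2 * (U : ℝ) ^ ((2 * m) * e)) ^ (2 * m) := by
              gcongr; exact h3.trans (by gcongr)
          _ = _ := by
              rw [mul_pow, ← Real.rpow_natCast (_ ^ _), ← Real.rpow_mul (by positivity)]
              push_cast; ring_nf
    _ ≤ (C1 * ((U ^ m : ℕ) : ℝ) ^ (1 + e)) *
          (C2 ^ (2 * m) * (U : ℝ) ^ ((2 * m) * (e * (2 * m)))) := by
        rw [sum_const, nsmul_eq_mul]
        gcongr
        exact h1 (U ^ m) (U ^ (2 * m)) (by rw [← pow_mul, mul_comm])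
    _ = C1 * C2 ^ (2 * m) * (U : ℝ) ^ ((m : ℝ) + (m * e + (2 * m) * (e * (2 * m)))) := by
        have : ((U ^ m : ℕ) : ℝ) ^ (1 + e) = (U : ℝ) ^ ((m : ℝ) + m * e) := by
          push_cast
          rw [← Real.rpow_natCast, ← Real.rpow_mul (by positivity)]; ring_nf
        rw [this, ← add_assoc (m : ℝ), Real.rpow_add (x := (U : ℝ)) (by positivity)
          ((m : ℝ) + m * e)]
        ring
    _ ≤ _ := by
        gcongr

lemma recipEnergy_le {k : ℕ} (hk : 1 ≤ k) {ε : ℝ} (hε : 0 < ε) :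
    ∃ C : ℝ, 1 ≤ C ∧ ∀ (U q : ℕ) (S : Finset ℕ), q.Prime → 1 ≤ U → S ⊆ Icc 1 U →
      2 * k * U ^ (2 * k - 1) < q → (recipEnergy q k S : ℝ) ≤ C * (U : ℝ) ^ ((k : ℝ) + ε) := by
  classical
  obtain ⟨C, hC1, hC⟩ := card_prod_isPowerful_le k hε
  refine ⟨C, hC1, fun U q S hq hU1 hS hUq => ?_⟩
  have := Fact.mk hq
  have hcard : Fintype.card (Fin k ⊕ Fin k) = 2 * k := by simp; ring
  refine le_trans ?_ (hC (Fin k ⊕ Fin k) hcard U hU1)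
  have hU : U < q := by
    refine lt_of_le_of_lt ?_ hUq
    calc U = 1 * U ^ 1 := by ring
      _ ≤ 2 * k * U ^ (2 * k - 1) := by
        refine Nat.mul_le_mul (by omega) (Nat.pow_le_pow_right hU1 (by omega))
  have : recipEnergy q k S ≤
      #{x ∈ Fintype.piFinset fun _ : Fin k ⊕ Fin k => Icc 1 U | IsPowerful (∏ i, x i)} := by
    unfold recipEnergy
    refine card_le_card_of_injOn (fun z => Sum.elim z.1 z.2) ?_ ?_
    · intro z hz
      simp only [coe_filter, mem_product, Fintype.mem_piFinset, Set.mem_ofPred_eq] at hz ⊢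
      have hmem : ∀ i, Sum.elim z.1 z.2 i ∈ Icc 1 U := by
        rintro (i | i)
        · exact hS (hz.1.1 i)
        · exact hS (hz.1.2 i)
      refine ⟨hmem, isPowerful_prod_of_sum_inv_eq_zero (q := q) (U := U)
        (σ := Sum.elim (fun _ => 1) (fun _ => -1)) ?_ hmem hU (by rwa [hcard]) ?_⟩
      · rintro (i | i) <;> simp
      · rw [Fintype.sum_sum_type]
        simp [hz.2]
    · intro z _ w _ h
      have h' := Sum.elim_eq_iff.mp h
      exact Prod.ext h'.1 h'.2
  exact_mod_cast this

lemma sum_card_fiber_sq {α β : Type*} [Fintype β] [DecidableEq β] [DecidableEq α] (G : Finset α)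
    (f : α → β) :
    ∑ b, #{g ∈ G | f g = b} ^ 2 = #{z ∈ G ×ˢ G | f z.1 = f z.2} := by
  rw [card_eq_sum_card_fiberwise (f := fun z => f z.1) (t := univ) (fun _ _ => by simp)]
  refine sum_congr rfl fun b _ => ?_
  rw [sq, ← card_product]
  congr 1
  ext z
  simp only [mem_product, mem_filter]
  constructor
  · rintro ⟨⟨h1, h2⟩, h3, h4⟩
    exact ⟨⟨⟨h1, h3⟩, h2.trans h4.symm⟩, h2⟩
  · rintro ⟨⟨⟨h1, h2⟩, h3⟩, h4⟩
    exact ⟨⟨h1, h4⟩, h2, h3.symm.trans h4⟩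

lemma sum_normSq_le {q : ℕ} [Fact q.Prime] {α : Type*} [DecidableEq α] (G : Finset α) (c : α → ℂ)
    (hc : ∀ g ∈ G, ‖c g‖ ≤ 1) (μ : α → ZMod q) {A : ZMod q} (hA : A ≠ 0) :
    ∑ t : ZMod q, ‖∑ g ∈ G, c g * ZMod.stdAddChar (A * μ g * t)‖ ^ 2 ≤
      q * (#{z ∈ G ×ˢ G | μ z.1 = μ z.2} : ℝ) := by
  have key : ((∑ t : ZMod q, ‖∑ g ∈ G, c g * ZMod.stdAddChar (A * μ g * t)‖ ^ 2 : ℝ) : ℂ) =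
      q * ∑ z ∈ {z ∈ G ×ˢ G | μ z.1 = μ z.2}, c z.1 * (starRingEnd ℂ) (c z.2) := by
    push_cast
    have h1 : ∀ t : ZMod q, (‖∑ g ∈ G, c g * ZMod.stdAddChar (A * μ g * t)‖ : ℂ) ^ 2 =
        ∑ z ∈ G ×ˢ G, c z.1 * (starRingEnd ℂ) (c z.2) *
          ZMod.stdAddChar (t * (A * (μ z.1 - μ z.2))) := by
      intro t
      rw [← Complex.mul_conj', map_sum, sum_mul_sum, ← sum_product']
      refine sum_congr rfl fun z _ => ?_
      rw [(starRingEnd ℂ).map_mul, ← AddChar.map_neg_eq_conj]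
      have : (ZMod.stdAddChar (t * (A * (μ z.1 - μ z.2))) : ℂ) =
        ZMod.stdAddChar (A * μ z.1 * t) * ZMod.stdAddChar (-(A * μ z.2 * t)) := by
        rw [← AddChar.map_add_eq_mul]; congr 1; ring
      rw [this]; ring
    simp_rw [h1]
    rw [sum_comm, mul_sum, sum_filter]
    refine sum_congr rfl fun z _ => ?_
    rw [← mul_sum, AddChar.sum_mulShift _ (ZMod.isPrimitive_stdAddChar q)]
    have : A * (μ z.1 - μ z.2) = 0 ↔ μ z.1 = μ z.2 := by
      rw [mul_eq_zero, sub_eq_zero]; simp [hA]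
    simp only [this]
    split_ifs
    · rw [ZMod.card]; ring
    · simp
  have h2 : ‖((∑ t : ZMod q, ‖∑ g ∈ G, c g * ZMod.stdAddChar (A * μ g * t)‖ ^ 2 : ℝ) : ℂ)‖ ≤
      q * (#{z ∈ G ×ˢ G | μ z.1 = μ z.2} : ℝ) := by
    rw [key, norm_mul, Complex.norm_natCast]
    gcongr
    refine (norm_sum_le _ _).trans ?_
    rw [card_eq_sum_ones]
    push_cast
    refine sum_le_sum fun z hz => ?_
    simp only [mem_filter, mem_product] at hz
    rw [norm_mul, RCLike.norm_conj]
    exact mul_le_one₀ (hc _ hz.1.1) (norm_nonneg _) (hc _ hz.1.2)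
  refine le_trans ?_ h2
  rw [Complex.norm_real]
  exact le_abs_self _

lemma sum_pow_le_card_pow_mul {α : Type*} (s : Finset α) {f : α → ℝ} (hf : ∀ i ∈ s, 0 ≤ f i)
    {k : ℕ} (hk : 1 ≤ k) :
    (∑ i ∈ s, f i) ^ k ≤ (#s : ℝ) ^ (k - 1) * ∑ i ∈ s, f i ^ k := by
  obtain ⟨n, rfl⟩ : ∃ n, k = n + 1 := ⟨k - 1, by omega⟩
  rcases s.eq_empty_or_nonempty with rfl | hs
  · simp
  have h := pow_sum_div_card_le_sum_pow hf n
  rw [div_le_iff₀ (by have := hs.card_pos; positivity)] at h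
  rw [Nat.add_sub_cancel, mul_comm]
  exact h

lemma sum_mul_addChar_pow {q : ℕ} [NeZero q] (S : Finset ℕ) (b : ℕ → ℂ) (B : ZMod q) (l : ℕ) :
    (∑ v ∈ S, b v * ZMod.stdAddChar (B * (v : ZMod q)⁻¹)) ^ l =
      ∑ g ∈ Fintype.piFinset fun _ : Fin l => S, (∏ i, b (g i)) *
        ZMod.stdAddChar (B * ∑ i, (g i : ZMod q)⁻¹) := by
  have : (∑ v ∈ S, b v * ZMod.stdAddChar (B * (v : ZMod q)⁻¹)) ^ l =
      ∏ _i : Fin l, ∑ v ∈ S, b v * ZMod.stdAddChar (B * (v : ZMod q)⁻¹) := by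
    rw [prod_const, card_univ, Fintype.card_fin]
  rw [this, prod_univ_sum]
  refine sum_congr rfl fun g _ => ?_
  rw [prod_mul_distrib, mul_sum]
  congr 1
  exact (map_prod (ZMod.stdAddChar (N := q)).toMonoidHom
    (fun i => Multiplicative.ofAdd (B * (g i : ZMod q)⁻¹)) univ).symm

lemma norm_prod_le_one {ι : Type*} [Fintype ι] {S : Finset ℕ} {b : ℕ → ℂ}
    (hb : ∀ v ∈ S, ‖b v‖ ≤ 1) {g : ι → ℕ} (hg : ∀ i, g i ∈ S) : ‖∏ i, b (g i)‖ ≤ 1 := by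
  rw [norm_prod]
  exact prod_le_one (fun _ _ => norm_nonneg _) fun i _ => hb _ (hg i)

lemma norm_bilinear_pow_le {q : ℕ} [Fact q.Prime] {A : ZMod q} (hA : A ≠ 0) (S T : Finset ℕ)
    {a b : ℕ → ℂ} (ha : ∀ u ∈ S, ‖a u‖ ≤ 1) (hb : ∀ v ∈ T, ‖b v‖ ≤ 1) {k l : ℕ}
    (hk : 1 ≤ k) (hl : 1 ≤ l) :
    ‖∑ u ∈ S, ∑ v ∈ T, a u * b v * ZMod.stdAddChar (A * (u : ZMod q)⁻¹ * (v : ZMod q)⁻¹)‖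
        ^ (2 * k * l) ≤
      (#S : ℝ) ^ (2 * k * (l - 1)) * (#T : ℝ) ^ (2 * l * (k - 1)) *
        (q * recipEnergy q k S * recipEnergy q l T) := by
  classical
  set F : ℕ → ℂ := fun u => ∑ v ∈ T, b v * ZMod.stdAddChar (A * (u : ZMod q)⁻¹ * (v : ZMod q)⁻¹)
    with hF
  have hph : ∀ z : ℂ, ∃ c : ℂ, ‖c‖ ≤ 1 ∧ (‖z‖ : ℂ) = c * z := by
    intro z
    rcases eq_or_ne z 0 with rfl | hz
    · exact ⟨0, by simp, by simp⟩
    · refine ⟨(starRingEnd ℂ) z / ‖z‖, ?_, ?_⟩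
      · rw [norm_div, RCLike.norm_conj, Complex.norm_real, norm_norm,
          div_self (norm_ne_zero_iff.mpr hz)]
      · have : (‖z‖ : ℂ) ≠ 0 := by exact_mod_cast norm_ne_zero_iff.mpr hz
        field_simp
        rw [mul_comm, Complex.mul_conj']
  choose c hc1 hc using hph
  set P := Fintype.piFinset fun _ : Fin l => T with hP
  set lam : (Fin l → ℕ) → ZMod q := fun g => ∑ i, (g i : ZMod q)⁻¹ with hlam
  set H : ZMod q → ℂ := fun t => ∑ u ∈ S, (c (F u)) ^ l * ZMod.stdAddChar (A * t * (u : ZMod q)⁻¹)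
    with hH
  have hcl : ∀ u ∈ S, ‖(c (F u)) ^ l‖ ≤ 1 := fun u _ => by
    rw [norm_pow]; exact pow_le_one₀ (norm_nonneg _) (hc1 _)
  have s1 : ‖∑ u ∈ S, ∑ v ∈ T, a u * b v *
      ZMod.stdAddChar (A * (u : ZMod q)⁻¹ * (v : ZMod q)⁻¹)‖ ≤ ∑ u ∈ S, ‖F u‖ := by
    refine (norm_sum_le _ _).trans (sum_le_sum fun u hu => ?_)
    have : ∑ v ∈ T, a u * b v * ZMod.stdAddChar (A * (u : ZMod q)⁻¹ * (v : ZMod q)⁻¹)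
        = a u * F u := by
      rw [hF, mul_sum]; exact sum_congr rfl fun v _ => by ring
    rw [this, norm_mul]
    exact mul_le_of_le_one_left (norm_nonneg _) (ha u hu)
  have s2 := sum_pow_le_card_pow_mul S (f := fun u => ‖F u‖) (fun _ _ => norm_nonneg _) hl
  have s3 : ∑ u ∈ S, ‖F u‖ ^ l ≤ ∑ g ∈ P, ‖H (lam g)‖ := by
    have e1 : ((∑ u ∈ S, ‖F u‖ ^ l : ℝ) : ℂ) = ∑ g ∈ P, (∏ i, b (g i)) * H (lam g) := by
      push_cast
      have : ∀ u ∈ S, (‖F u‖ : ℂ) ^ l = ∑ g ∈ P, (c (F u)) ^ l * ((∏ i, b (g i)) *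
          ZMod.stdAddChar (A * (u : ZMod q)⁻¹ * lam g)) := by
        intro u _
        rw [hc (F u), mul_pow, hF, sum_mul_addChar_pow, mul_sum]
      rw [sum_congr rfl this, sum_comm]
      refine sum_congr rfl fun g _ => ?_
      rw [hH, mul_sum]
      refine sum_congr rfl fun u _ => ?_
      rw [mul_right_comm A]; ring
    have e2 : ‖((∑ u ∈ S, ‖F u‖ ^ l : ℝ) : ℂ)‖ ≤ ∑ g ∈ P, ‖H (lam g)‖ := by
      rw [e1]
      refine (norm_sum_le _ _).trans (sum_le_sum fun g hg => ?_)
      rw [norm_mul]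
      exact mul_le_of_le_one_left (norm_nonneg _)
        (norm_prod_le_one hb (Fintype.mem_piFinset.mp hg))
    refine le_trans ?_ e2
    rw [Complex.norm_real]
    exact le_abs_self _
  have s4 := sum_pow_le_card_pow_mul P (f := fun g => ‖H (lam g)‖) (fun _ _ => norm_nonneg _) hk
  have hPc : (#P : ℝ) = (#T : ℝ) ^ l := by
    rw [hP, Fintype.card_piFinset]; simp
  have s5 : (∑ g ∈ P, ‖H (lam g)‖ ^ k) ^ 2 ≤ q * recipEnergy q k S * recipEnergy q l T := by
    have e1 : ∑ g ∈ P, ‖H (lam g)‖ ^ k =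
        ∑ t : ZMod q, (#{g ∈ P | lam g = t} : ℝ) * ‖H t‖ ^ k := by
      rw [← sum_fiberwise P lam]
      refine sum_congr rfl fun t _ => ?_
      rw [card_eq_sum_ones]
      push_cast
      rw [sum_mul]
      refine sum_congr rfl fun g hg => ?_
      rw [(mem_filter.mp hg).2, one_mul]
    have e2 : (∑ t : ZMod q, (#{g ∈ P | lam g = t} : ℝ) ^ 2) = recipEnergy q l T := by
      have := sum_card_fiber_sq P lam
      unfold recipEnergy
      exact_mod_cast this
    have e3 : ∑ t : ZMod q, (‖H t‖ ^ k) ^ 2 ≤ q * recipEnergy q k S := by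
      have := sum_normSq_le (q := q) (Fintype.piFinset fun _ : Fin k => S)
        (fun g => ∏ i, (c (F (g i))) ^ l)
        (fun g hg => norm_prod_le_one (b := fun u => c (F u) ^ l) hcl (Fintype.mem_piFinset.mp hg))
        (fun g => ∑ i, (g i : ZMod q)⁻¹) hA
      unfold recipEnergy
      refine le_trans (le_of_eq ?_) this
      refine sum_congr rfl fun t _ => ?_
      rw [← norm_pow, hH]
      simp only
      rw [sum_mul_addChar_pow S (fun u => c (F u) ^ l)]
      congr 2
      refine sum_congr rfl fun g _ => ?_
      rw [mul_right_comm A]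
    rw [e1]
    refine (sum_mul_sq_le_sq_mul_sq _ _ _).trans ?_
    rw [e2, mul_comm]
    gcongr
  calc _ ≤ (∑ u ∈ S, ‖F u‖) ^ (2 * k * l) := by gcongr
    _ = ((∑ u ∈ S, ‖F u‖) ^ l) ^ (2 * k) := by rw [← pow_mul]; ring_nf
    _ ≤ ((#S : ℝ) ^ (l - 1) * ∑ g ∈ P, ‖H (lam g)‖) ^ (2 * k) := by
        refine pow_le_pow_left₀ (by positivity) (s2.trans ?_) _
        gcongr
    _ = (#S : ℝ) ^ (2 * k * (l - 1)) * ((∑ g ∈ P, ‖H (lam g)‖) ^ k) ^ 2 := by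
        rw [mul_pow, ← pow_mul, ← pow_mul]; ring_nf
    _ ≤ (#S : ℝ) ^ (2 * k * (l - 1)) *
          (((#T : ℝ) ^ l) ^ (k - 1) * ∑ g ∈ P, ‖H (lam g)‖ ^ k) ^ 2 := by
        rw [hPc] at s4
        gcongr
    _ = (#S : ℝ) ^ (2 * k * (l - 1)) * (#T : ℝ) ^ (2 * l * (k - 1)) *
          (∑ g ∈ P, ‖H (lam g)‖ ^ k) ^ 2 := by
        rw [mul_pow, ← pow_mul, ← pow_mul]; ring_nf
    _ ≤ _ := by gcongr

lemma four_mul_le_norm_stdAddChar_sub_one {q : ℕ} [NeZero q] (h : ZMod q) :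
    4 * (h.valMinAbs.natAbs : ℝ) / q ≤ ‖(ZMod.stdAddChar h : ℂ) - 1‖ := by
  have hq : (0 : ℝ) < q := by exact_mod_cast Nat.pos_of_ne_zero (NeZero.ne q)
  have h1 : (ZMod.stdAddChar h : ℂ) =
      Complex.exp (Complex.I * ((2 * Real.pi * h.valMinAbs / q : ℝ) : ℂ)) := by
    conv_lhs => rw [← ZMod.coe_valMinAbs h]
    rw [ZMod.stdAddChar_coe]
    congr 1
    push_cast
    ring
  rw [h1, Complex.norm_exp_I_mul_ofReal_sub_one, norm_mul, Real.norm_eq_abs, Real.norm_eq_abs,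
    abs_two]
  have hb : |2 * Real.pi * h.valMinAbs / q / 2| ≤ Real.pi / 2 := by
    have h2 : ((2 * h.valMinAbs.natAbs : ℕ) : ℝ) ≤ q := by
      have := ZMod.natAbs_valMinAbs_le h
      exact_mod_cast (by omega : 2 * h.valMinAbs.natAbs ≤ q)
    have h3 : |(h.valMinAbs : ℝ)| = (h.valMinAbs.natAbs : ℝ) := by
      rw [Nat.cast_natAbs, Int.cast_abs]
    have : 2 * Real.pi * h.valMinAbs / q / 2 = Real.pi * (h.valMinAbs / q) := by ring
    rw [this, abs_mul, abs_of_pos Real.pi_pos, abs_div, h3, abs_of_pos hq]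
    have : (h.valMinAbs.natAbs : ℝ) / q ≤ 1 / 2 := by
      rw [div_le_div_iff₀ hq (by norm_num)]; push_cast at h2; linarith
    nlinarith [Real.pi_pos]
  have := Real.mul_abs_le_abs_sin hb
  have h3 : |(h.valMinAbs : ℝ)| = (h.valMinAbs.natAbs : ℝ) := by
    rw [Nat.cast_natAbs, Int.cast_abs]
  have h4 : 2 / Real.pi * |2 * Real.pi * h.valMinAbs / q / 2| = 2 * h.valMinAbs.natAbs / q := by
    have : 2 * Real.pi * h.valMinAbs / q / 2 = Real.pi * (h.valMinAbs / q) := by ring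
    rw [this, abs_mul, abs_of_pos Real.pi_pos, abs_div, h3, abs_of_pos hq]
    have := Real.pi_pos.ne'
    field_simp
  rw [h4] at this
  calc 4 * (h.valMinAbs.natAbs : ℝ) / q = 2 * (2 * h.valMinAbs.natAbs / q) := by ring
    _ ≤ _ := by gcongr

lemma norm_sum_Icc_stdAddChar_le {q : ℕ} [NeZero q] (h : ZMod q) (hh : h ≠ 0) (M : ℕ) :
    ‖∑ m ∈ Icc 1 M, (ZMod.stdAddChar (h * (m : ZMod q)) : ℂ)‖ ≤
      q / (2 * (h.valMinAbs.natAbs : ℝ)) := by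
  have hq : (0 : ℝ) < q := by exact_mod_cast Nat.pos_of_ne_zero (NeZero.ne q)
  have hr : (0 : ℝ) < h.valMinAbs.natAbs := by
    have : h.valMinAbs ≠ 0 := by simpa using hh
    exact_mod_cast Int.natAbs_pos.mpr this
  have hlow := four_mul_le_norm_stdAddChar_sub_one h
  have hpow : ∀ m : ℕ, (ZMod.stdAddChar (h * (m : ZMod q)) : ℂ) = (ZMod.stdAddChar h) ^ m := by
    intro m
    rw [← AddChar.map_nsmul_eq_pow, nsmul_eq_mul, mul_comm]
  have hg : (∑ m ∈ Icc 1 M, (ZMod.stdAddChar (h * (m : ZMod q)) : ℂ)) *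
      (ZMod.stdAddChar h - 1) = ZMod.stdAddChar h * (ZMod.stdAddChar h ^ M - 1) := by
    simp_rw [hpow]
    rw [← geom_sum_mul, ← mul_assoc, mul_sum, range_eq_Ico, sum_Ico_eq_sum_range]
    congr 1
    rw [← Ico_add_one_right_eq_Icc, sum_Ico_eq_sum_range]
    refine sum_congr rfl fun i _ => ?_
    rw [← pow_succ']
    congr 1; omega
  have hn : ‖(ZMod.stdAddChar h : ℂ)‖ = 1 := AddChar.norm_apply _ _
  have hup : ‖∑ m ∈ Icc 1 M, (ZMod.stdAddChar (h * (m : ZMod q)) : ℂ)‖ *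
      ‖(ZMod.stdAddChar h : ℂ) - 1‖ ≤ 2 := by
    rw [← norm_mul, hg, norm_mul, hn, one_mul]
    refine (norm_sub_le _ _).trans ?_
    rw [norm_pow, hn]; norm_num
  rw [le_div_iff₀ (by positivity)]
  have : ‖∑ m ∈ Icc 1 M, (ZMod.stdAddChar (h * (m : ZMod q)) : ℂ)‖ *
      (4 * (h.valMinAbs.natAbs : ℝ) / q) ≤ 2 :=
    (mul_le_mul_of_nonneg_left hlow (norm_nonneg _)).trans hup
  rw [mul_div_assoc', div_le_iff₀ hq] at this
  linarith

lemma sum_inv_natAbs_valMinAbs_le {q : ℕ} [NeZero q] :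
    ∑ h ∈ ({0}ᶜ : Finset (ZMod q)), ((h.valMinAbs.natAbs : ℝ))⁻¹ ≤ 2 * (1 + Real.log q) := by
  have h1 : ∀ h ∈ ({0}ᶜ : Finset (ZMod q)), ((h.valMinAbs.natAbs : ℝ))⁻¹ ≤
      (h.val : ℝ)⁻¹ + ((q - h.val : ℕ) : ℝ)⁻¹ := by
    intro h _
    rw [ZMod.valMinAbs_natAbs_eq_min]
    rcases min_choice h.val (q - h.val) with h' | h' <;> rw [h']
    · simp
    · exact le_add_of_nonneg_left (by positivity)
  have himg : ∀ f : ℕ → ℝ, ∑ h ∈ ({0}ᶜ : Finset (ZMod q)), f h.val = ∑ r ∈ Ico 1 q, f r := by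
    intro f
    refine sum_bij (fun h _ => h.val) ?_ ?_ ?_ ?_
    · intro h hh
      simp only [mem_compl, mem_singleton] at hh
      rw [mem_Ico]
      exact ⟨Nat.pos_of_ne_zero (by simpa using hh), ZMod.val_lt h⟩
    · intro _ _ _ _ h'; exact ZMod.val_injective q h'
    · intro r hr
      rw [mem_Ico] at hr
      refine ⟨(r : ZMod q), ?_, ZMod.val_cast_of_lt hr.2⟩
      simp only [mem_compl, mem_singleton]
      intro h0
      have := ZMod.val_cast_of_lt hr.2
      rw [h0, ZMod.val_zero] at this
      omega
    · intros; rfl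
  have hharm : ∑ r ∈ Ico 1 q, (r : ℝ)⁻¹ ≤ 1 + Real.log q := by
    have := harmonic_le_one_add_log q
    refine le_trans ?_ this
    rw [harmonic_eq_sum_Icc]
    push_cast
    refine sum_le_sum_of_subset_of_nonneg (fun r hr => ?_) fun _ _ _ => by positivity
    simp only [mem_Ico, mem_Icc] at hr ⊢; omega
  calc _ ≤ ∑ h ∈ ({0}ᶜ : Finset (ZMod q)), ((h.val : ℝ)⁻¹ + ((q - h.val : ℕ) : ℝ)⁻¹) :=
        sum_le_sum h1
    _ = ∑ r ∈ Ico 1 q, (r : ℝ)⁻¹ + ∑ r ∈ Ico 1 q, ((q - r : ℕ) : ℝ)⁻¹ := by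
        rw [himg fun r => (r : ℝ)⁻¹ + ((q - r : ℕ) : ℝ)⁻¹, sum_add_distrib]
    _ = ∑ r ∈ Ico 1 q, (r : ℝ)⁻¹ + ∑ r ∈ Ico 1 q, (r : ℝ)⁻¹ := by
        congr 1
        refine sum_bij (fun r _ => q - r) ?_ ?_ ?_ ?_
        · intro r hr; simp only [mem_Ico] at hr ⊢; omega
        · intro r hr r' hr'; simp only [mem_Ico] at hr hr'; omega
        · intro r hr; simp only [mem_Ico] at hr
          exact ⟨q - r, by simp only [mem_Ico]; omega, by omega⟩
        · intros; rfl
    _ ≤ _ := by linarith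

lemma sum_norm_sum_Icc_stdAddChar_le {q : ℕ} [NeZero q] (M : ℕ) :
    ∑ h ∈ ({0}ᶜ : Finset (ZMod q)), ‖∑ m ∈ Icc 1 M, (ZMod.stdAddChar (h * (m : ZMod q)) : ℂ)‖ ≤
      q * (1 + Real.log q) := by
  calc _ ≤ ∑ h ∈ ({0}ᶜ : Finset (ZMod q)), (q / 2 : ℝ) * ((h.valMinAbs.natAbs : ℝ))⁻¹ := by
        refine sum_le_sum fun h hh => (norm_sum_Icc_stdAddChar_le h (by simpa using hh) M).trans ?_
        rw [div_mul_eq_div_div, div_eq_mul_inv]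
    _ ≤ (q / 2 : ℝ) * (2 * (1 + Real.log q)) := by
        rw [← mul_sum]; gcongr; exact sum_inv_natAbs_valMinAbs_le
    _ = _ := by ring

lemma card_filter_eq_fourier {q : ℕ} [NeZero q] (M : ℕ) (c : ZMod q) :
    ((#{m ∈ Icc 1 M | ((m : ℕ) : ZMod q) = c} : ℝ) - M / q : ℂ) =
      (q : ℂ)⁻¹ * ∑ h ∈ ({0}ᶜ : Finset (ZMod q)),
        (∑ m ∈ Icc 1 M, (ZMod.stdAddChar (h * (m : ZMod q)) : ℂ)) * ZMod.stdAddChar (-h * c) := by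
  have hq : (q : ℂ) ≠ 0 := by exact_mod_cast NeZero.ne q
  have h1 : (q : ℂ) * (#{m ∈ Icc 1 M | ((m : ℕ) : ZMod q) = c} : ℂ) = ∑ h : ZMod q,
      (∑ m ∈ Icc 1 M, (ZMod.stdAddChar (h * (m : ZMod q)) : ℂ)) * ZMod.stdAddChar (-h * c) := by
    simp_rw [sum_mul]
    rw [sum_comm, card_eq_sum_ones]
    push_cast
    rw [mul_sum, sum_filter]
    refine sum_congr rfl fun m _ => ?_
    have : ∀ h : ZMod q, (ZMod.stdAddChar (h * (m : ZMod q)) : ℂ) * ZMod.stdAddChar (-h * c) =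
        ZMod.stdAddChar (h * ((m : ZMod q) - c)) := by
      intro h
      rw [← AddChar.map_add_eq_mul]; congr 1; ring
    simp_rw [this]
    rw [AddChar.sum_mulShift _ (ZMod.isPrimitive_stdAddChar q), ZMod.card]
    simp [sub_eq_zero]
  rw [← sum_add_sum_compl ({0} : Finset (ZMod q))] at h1
  simp only [sum_singleton, zero_mul, AddChar.map_zero_eq_one, neg_zero, sum_const, Nat.card_Icc,
    mul_one, Nat.add_sub_cancel, nsmul_eq_mul] at h1
  rw [eq_inv_mul_iff_mul_eq₀ hq]
  push_cast
  rw [mul_sub, h1]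
  field_simp
  ring

lemma norm_sum_mul_card_sub_le {q : ℕ} [Fact q.Prime] (S T : Finset ℕ) {a b : ℕ → ℂ}
    {c : ZMod q} (hc : c ≠ 0) (M : ℕ) {B : ℝ}
    (hB : ∀ A : ZMod q, A ≠ 0 →
      ‖∑ u ∈ S, ∑ v ∈ T, a u * b v * ZMod.stdAddChar (A * (u : ZMod q)⁻¹ * (v : ZMod q)⁻¹)‖ ≤ B) :
    ‖∑ u ∈ S, ∑ v ∈ T, a u * b v *
      ((#{m ∈ Icc 1 M | ((m : ℕ) : ZMod q) = c * (u : ZMod q)⁻¹ * (v : ZMod q)⁻¹} : ℝ) - M / q)‖ ≤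
      (1 + Real.log q) * B := by
  have hq : (0 : ℝ) < q := by exact_mod_cast (Fact.out : q.Prime).pos
  have h1 : ∑ u ∈ S, ∑ v ∈ T, a u * b v *
      ((#{m ∈ Icc 1 M | ((m : ℕ) : ZMod q) = c * (u : ZMod q)⁻¹ * (v : ZMod q)⁻¹} : ℝ) - M / q) =
      (q : ℂ)⁻¹ * ∑ h ∈ ({0}ᶜ : Finset (ZMod q)),
        (∑ m ∈ Icc 1 M, (ZMod.stdAddChar (h * (m : ZMod q)) : ℂ)) *
        ∑ u ∈ S, ∑ v ∈ T, a u * b v *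
          ZMod.stdAddChar ((-h * c) * (u : ZMod q)⁻¹ * (v : ZMod q)⁻¹) := by
    simp_rw [card_filter_eq_fourier, mul_sum]
    conv_rhs =>
      rw [sum_comm]
      enter [2, u]
      rw [sum_comm]
    refine sum_congr rfl fun u _ => sum_congr rfl fun v _ => sum_congr rfl fun h _ => ?_
    rw [show -h * (c * (u : ZMod q)⁻¹ * (v : ZMod q)⁻¹) = -h * c * (u : ZMod q)⁻¹ * (v : ZMod q)⁻¹
      by ring]
    ring
  rw [h1, norm_mul, norm_inv, Complex.norm_natCast, inv_mul_le_iff₀ hq]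
  refine (norm_sum_le _ _).trans ?_
  have hB0 : 0 ≤ B := (norm_nonneg _).trans (hB 1 one_ne_zero)
  calc _ ≤ ∑ h ∈ ({0}ᶜ : Finset (ZMod q)),
        ‖∑ m ∈ Icc 1 M, (ZMod.stdAddChar (h * (m : ZMod q)) : ℂ)‖ * B := by
        refine sum_le_sum fun h hh => ?_
        rw [norm_mul]
        refine mul_le_mul_of_nonneg_left (hB _ ?_) (norm_nonneg _)
        simp only [mem_compl, mem_singleton] at hh
        exact mul_ne_zero (neg_ne_zero.mpr hh) hc
    _ ≤ (q * (1 + Real.log q)) * B := by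
        rw [← sum_mul]
        gcongr
        exact sum_norm_sum_Icc_stdAddChar_le M
    _ = _ := by ring

/-- The number of positive integers `m ≤ y` in the residue class `c` modulo `q`. -/
noncomputable def apCount (q : ℕ) (c : ZMod q) (y : ℝ) : ℕ :=
  #{m ∈ Icc 1 ⌊y⌋₊ | ((m : ℕ) : ZMod q) = c}

lemma abs_card_Ioc_filter_sub_le {q : ℕ} [NeZero q] (c : ZMod q) {a b : ℕ} (hab : a ≤ b) :
    |(#{m ∈ Ioc a b | ((m : ℕ) : ZMod q) = c} : ℝ) - ((b : ℝ) - a) / q| ≤ 1 := by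
  have hq0 : 0 < q := Nat.pos_of_ne_zero (NeZero.ne q)
  have hset : {m ∈ Ioc a b | ((m : ℕ) : ZMod q) = c} = {m ∈ Ioc a b | m ≡ c.val [MOD q]} := by
    refine filter_congr fun m _ => ?_
    rw [← ZMod.natCast_eq_natCast_iff, ZMod.natCast_val, ZMod.cast_id]
  have h := Nat.Ioc_filter_modEq_card a b hq0 c.val
  rw [hset]
  set f1 := ⌊((b : ℚ) - c.val) / q⌋ with hf1
  set f2 := ⌊((a : ℚ) - c.val) / q⌋ with hf2
  have hle : f2 ≤ f1 := by
    rw [hf1, hf2]; apply Int.floor_le_floor; gcongr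
  rw [max_eq_left (by omega)] at h
  have h' : ((#{m ∈ Ioc a b | m ≡ c.val [MOD q]} : ℕ) : ℚ) = (f1 : ℚ) - f2 := by
    exact_mod_cast h
  have e1 := Int.floor_le (((b : ℚ) - c.val) / q)
  have e2 := Int.lt_floor_add_one (((b : ℚ) - c.val) / q)
  have e3 := Int.floor_le (((a : ℚ) - c.val) / q)
  have e4 := Int.lt_floor_add_one (((a : ℚ) - c.val) / q)
  have e5 : ((b : ℚ) - a) / q = ((b : ℚ) - c.val) / q - ((a : ℚ) - c.val) / q := by ring
  have : |((#{m ∈ Ioc a b | m ≡ c.val [MOD q]} : ℕ) : ℚ) - ((b : ℚ) - a) / q| ≤ 1 := by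
    rw [h', e5, abs_le]; constructor <;> linarith
  have h2 := (Rat.cast_le (K := ℝ)).mpr this
  push_cast at h2
  exact h2

lemma abs_apCount_sub_le {q : ℕ} [NeZero q] (c : ZMod q) {y : ℝ} (hy : 0 ≤ y) :
    |(apCount q c y : ℝ) - y / q| ≤ 2 := by
  have hq0 : (1 : ℝ) ≤ q := by exact_mod_cast Nat.pos_of_ne_zero (NeZero.ne q)
  have h := abs_card_Ioc_filter_sub_le c (Nat.zero_le ⌊y⌋₊)
  have hs : Ioc 0 ⌊y⌋₊ = Icc 1 ⌊y⌋₊ := by ext; simp [Nat.succ_le_iff]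
  rw [hs] at h
  unfold apCount
  have h1 : |((⌊y⌋₊ : ℝ) - (0 : ℕ)) / q - y / q| ≤ 1 := by
    have e1 := Nat.floor_le hy
    have e2 := Nat.lt_floor_add_one y
    rw [← sub_div, abs_div, abs_of_nonneg (by linarith : (0 : ℝ) ≤ q), div_le_one (by linarith),
      abs_le]
    push_cast
    constructor <;> linarith
  have := abs_sub_le (#{m ∈ Icc 1 ⌊y⌋₊ | ((m : ℕ) : ZMod q) = c} : ℝ)
    (((⌊y⌋₊ : ℝ) - (0 : ℕ)) / q) (y / q)
  linarith

lemma apCount_sub_apCount {q : ℕ} (c : ZMod q) {y z : ℝ} (h : y ≤ z) :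
    (apCount q c z : ℝ) - apCount q c y =
      (#{m ∈ Ioc ⌊y⌋₊ ⌊z⌋₊ | ((m : ℕ) : ZMod q) = c} : ℝ) := by
  have hf := Nat.floor_mono h
  have : apCount q c z =
      apCount q c y + #{m ∈ Ioc ⌊y⌋₊ ⌊z⌋₊ | ((m : ℕ) : ZMod q) = c} := by
    unfold apCount
    rw [← card_union_of_disjoint, ← filter_union]
    · congr 2
      ext m; simp only [mem_union, mem_Icc, mem_Ioc]; omega
    · apply disjoint_filter_filter
      rw [disjoint_left]; intro m; simp only [mem_Icc, mem_Ioc]; omega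
  rw [this]; push_cast; ring

lemma sum_card_short_le {q : ℕ} [Fact q.Prime] {X Y : ℝ} (hX : 0 ≤ X) (hXY : X ≤ Y) (c : ZMod q)
    {S T : Finset ℕ} (hS : ∀ u ∈ S, 0 < u ∧ (u : ZMod q) ≠ 0)
    (hT : ∀ v ∈ T, 0 < v ∧ (v : ZMod q) ≠ 0) (y : ℕ → ℕ → ℝ)
    (hy : ∀ u ∈ S, ∀ v ∈ T, y u v * (u * v) ≤ Y)
    {D : ℝ} (hD : ∀ n : ℕ, n ≠ 0 → (n : ℝ) ≤ Y → (#n.divisors : ℝ) ≤ D) :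
    ∑ u ∈ S, ∑ v ∈ T, (#{m ∈ Ioc ⌊X / (u * v)⌋₊ ⌊y u v⌋₊ |
      ((m : ℕ) : ZMod q) = c * (u : ZMod q)⁻¹ * (v : ZMod q)⁻¹} : ℝ) ≤
      ((Y - X) / q + 2) * D ^ 2 := by
  classical
  have hq : (1 : ℝ) ≤ q := by exact_mod_cast (Fact.out : q.Prime).one_lt.le
  set P := (S ×ˢ T).sigma fun z : ℕ × ℕ => {m ∈ Ioc ⌊X / (z.1 * z.2)⌋₊ ⌊y z.1 z.2⌋₊ |
      ((m : ℕ) : ZMod q) = c * (z.1 : ZMod q)⁻¹ * (z.2 : ZMod q)⁻¹} with hP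
  have hcard : ∑ u ∈ S, ∑ v ∈ T, (#{m ∈ Ioc ⌊X / (u * v)⌋₊ ⌊y u v⌋₊ |
      ((m : ℕ) : ZMod q) = c * (u : ZMod q)⁻¹ * (v : ZMod q)⁻¹} : ℝ) = #P := by
    rw [hP, card_sigma, sum_product]; push_cast; rfl
  rw [hcard]
  set W := {n ∈ Ioc ⌊X⌋₊ ⌊Y⌋₊ | ((n : ℕ) : ZMod q) = c} with hW
  have hmaps : ∀ z ∈ P, z.1.1 * z.1.2 * z.2 ∈ W := by
    rintro ⟨⟨u, v⟩, m⟩ hz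
    simp only [hP, mem_sigma, mem_product, mem_filter, mem_Ioc] at hz
    obtain ⟨⟨hu, hv⟩, ⟨h1, h2⟩, h3⟩ := hz
    obtain ⟨hu0, hu1⟩ := hS u hu
    obtain ⟨hv0, hv1⟩ := hT v hv
    have huR : (0 : ℝ) < u := by exact_mod_cast hu0
    have hvR : (0 : ℝ) < v := by exact_mod_cast hv0
    simp only [hW, mem_filter, mem_Ioc]
    refine ⟨⟨?_, ?_⟩, ?_⟩
    · rw [Nat.floor_lt (by positivity), div_lt_iff₀ (by positivity)] at h1
      rw [Nat.floor_lt hX]; push_cast; linarith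
    · have hm0 : m ≠ 0 := by rintro rfl; exact absurd h1 (by simp)
      rw [Nat.le_floor_iff' hm0] at h2
      have : u * v * m ≠ 0 := by positivity
      rw [Nat.le_floor_iff' this]; push_cast
      calc (u : ℝ) * v * m ≤ u * v * y u v := by gcongr
        _ = y u v * (u * v) := by ring
        _ ≤ Y := hy u hu v hv
    · push_cast; rw [h3]; field_simp
  have hfib : ∀ n ∈ W, (#{z ∈ P | z.1.1 * z.1.2 * z.2 = n} : ℝ) ≤ D ^ 2 := by
    intro n hn
    simp only [hW, mem_filter, mem_Ioc] at hn
    have hn0 : n ≠ 0 := by omega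
    have hnY : (n : ℝ) ≤ Y := (Nat.le_floor_iff' hn0).mp hn.1.2
    have : #{z ∈ P | z.1.1 * z.1.2 * z.2 = n} ≤ #(n.divisors ×ˢ n.divisors) := by
      refine card_le_card_of_injOn (fun z => z.1) ?_ ?_
      · rintro ⟨⟨u, v⟩, m⟩ hz
        simp only [coe_filter, Set.mem_ofPred_eq] at hz
        simp only [coe_product, Set.mem_prod, mem_coe, Nat.mem_divisors]
        exact ⟨⟨⟨v * m, by rw [← hz.2]; ring⟩, hn0⟩, ⟨⟨u * m, by rw [← hz.2]; ring⟩, hn0⟩⟩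
      · rintro ⟨⟨u, v⟩, m⟩ hz ⟨⟨u', v'⟩, m'⟩ hz' h
        simp only [coe_filter, Set.mem_ofPred_eq] at hz hz'
        simp only [Prod.mk.injEq] at h
        obtain ⟨rfl, rfl⟩ := h
        have huv : u * v ≠ 0 := by
          rintro h0; apply hn0; rw [← hz.2, h0, zero_mul]
        have := Nat.eq_of_mul_eq_mul_left (Nat.pos_of_ne_zero huv) (hz.2.trans hz'.2.symm)
        rw [this]
    rw [card_product] at this
    calc _ ≤ ((#n.divisors * #n.divisors : ℕ) : ℝ) := by exact_mod_cast this
      _ = (#n.divisors : ℝ) ^ 2 := by push_cast; ring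
      _ ≤ _ := by gcongr; exact hD n hn0 hnY
  have hWc : (#W : ℝ) ≤ (Y - X) / q + 2 := by
    have h := abs_card_Ioc_filter_sub_le c (Nat.floor_mono hXY)
    rw [← hW] at h
    have e1 := Nat.floor_le (hX.trans hXY)
    have e2 := Nat.lt_floor_add_one X
    have : ((⌊Y⌋₊ : ℝ) - ⌊X⌋₊) / q ≤ (Y - X) / q + 1 := by
      rw [div_add_one (by positivity)]
      gcongr; linarith
    linarith [(abs_le.mp h).2]
  rw [card_eq_sum_card_fiberwise (s := P) (f := fun z => z.1.1 * z.1.2 * z.2) (t := W)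
    (fun z hz => hmaps z hz)]
  push_cast
  calc _ ≤ ∑ n ∈ W, D ^ 2 := sum_le_sum hfib
    _ = #W * D ^ 2 := by rw [sum_const, nsmul_eq_mul]
    _ ≤ _ := by gcongr

lemma sum_inv_le_one_add_log {S : Finset ℕ} {U : ℕ} (hS : S ⊆ Icc 1 U) :
    ∑ u ∈ S, (u : ℝ)⁻¹ ≤ 1 + Real.log U := by
  refine le_trans ?_ (harmonic_le_one_add_log U)
  rw [harmonic_eq_sum_Icc]
  push_cast
  exact sum_le_sum_of_subset_of_nonneg hS fun _ _ _ => by positivity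

/-- The index of the multiplicative box of ratio `exp ε` containing `u`. -/
noncomputable def boxIndex (ε : ℝ) (u : ℕ) : ℕ := ⌊Real.log u / ε⌋₊

lemma boxIndex_spec {ε : ℝ} (hε : 0 < ε) {u : ℕ} (hu : 0 < u) :
    Real.exp (boxIndex ε u * ε) ≤ u ∧ (u : ℝ) ≤ Real.exp (boxIndex ε u * ε) * Real.exp ε := by
  have hu1 : (1 : ℝ) ≤ u := by exact_mod_cast hu
  have hl := Real.log_nonneg hu1
  unfold boxIndex
  have e1 := Nat.floor_le (div_nonneg hl hε.le)
  have e2 := Nat.lt_floor_add_one (Real.log u / ε)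
  rw [le_div_iff₀ hε] at e1
  rw [div_lt_iff₀ hε] at e2
  constructor
  · rw [← Real.le_log_iff_exp_le (by linarith)]; exact e1
  · rw [← Real.exp_add, ← Real.log_le_iff_le_exp (by linarith)]; linarith

lemma boxIndex_lt {ε : ℝ} (hε : 0 < ε) {u U : ℕ} (hu : 0 < u) (huU : u ≤ U) :
    boxIndex ε u < ⌊Real.log U / ε⌋₊ + 1 := by
  unfold boxIndex
  have : (u : ℝ) ≤ U := by exact_mod_cast huU
  have hu1 : (0 : ℝ) < u := by exact_mod_cast hu
  exact Nat.lt_succ_of_le (Nat.floor_mono (by gcongr))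

lemma norm_sum_mul_apCount_sub_le {q : ℕ} [Fact q.Prime] {x : ℝ} (hx : 0 < x) {c : ZMod q}
    (hc : c ≠ 0) {U V : ℕ} {S T : Finset ℕ} (hS : S ⊆ Icc 1 U) (hT : T ⊆ Icc 1 V)
    (hSq : ∀ u ∈ S, (u : ZMod q) ≠ 0) (hTq : ∀ v ∈ T, (v : ZMod q) ≠ 0) {a b : ℕ → ℂ}
    (ha : ∀ u ∈ S, ‖a u‖ ≤ 1) (hb : ∀ v ∈ T, ‖b v‖ ≤ 1) {ε B D : ℝ} (hε : 0 < ε)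
    (hB : ∀ A : ZMod q, A ≠ 0 → ∀ S' ⊆ S, ∀ T' ⊆ T,
      ‖∑ u ∈ S', ∑ v ∈ T', a u * b v * ZMod.stdAddChar (A * (u : ZMod q)⁻¹ * (v : ZMod q)⁻¹)‖ ≤ B)
    (hD : ∀ n : ℕ, n ≠ 0 → (n : ℝ) ≤ x * Real.exp (2 * ε) → (#n.divisors : ℝ) ≤ D) :
    ‖∑ u ∈ S, ∑ v ∈ T, a u * b v *
      ((apCount q (c * (u : ZMod q)⁻¹ * (v : ZMod q)⁻¹) (x / (u * v)) : ℝ) -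
        (x / (u * v) / q : ℝ) : ℂ)‖ ≤
      (Real.log U / ε + 1) * (Real.log V / ε + 1) * ((1 + Real.log q) * B) +
      (U * V / q + (Real.exp (2 * ε) - 1) * (x / q) * ((1 + Real.log U) * (1 + Real.log V))) +
      ((Real.exp (2 * ε) - 1) * (x / q) + 2) * D ^ 2 := by
  classical
  have hq : (1 : ℝ) ≤ q := by exact_mod_cast (Fact.out : q.Prime).one_lt.le
  have hSp : ∀ u ∈ S, 0 < u ∧ u ≤ U := fun u hu => by
    have := mem_Icc.mp (hS hu); omega
  have hTp : ∀ u ∈ T, 0 < u ∧ u ≤ V := fun u hu => by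
    have := mem_Icc.mp (hT hu); omega
  set Y : ℕ → ℕ → ℝ := fun i j => x / (Real.exp (i * ε) * Real.exp (j * ε)) with hY
  set y : ℕ → ℕ → ℝ := fun u v => Y (boxIndex ε u) (boxIndex ε v) with hy
  have hylow : ∀ u ∈ S, ∀ v ∈ T, x / (u * v) ≤ y u v := by
    intro u hu v hv
    have h1 := (boxIndex_spec hε (hSp u hu).1).1
    have h2 := (boxIndex_spec hε (hTp v hv).1).1
    simp only [hy, hY]
    gcongr
  have hyup : ∀ u ∈ S, ∀ v ∈ T, y u v * (u * v) ≤ x * Real.exp (2 * ε) := by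
    intro u hu v hv
    have h1 := (boxIndex_spec hε (hSp u hu).1).2
    have h2 := (boxIndex_spec hε (hTp v hv).1).2
    simp only [hy, hY]
    rw [div_mul_eq_mul_div, div_le_iff₀ (by positivity), mul_assoc]
    refine mul_le_mul_of_nonneg_left ?_ hx.le
    calc (u : ℝ) * v ≤ (Real.exp (boxIndex ε u * ε) * Real.exp ε) *
          (Real.exp (boxIndex ε v * ε) * Real.exp ε) := by gcongr
      _ = Real.exp (2 * ε) * (Real.exp (boxIndex ε u * ε) * Real.exp (boxIndex ε v * ε)) := by
          rw [two_mul, Real.exp_add]; ring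
  set cc : ℕ → ℕ → ZMod q := fun u v => c * (u : ZMod q)⁻¹ * (v : ZMod q)⁻¹ with hcc
  set t1 : ℕ → ℕ → ℂ := fun u v =>
    (apCount q (cc u v) (y u v) : ℝ) - ((⌊y u v⌋₊ : ℕ) : ℂ) / q with ht1
  set t2 : ℕ → ℕ → ℝ := fun u v => (⌊y u v⌋₊ : ℝ) / q - x / (u * v) / q with ht2
  set t3 : ℕ → ℕ → ℝ := fun u v =>
    (apCount q (cc u v) (y u v) : ℝ) - apCount q (cc u v) (x / (u * v)) with ht3
  have hdec : ∑ u ∈ S, ∑ v ∈ T, a u * b v *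
      ((apCount q (cc u v) (x / (u * v)) : ℝ) - (x / (u * v) / q : ℝ) : ℂ) =
      ∑ u ∈ S, ∑ v ∈ T, a u * b v * t1 u v + ∑ u ∈ S, ∑ v ∈ T, a u * b v * (t2 u v : ℂ) -
        ∑ u ∈ S, ∑ v ∈ T, a u * b v * (t3 u v : ℂ) := by
    simp_rw [← sum_add_distrib, ← sum_sub_distrib]
    refine sum_congr rfl fun u _ => sum_congr rfl fun v _ => ?_
    simp only [ht1, ht2, ht3]; push_cast; ring
  have hab : ∀ u ∈ S, ∀ v ∈ T, ∀ z : ℂ, ‖a u * b v * z‖ ≤ ‖z‖ := by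
    intro u hu v hv z
    rw [norm_mul, norm_mul]
    exact mul_le_of_le_one_left (norm_nonneg _)
      (mul_le_one₀ (ha u hu) (norm_nonneg _) (hb v hv))
  have h1 : ‖∑ u ∈ S, ∑ v ∈ T, a u * b v * t1 u v‖ ≤
      (Real.log U / ε + 1) * (Real.log V / ε + 1) * ((1 + Real.log q) * B) := by
    set I := range (⌊Real.log U / ε⌋₊ + 1) with hI
    set J := range (⌊Real.log V / ε⌋₊ + 1) with hJ
    have hsplit : ∑ u ∈ S, ∑ v ∈ T, a u * b v * t1 u v = ∑ i ∈ I, ∑ j ∈ J,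
        ∑ u ∈ S with boxIndex ε u = i, ∑ v ∈ T with boxIndex ε v = j, a u * b v * t1 u v := by
      rw [← sum_fiberwise_of_maps_to (s := S) (t := I) (g := boxIndex ε)
        (fun u hu => mem_range.mpr (boxIndex_lt hε (hSp u hu).1 (hSp u hu).2))]
      refine sum_congr rfl fun i _ => ?_
      conv_rhs => rw [sum_comm]
      refine sum_congr rfl fun u _ => ?_
      exact (sum_fiberwise_of_maps_to (s := T) (t := J) (g := boxIndex ε)
        (fun v hv => mem_range.mpr (boxIndex_lt hε (hTp v hv).1 (hTp v hv).2)) _).symm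
    have hB0 : 0 ≤ (1 + Real.log q) * B :=
      mul_nonneg (by linarith [Real.log_nonneg hq])
        ((norm_nonneg _).trans (hB 1 one_ne_zero S subset_rfl T subset_rfl))
    have hbox : ∀ i ∈ I, ∀ j ∈ J, ‖∑ u ∈ S with boxIndex ε u = i,
        ∑ v ∈ T with boxIndex ε v = j, a u * b v * t1 u v‖ ≤ (1 + Real.log q) * B := by
      intro i _ j _
      refine le_trans (le_of_eq ?_) (norm_sum_mul_card_sub_le (S.filter (boxIndex ε · = i))
        (T.filter (boxIndex ε · = j)) hc ⌊Y i j⌋₊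
        (fun A hA => hB A hA _ (filter_subset _ _) _ (filter_subset _ _)))
      congr 1
      refine sum_congr rfl fun u hu => sum_congr rfl fun v hv => ?_
      rw [mem_filter] at hu hv
      simp only [ht1, hy, hu.2, hv.2, apCount, hcc]
    rw [hsplit]
    refine (norm_sum_le _ _).trans ?_
    calc _ ≤ ∑ i ∈ I, ∑ j ∈ J, (1 + Real.log q) * B :=
          sum_le_sum fun i hi => (norm_sum_le _ _).trans (sum_le_sum fun j hj => hbox i hi j hj)
      _ = (⌊Real.log U / ε⌋₊ + 1) * ((⌊Real.log V / ε⌋₊ + 1) * ((1 + Real.log q) * B)) := by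
          simp [hI, hJ]
      _ ≤ (Real.log U / ε + 1) * ((Real.log V / ε + 1) * ((1 + Real.log q) * B)) := by
          have := Nat.floor_le (div_nonneg (Real.log_natCast_nonneg U) hε.le)
          have := Nat.floor_le (div_nonneg (Real.log_natCast_nonneg V) hε.le)
          have := Real.log_natCast_nonneg U
          gcongr
      _ = _ := by ring
  have hexp : 0 ≤ Real.exp (2 * ε) - 1 := by linarith [Real.add_one_le_exp (2 * ε)]
  have h2 : ‖∑ u ∈ S, ∑ v ∈ T, a u * b v * (t2 u v : ℂ)‖ ≤
      U * V / q + (Real.exp (2 * ε) - 1) * (x / q) * ((1 + Real.log U) * (1 + Real.log V)) := by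
    have hpt : ∀ u ∈ S, ∀ v ∈ T, |t2 u v| ≤
        1 / q + (Real.exp (2 * ε) - 1) * (x / q) * ((u : ℝ)⁻¹ * (v : ℝ)⁻¹) := by
      intro u hu v hv
      have l1 := hylow u hu v hv
      have l2 := hyup u hu v hv
      have hu0 : (0 : ℝ) < u := by exact_mod_cast (hSp u hu).1
      have hv0 : (0 : ℝ) < v := by exact_mod_cast (hTp v hv).1
      rw [← le_div_iff₀ (by positivity)] at l2
      have hx0 : 0 < x / (u * v) := by positivity
      have f1 := Nat.floor_le (hx0.le.trans l1)
      have f2 := Nat.lt_floor_add_one (y u v)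
      have e : 1 / q + (Real.exp (2 * ε) - 1) * (x / q) * ((u : ℝ)⁻¹ * (v : ℝ)⁻¹) =
          (1 + (x * Real.exp (2 * ε) / (u * v) - x / (u * v))) / q := by
        field_simp
      have h0 : 0 ≤ x * Real.exp (2 * ε) / (u * v) - x / (u * v) := by linarith
      rw [e]
      simp only [ht2]
      rw [← sub_div, abs_div, abs_of_nonneg (by linarith : (0 : ℝ) ≤ q)]
      gcongr
      rw [abs_le]
      constructor <;> linarith
    calc _ ≤ ∑ u ∈ S, ∑ v ∈ T,
          (1 / q + (Real.exp (2 * ε) - 1) * (x / q) * ((u : ℝ)⁻¹ * (v : ℝ)⁻¹)) := by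
          refine (norm_sum_le _ _).trans (sum_le_sum fun u hu => (norm_sum_le _ _).trans
            (sum_le_sum fun v hv => (hab u hu v hv _).trans ?_))
          rw [Complex.norm_real]
          exact hpt u hu v hv
      _ = #S * #T / q + (Real.exp (2 * ε) - 1) * (x / q) *
          ((∑ u ∈ S, (u : ℝ)⁻¹) * ∑ v ∈ T, (v : ℝ)⁻¹) := by
          rw [sum_mul_sum]
          simp_rw [sum_add_distrib, ← mul_sum]
          simp; ring
      _ ≤ _ := by
          have c1 : (#S : ℝ) ≤ U := by
            have := card_le_card hS; rw [Nat.card_Icc, Nat.add_sub_cancel] at this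
            exact_mod_cast this
          have c2 : (#T : ℝ) ≤ V := by
            have := card_le_card hT; rw [Nat.card_Icc, Nat.add_sub_cancel] at this
            exact_mod_cast this
          have := sum_inv_le_one_add_log hS
          have := sum_inv_le_one_add_log hT
          have := Real.log_natCast_nonneg U
          gcongr
  have h3 : ‖∑ u ∈ S, ∑ v ∈ T, a u * b v * (t3 u v : ℂ)‖ ≤
      ((Real.exp (2 * ε) - 1) * (x / q) + 2) * D ^ 2 := by
    have hXY : x ≤ x * Real.exp (2 * ε) := le_mul_of_one_le_right hx.le (by linarith)
    refine le_trans ?_ ((sum_card_short_le (q := q) hx.le hXY c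
      (fun u hu => ⟨(hSp u hu).1, hSq u hu⟩) (fun v hv => ⟨(hTp v hv).1, hTq v hv⟩) y hyup
      hD).trans (le_of_eq (by ring)))
    refine (norm_sum_le _ _).trans (sum_le_sum fun u hu => (norm_sum_le _ _).trans
      (sum_le_sum fun v hv => (hab u hu v hv _).trans ?_))
    simp only [ht3]
    rw [apCount_sub_apCount _ (hylow u hu v hv), Complex.norm_real]
    simp [hcc]
  change ‖∑ u ∈ S, ∑ v ∈ T, a u * b v *
      ((apCount q (cc u v) (x / (u * v)) : ℝ) - (x / (u * v) / q : ℝ) : ℂ)‖ ≤ _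
  rw [hdec]
  refine (norm_sub_le _ _).trans ?_
  exact add_le_add ((norm_add_le _ _).trans (add_le_add h1 h2)) h3

section

open Filter

lemma eventually_const_le_rpow (C : ℝ) {e : ℝ} (he : 0 < e) : ∀ᶠ N : ℝ in atTop, C ≤ N ^ e :=
  (tendsto_rpow_atTop he).eventually_ge_atTop C

lemma eventually_one_add_mul_log_le_rpow (K : ℝ) {e : ℝ} (he : 0 < e) :
    ∀ᶠ N : ℝ in atTop, 1 + K * Real.log N ≤ N ^ e := by
  have h := (isLittleO_log_rpow_atTop he).bound (c := 1 / (2 * (|K| + 1))) (by positivity)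
  filter_upwards [h, eventually_const_le_rpow 2 he, eventually_ge_atTop (1 : ℝ)] with N h1 h2 h3
  have hl := Real.log_nonneg h3
  rw [Real.norm_of_nonneg hl, Real.norm_of_nonneg (by positivity), one_div,
    ← div_eq_inv_mul, le_div_iff₀ (by positivity)] at h1
  nlinarith [le_abs_self K, abs_nonneg K]

lemma eventually_norm_bilinear_le {s u v μ e : ℝ} {k l : ℕ} (hk : 1 ≤ k) (hl : 1 ≤ l)
    (hu : 0 < u) (hv : 0 < v) (h1 : (2 * k - 1) * u < s) (h2 : (2 * l - 1) * v < s)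
    (hμ : s + μ ≤ k * u + l * v) (he : 0 < e) :
    ∀ᶠ N : ℝ in atTop, ∀ q : ℕ, ∀ _ : Fact q.Prime, (q : ℝ) = N ^ s →
      ∀ A : ZMod q, A ≠ 0 → ∀ S T : Finset ℕ, S ⊆ Icc 1 ⌊N ^ u⌋₊ → T ⊆ Icc 1 ⌊N ^ v⌋₊ →
      ∀ a b : ℕ → ℂ, (∀ u ∈ S, ‖a u‖ ≤ 1) → (∀ v ∈ T, ‖b v‖ ≤ 1) →
      ‖∑ u ∈ S, ∑ v ∈ T, a u * b v * ZMod.stdAddChar (A * (u : ZMod q)⁻¹ * (v : ZMod q)⁻¹)‖ ≤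
        N ^ (u + v - μ / (2 * k * l) + e) := by
  have hk' : (1 : ℝ) ≤ k := by exact_mod_cast hk
  have hl' : (1 : ℝ) ≤ l := by exact_mod_cast hl
  set ε := e / (u + v) with hε
  have hε0 : 0 < ε := by positivity
  obtain ⟨C1, hC1, H1⟩ := recipEnergy_le hk hε0
  obtain ⟨C2, hC2, H2⟩ := recipEnergy_le hl hε0
  filter_upwards [eventually_ge_atTop (1 : ℝ), eventually_const_le_rpow (C1 * C2) he,
    eventually_const_le_rpow (2 * k + 1) (sub_pos.mpr h1),
    eventually_const_le_rpow (2 * l + 1) (sub_pos.mpr h2)] with N hN1 hN2 hN3 hN4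
  intro q hqf hq A hA S T hS hT a b ha hb
  have hN0 : 0 < N := by linarith
  have floorU : ∀ w : ℝ, (⌊N ^ w⌋₊ : ℝ) ≤ N ^ w := fun w => Nat.floor_le (by positivity)
  have hsmall : ∀ (m : ℕ) (w : ℝ), 1 ≤ m → 2 * (m : ℝ) + 1 ≤ N ^ (s - (2 * m - 1) * w) →
      2 * m * ⌊N ^ w⌋₊ ^ (2 * m - 1) < q := by
    intro m w hm hmN
    have : (2 * m * ⌊N ^ w⌋₊ ^ (2 * m - 1) : ℝ) < q := by
      calc (2 * m * ⌊N ^ w⌋₊ ^ (2 * m - 1) : ℝ) ≤ 2 * m * (N ^ w) ^ (2 * m - 1) := by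
            gcongr; exact floorU w
        _ = 2 * m * N ^ ((2 * m - 1) * w) := by
            rw [← Real.rpow_natCast, ← Real.rpow_mul hN0.le]
            push_cast [Nat.cast_sub (by omega : 1 ≤ 2 * m)]
            ring_nf
        _ < N ^ (s - (2 * m - 1) * w) * N ^ ((2 * m - 1) * w) := by
            gcongr; linarith
        _ = q := by rw [← Real.rpow_add hN0, hq]; ring_nf
    exact_mod_cast this
  have hU1 : ∀ w : ℝ, 0 < w → 1 ≤ ⌊N ^ w⌋₊ := fun w hw =>
    Nat.le_floor (by push_cast; exact Real.one_le_rpow hN1 hw.le)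
  have hE1 := H1 _ q S hqf.out (hU1 u hu) hS (hsmall k u hk hN3)
  have hE2 := H2 _ q T hqf.out (hU1 v hv) hT (hsmall l v hl hN4)
  have hb := norm_bilinear_pow_le hA S T ha hb hk hl
  set Z := ‖∑ u ∈ S, ∑ v ∈ T, a u * b v * ZMod.stdAddChar (A * (u : ZMod q)⁻¹ * (v : ZMod q)⁻¹)‖
  have hcard : ∀ (R : Finset ℕ) (w : ℝ), R ⊆ Icc 1 ⌊N ^ w⌋₊ → (#R : ℝ) ≤ N ^ w := by
    intro R w hR
    have := card_le_card hR
    rw [Nat.card_Icc, Nat.add_sub_cancel] at this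
    exact le_trans (by exact_mod_cast this) (floorU w)
  have hpos : (0 : ℝ) < 2 * k * l := by positivity
  refine le_of_pow_le_pow_left₀ (n := 2 * k * l) (by positivity) (by positivity) ?_
  refine hb.trans ?_
  calc (#S : ℝ) ^ (2 * k * (l - 1)) * (#T : ℝ) ^ (2 * l * (k - 1)) *
        (q * recipEnergy q k S * recipEnergy q l T)
      ≤ (N ^ u) ^ (2 * k * (l - 1)) * (N ^ v) ^ (2 * l * (k - 1)) *
        (q * (C1 * (N ^ u) ^ ((k : ℝ) + ε)) * (C2 * (N ^ v) ^ ((l : ℝ) + ε))) := by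
        have a1 := hcard S u hS
        have a2 := hcard T v hT
        have a3 : (recipEnergy q k S : ℝ) ≤ C1 * (N ^ u) ^ ((k : ℝ) + ε) := hE1.trans (by
          gcongr; exact floorU u)
        have a4 : (recipEnergy q l T : ℝ) ≤ C2 * (N ^ v) ^ ((l : ℝ) + ε) := hE2.trans (by
          gcongr; exact floorU v)
        gcongr
    _ = (C1 * C2) * N ^ (u * (2 * k * (l - 1)) + v * (2 * l * (k - 1)) + s + u * (k + ε) +
          v * (l + ε)) := by
        rw [hq]
        simp_rw [Real.rpow_add hN0]
        simp_rw [← Real.rpow_natCast, ← Real.rpow_mul hN0.le]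
        push_cast [Nat.cast_sub hk, Nat.cast_sub hl]
        ring
    _ ≤ N ^ e * N ^ (u * (2 * k * (l - 1)) + v * (2 * l * (k - 1)) + s + u * (k + ε) +
          v * (l + ε)) := by gcongr
    _ = N ^ (e + (u * (2 * k * (l - 1)) + v * (2 * l * (k - 1)) + s + u * (k + ε) +
          v * (l + ε))) := by rw [← Real.rpow_add hN0]
    _ ≤ N ^ ((u + v - μ / (2 * k * l) + e) * (2 * k * l : ℕ)) := by
        refine Real.rpow_le_rpow_of_exponent_le hN1 ?_
        have e1 : u * ε + v * ε = e := by rw [hε]; field_simp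
        have e2 : (u + v - μ / (2 * k * l) + e) * (2 * k * l : ℕ) =
            (u + v) * (2 * k * l) - μ + 2 * (e * (k * l)) := by
          push_cast; field_simp
        rw [e2]
        have : e ≤ e * (k * l) := le_mul_of_one_le_right he.le (by nlinarith)
        nlinarith
    _ = _ := by rw [Real.rpow_mul hN0.le, Real.rpow_natCast]

lemma eventually_norm_bilinear_remainder_le {s u v μ ξ ρ : ℝ} {k l : ℕ} (hk : 1 ≤ k) (hl : 1 ≤ l)
    (hu : 0 < u) (hv : 0 < v) (h1 : (2 * k - 1) * u < s) (h2 : (2 * l - 1) * v < s)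
    (hμ : s + μ ≤ k * u + l * v) (hξ0 : 0 < ξ) (hξ1 : ξ ≤ 1) (hρξ : ρ < ξ)
    (h3 : ρ + 2 * ξ + (u + v - 1) < μ / (2 * k * l)) (h4 : u + v + ρ < s + 1) :
    ∀ᶠ N : ℝ in atTop, ∀ q : ℕ, ∀ _ : Fact q.Prime, (q : ℝ) = N ^ s →
      ∀ c : ZMod q, c ≠ 0 → ∀ X : ℝ, 0 < X → X ≤ q * N →
      ∀ S T : Finset ℕ, S ⊆ Icc 1 ⌊N ^ u⌋₊ → T ⊆ Icc 1 ⌊N ^ v⌋₊ →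
      ∀ a b : ℕ → ℂ, (∀ u ∈ S, ‖a u‖ ≤ 1) → (∀ v ∈ T, ‖b v‖ ≤ 1) →
      ‖∑ u ∈ S, ∑ v ∈ T, a u * b v *
        ((apCount q (c * (u : ZMod q)⁻¹ * (v : ZMod q)⁻¹) (X / (u * v)) : ℝ) -
          (X / (u * v) / q : ℝ) : ℂ)‖ ≤ N ^ (1 - ρ) := by
  have hk' : (1 : ℝ) ≤ k := by exact_mod_cast hk
  have hl' : (1 : ℝ) ≤ l := by exact_mod_cast hl
  have hus : u < s := by nlinarith
  have hvs : v < s := by nlinarith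
  have hs : 0 < s := by linarith
  set e := min (ξ - ρ) (min (μ / (2 * k * l) - (ρ + 2 * ξ + (u + v - 1)))
    (s + 1 - (u + v + ρ))) / 10 with he
  have he0 : 0 < e := by
    rw [he]; have := sub_pos.mpr hρξ; have := sub_pos.mpr h3; have := sub_pos.mpr h4; positivity
  have g1 : ρ + 10 * e ≤ ξ := by
    have := min_le_left (ξ - ρ) (min (μ / (2 * k * l) - (ρ + 2 * ξ + (u + v - 1)))
      (s + 1 - (u + v + ρ)))
    linarith
  have g2 : ρ + 2 * ξ + (u + v - 1) + 10 * e ≤ μ / (2 * k * l) := by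
    have := min_le_right (ξ - ρ) (min (μ / (2 * k * l) - (ρ + 2 * ξ + (u + v - 1)))
      (s + 1 - (u + v + ρ)))
    have := min_le_left (μ / (2 * k * l) - (ρ + 2 * ξ + (u + v - 1))) (s + 1 - (u + v + ρ))
    linarith
  have g3 : u + v + ρ + 10 * e ≤ s + 1 := by
    have := min_le_right (ξ - ρ) (min (μ / (2 * k * l) - (ρ + 2 * ξ + (u + v - 1)))
      (s + 1 - (u + v + ρ)))
    have := min_le_right (μ / (2 * k * l) - (ρ + 2 * ξ + (u + v - 1))) (s + 1 - (u + v + ρ))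
    linarith
  obtain ⟨C, hC, hdiv⟩ := card_divisors_le_rpow (ε := e / (s + 2)) (by positivity)
  filter_upwards [eventually_ge_atTop (1 : ℝ),
    eventually_norm_bilinear_le hk hl hu hv h1 h2 hμ he0,
    eventually_one_add_mul_log_le_rpow u he0, eventually_one_add_mul_log_le_rpow v he0,
    eventually_one_add_mul_log_le_rpow s he0,
    eventually_const_le_rpow 12 he0, eventually_const_le_rpow 2 hξ0,
    eventually_const_le_rpow (C * Real.exp 1 ^ (e / (s + 2))) (e := e / (s + 2)) (by positivity)]
    with N hN1 hbil hlu hlv hls h12 hNξ hNC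
  intro q hqf hq c hc X hX hXq S T hS hT a b ha hb
  have hN0 : 0 < N := by linarith
  have hl0 := Real.log_nonneg hN1
  have hqpos : (0 : ℝ) < q := by exact_mod_cast hqf.out.pos
  have hunit : ∀ (R : Finset ℕ) (w : ℝ), w < s → R ⊆ Icc 1 ⌊N ^ w⌋₊ → 1 < N →
      ∀ r ∈ R, (r : ZMod q) ≠ 0 := by
    intro R w hw hR hN r hr h0
    have hr' := mem_Icc.mp (hR hr)
    rw [ZMod.natCast_eq_zero_iff] at h0
    have h5 := Nat.le_of_dvd (by omega) h0
    have h6 : (r : ℝ) ≤ N ^ w := (Nat.le_floor_iff (by positivity)).mp hr'.2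
    have h7 : (q : ℝ) ≤ r := by exact_mod_cast h5
    have h8 : N ^ w < N ^ s := Real.rpow_lt_rpow_of_exponent_lt hN hw
    linarith
  have hNgt : 1 < N := by
    by_contra hcon
    have : N = 1 := by linarith
    rw [this, Real.one_rpow] at h12; norm_num at h12
  set ε := N ^ (-ξ) with hε
  have hε0 : 0 < ε := by positivity
  have hε2 : 2 * ε ≤ 1 := by
    rw [hε, Real.rpow_neg hN0.le, ← div_eq_mul_inv, div_le_one (by positivity)]; exact hNξ
  have hexp : Real.exp (2 * ε) - 1 ≤ 4 * ε := by
    have := Real.abs_exp_sub_one_le (x := 2 * ε) (by rw [abs_of_pos (by positivity)]; exact hε2)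
    rw [abs_of_pos (by positivity : 0 < 2 * ε)] at this
    linarith [le_abs_self (Real.exp (2 * ε) - 1)]
  have hexp0 : 0 ≤ Real.exp (2 * ε) - 1 := by linarith [Real.add_one_le_exp (2 * ε)]
  have hD : ∀ n : ℕ, n ≠ 0 → (n : ℝ) ≤ X * Real.exp (2 * ε) → (#n.divisors : ℝ) ≤ N ^ e := by
    intro n hn hnX
    calc (#n.divisors : ℝ) ≤ C * (n : ℝ) ^ (e / (s + 2)) := hdiv n hn
      _ ≤ C * (N ^ (s + 1) * Real.exp 1) ^ (e / (s + 2)) := by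
          gcongr
          refine hnX.trans ?_
          have : X ≤ N ^ (s + 1) := by rw [Real.rpow_add hN0, Real.rpow_one, ← hq]; exact hXq
          gcongr
      _ = C * Real.exp 1 ^ (e / (s + 2)) * N ^ ((s + 1) * (e / (s + 2))) := by
          rw [Real.mul_rpow (by positivity) (by positivity), ← Real.rpow_mul hN0.le]; ring
      _ ≤ N ^ (e / (s + 2)) * N ^ ((s + 1) * (e / (s + 2))) := by gcongr
      _ = N ^ e := by rw [← Real.rpow_add hN0]; congr 1; field_simp; ring
  have hmain := norm_sum_mul_apCount_sub_le (q := q) hX hc hS hT (hunit S u hus hS hNgt)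
    (hunit T v hvs hT hNgt) ha hb hε0 (B := N ^ (u + v - μ / (2 * k * l) + e))
    (fun A hA S' hS' T' hT' => hbil q hqf hq A hA S' T' (hS'.trans hS) (hT'.trans hT) a b
      (fun u hu => ha u (hS' hu)) (fun v hv => hb v (hT' hv))) hD
  refine hmain.trans ?_
  have floorU : ∀ w : ℝ, (⌊N ^ w⌋₊ : ℝ) ≤ N ^ w := fun w => Nat.floor_le (by positivity)
  have hlogU : ∀ w : ℝ, 0 < w → Real.log ⌊N ^ w⌋₊ ≤ w * Real.log N := by
    intro w hw
    rw [← Real.log_rpow hN0]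
    refine Real.log_le_log ?_ (floorU w)
    have : 1 ≤ ⌊N ^ w⌋₊ := Nat.le_floor (by push_cast; exact Real.one_le_rpow hN1 hw.le)
    exact_mod_cast this
  have hbox : ∀ w : ℝ, 0 < w → 1 + w * Real.log N ≤ N ^ e →
      Real.log ⌊N ^ w⌋₊ / ε + 1 ≤ N ^ (ξ + e) := by
    intro w hw hwN
    have h5 : 1 ≤ N ^ ξ := by linarith
    calc Real.log ⌊N ^ w⌋₊ / ε + 1 = N ^ ξ * Real.log ⌊N ^ w⌋₊ + 1 := by
          rw [hε, Real.rpow_neg hN0.le, div_inv_eq_mul, mul_comm]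
      _ ≤ N ^ ξ * (w * Real.log N) + N ^ ξ := by gcongr; exact hlogU w hw
      _ = N ^ ξ * (1 + w * Real.log N) := by ring
      _ ≤ N ^ ξ * N ^ e := by gcongr
      _ = _ := by rw [← Real.rpow_add hN0]
  have hXN : X / q ≤ N := by rw [div_le_iff₀ hqpos]; linarith
  have b1 : (Real.log ⌊N ^ u⌋₊ / ε + 1) * (Real.log ⌊N ^ v⌋₊ / ε + 1) *
      ((1 + Real.log q) * N ^ (u + v - μ / (2 * k * l) + e)) ≤ N ^ (1 - ρ - e) := by
    calc _ ≤ N ^ (ξ + e) * N ^ (ξ + e) * (N ^ e * N ^ (u + v - μ / (2 * k * l) + e)) := by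
          have c1 := hbox u hu hlu
          have c2 := hbox v hv hlv
          have c3 : 1 + Real.log q ≤ N ^ e := by rw [hq, Real.log_rpow hN0]; exact hls
          have := Real.log_natCast_nonneg ⌊N ^ u⌋₊
          have := Real.log_natCast_nonneg ⌊N ^ v⌋₊
          gcongr
      _ = N ^ ((ξ + e) + (ξ + e) + (e + (u + v - μ / (2 * k * l) + e))) := by
          simp_rw [← Real.rpow_add hN0]
      _ ≤ _ := Real.rpow_le_rpow_of_exponent_le hN1 (by linarith)
  have b2 : (⌊N ^ u⌋₊ : ℝ) * ⌊N ^ v⌋₊ / q ≤ N ^ (1 - ρ - e) := by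
    calc _ ≤ N ^ u * N ^ v / q := by gcongr <;> exact floorU _
      _ = N ^ (u + v - s) := by rw [hq, Real.rpow_sub hN0, Real.rpow_add hN0]
      _ ≤ _ := Real.rpow_le_rpow_of_exponent_le hN1 (by linarith)
  have hεN : ε * N = N ^ (1 - ξ) := by
    rw [hε, sub_eq_add_neg, Real.rpow_add hN0, Real.rpow_one, mul_comm]
  have b3 : (Real.exp (2 * ε) - 1) * (X / q) *
      ((1 + Real.log ⌊N ^ u⌋₊) * (1 + Real.log ⌊N ^ v⌋₊)) ≤ 4 * N ^ (1 - ρ - e) := by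
    calc _ ≤ 4 * ε * N * (N ^ e * N ^ e) := by
          have c1 : 1 + Real.log ⌊N ^ u⌋₊ ≤ N ^ e := by linarith [hlogU u hu]
          have c2 : 1 + Real.log ⌊N ^ v⌋₊ ≤ N ^ e := by linarith [hlogU v hv]
          have := Real.log_natCast_nonneg ⌊N ^ u⌋₊
          have := Real.log_natCast_nonneg ⌊N ^ v⌋₊
          gcongr
      _ = 4 * N ^ (1 - ξ + (e + e)) := by
          rw [mul_assoc 4, hεN, mul_assoc, Real.rpow_add hN0, Real.rpow_add hN0]
      _ ≤ _ := by
          gcongr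
          linarith
  have b4 : ((Real.exp (2 * ε) - 1) * (X / q) + 2) * (N ^ e) ^ 2 ≤ 6 * N ^ (1 - ρ - e) := by
    calc _ ≤ (4 * ε * N + 2 * N ^ (1 - ξ)) * (N ^ e) ^ 2 := by
          have : 1 ≤ N ^ (1 - ξ) := Real.one_le_rpow hN1 (by linarith)
          gcongr
          linarith
      _ = 6 * N ^ (1 - ξ + (e + e)) := by
          rw [mul_assoc 4, hεN, Real.rpow_add hN0, Real.rpow_add hN0]; ring
      _ ≤ _ := by
          gcongr
          linarith
  have b5 : 12 * N ^ (1 - ρ - e) ≤ N ^ (1 - ρ) := by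
    calc 12 * N ^ (1 - ρ - e) ≤ N ^ e * N ^ (1 - ρ - e) := by gcongr
      _ = _ := by rw [← Real.rpow_add hN0]; congr 1; ring
  linarith

end

section

open ArithmeticFunction

lemma le_totient_mul_card_divisors {n : ℕ} (hn : n ≠ 0) : n ≤ n.totient * #n.divisors := by
  conv_lhs => rw [← Nat.sum_totient n]
  calc _ ≤ ∑ _d ∈ n.divisors, n.totient := sum_le_sum fun d hd =>
        Nat.le_of_dvd (Nat.totient_pos.mpr (Nat.pos_of_ne_zero hn))
          (Nat.totient_dvd_of_dvd (Nat.dvd_of_mem_divisors hd))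
    _ = _ := by rw [sum_const, smul_eq_mul, mul_comm]

lemma sum_divisors_prime_mul {p j : ℕ} (hp : p.Prime) (hpj : ¬ p ∣ j) (g : ℕ → ℝ) :
    ∑ d ∈ (p * j).divisors, g d = ∑ s ∈ j.divisors, (g s + g (p * s)) := by
  have hc : p.Coprime j := (Nat.Prime.coprime_iff_not_dvd hp).mpr hpj
  have hinj := hc.mul_injOn_divisors
  rw [Nat.divisors_mul, ← Finset.image_mul_product, sum_image (by simpa using hinj), sum_product,
    hp.divisors, sum_pair hp.one_lt.ne, ← sum_add_distrib]
  simp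

/-- Detecting the exact gcd through Möbius inversion. -/
lemma eq_sum_moebius_gcd (H : ℕ → ℝ) {n : ℕ} (hn : 0 < n) :
    H n = ∑ f ∈ n.divisors, ∑ x ∈ f.divisorsAntidiagonal, (moebius x.1 : ℝ) * H x.2 := by
  have h := (sum_eq_iff_sum_mul_moebius_eq (R := ℝ)
    (f := fun f => ∑ x ∈ f.divisorsAntidiagonal, (moebius x.1 : ℝ) * H x.2) (g := H)).mpr
    (fun _ _ => rfl)
  exact (h n hn).symm

lemma sum_inv_dvd_le {P : ℕ} (Z : ℕ) :
    ∑ p ∈ Icc 1 P, (#{e ∈ Icc 1 Z | p ∣ e} : ℝ) ≤ Z * ∑ p ∈ Icc 1 P, (p : ℝ)⁻¹ := by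
  rw [mul_sum]
  refine sum_le_sum fun p _ => ?_
  have : #{e ∈ Icc 1 Z | p ∣ e} = Z / p := by
    rw [show Icc 1 Z = Ioc 0 Z from rfl, Nat.Ioc_filter_dvd_card_eq_div]
  rw [this, ← div_eq_mul_inv]
  exact Nat.cast_div_le

lemma sum_Icc_filter_dvd {f J : ℕ} (hf : 0 < f) (g : ℕ → ℝ) :
    ∑ s ∈ Icc 1 J with f ∣ s, g s = ∑ m ∈ Icc 1 (J / f), g (f * m) := by
  symm
  refine sum_bij (fun m _ => f * m) ?_ ?_ ?_ ?_
  · intro m hm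
    rw [mem_Icc] at hm
    rw [mem_filter, mem_Icc]
    refine ⟨⟨Nat.mul_pos hf hm.1, ?_⟩, dvd_mul_right _ _⟩
    calc f * m ≤ f * (J / f) := Nat.mul_le_mul_left _ hm.2
      _ ≤ J := Nat.mul_div_le _ _
  · intro m _ m' _ h; exact Nat.eq_of_mul_eq_mul_left hf h
  · intro s hs
    rw [mem_filter, mem_Icc] at hs
    obtain ⟨⟨h1, h2⟩, m, rfl⟩ := hs
    refine ⟨m, ?_, rfl⟩
    rw [mem_Icc]
    exact ⟨Nat.pos_of_ne_zero (by rintro rfl; simp at h1),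
      (Nat.le_div_iff_mul_le hf).mpr (by linarith [mul_comm m f])⟩
  · intros; rfl

/-- The coefficient `μ(s) s ∑_{j ∈ 𝒥, s ∣ j} 1/φ(j)`. -/
noncomputable def windowCoeff (𝒥 : Finset ℕ) (s : ℕ) : ℝ :=
  moebius s * s * ∑ j ∈ 𝒥 with s ∣ j, (j.totient : ℝ)⁻¹

lemma abs_moebius_le_one_real (s : ℕ) : |(moebius s : ℝ)| ≤ 1 := by
  have := abs_moebius_le_one (n := s)
  exact_mod_cast this

lemma inv_totient_le {D : ℝ} {n : ℕ} (hn : n ≠ 0) (hD : (#n.divisors : ℝ) ≤ D) :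
    (n.totient : ℝ)⁻¹ ≤ D * (n : ℝ)⁻¹ := by
  have h := le_totient_mul_card_divisors hn
  have h1 : (0 : ℝ) < n.totient := by
    exact_mod_cast Nat.totient_pos.mpr (Nat.pos_of_ne_zero hn)
  have h2 : (0 : ℝ) < n := by exact_mod_cast Nat.pos_of_ne_zero hn
  have h3 : (n : ℝ) ≤ n.totient * #n.divisors := by exact_mod_cast h
  rw [← div_eq_mul_inv, inv_eq_one_div, div_le_div_iff₀ h1 h2]
  nlinarith

lemma mul_sum_inv_totient_le {J : ℕ} {D H : ℝ} (hD : ∀ n ∈ Icc 1 J, (#n.divisors : ℝ) ≤ D)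
    (hD0 : 0 ≤ D) (hH : ∑ n ∈ Icc 1 J, (n : ℝ)⁻¹ ≤ H) {s : ℕ} (hs : 0 < s) :
    s * ∑ j ∈ Icc 1 J with s ∣ j, (j.totient : ℝ)⁻¹ ≤ D * H := by
  have hs' : (0 : ℝ) < s := by exact_mod_cast hs
  calc _ ≤ s * ∑ j ∈ Icc 1 J with s ∣ j, D * (j : ℝ)⁻¹ := by
        gcongr with j hj
        have hj' := (mem_filter.mp hj).1
        exact inv_totient_le (by have := mem_Icc.mp hj'; omega) (hD j hj')
    _ = D * ∑ m ∈ Icc 1 (J / s), (m : ℝ)⁻¹ := by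
        rw [sum_Icc_filter_dvd hs (fun j => D * (j : ℝ)⁻¹), mul_sum, mul_sum]
        refine sum_congr rfl fun m _ => ?_
        push_cast
        field_simp
    _ ≤ D * ∑ m ∈ Icc 1 J, (m : ℝ)⁻¹ := by
        gcongr
        exact Nat.div_le_self _ _
    _ ≤ D * H := by gcongr

lemma abs_windowCoeff_le {𝒥 : Finset ℕ} {J : ℕ} {D H : ℝ} (hJ : 𝒥 ⊆ Icc 1 J)
    (hD : ∀ n ∈ Icc 1 J, (#n.divisors : ℝ) ≤ D) (hD0 : 0 ≤ D)
    (hH : ∑ n ∈ Icc 1 J, (n : ℝ)⁻¹ ≤ H) {s : ℕ} (hs : 0 < s) : |windowCoeff 𝒥 s| ≤ D * H := by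
  refine le_trans ?_ (mul_sum_inv_totient_le hD hD0 hH hs)
  unfold windowCoeff
  have h0 : 0 ≤ ∑ j ∈ 𝒥 with s ∣ j, (j.totient : ℝ)⁻¹ := sum_nonneg fun _ _ => by positivity
  rw [abs_mul, abs_mul, Nat.abs_cast, abs_of_nonneg h0]
  calc _ ≤ 1 * s * ∑ j ∈ 𝒥 with s ∣ j, (j.totient : ℝ)⁻¹ := by
        gcongr; exact abs_moebius_le_one_real s
    _ ≤ _ := by rw [one_mul]; gcongr

lemma window_sum_eq {W 𝒥 : Finset ℕ} {J : ℕ} (hW : ∀ p ∈ W, p.Prime) (hJ : 𝒥 ⊆ Icc 1 J)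
    (hWJ : ∀ j ∈ 𝒥, ∀ p ∈ W, ¬ p ∣ j) (G : ℕ → ℝ) :
    ∑ p ∈ W, ∑ j ∈ 𝒥, ((p * j).totient : ℝ)⁻¹ *
        ∑ d ∈ (p * j).divisors, (moebius d : ℝ) * d * G d =
      ∑ p ∈ W, (p.totient : ℝ)⁻¹ * ∑ j ∈ 𝒥, (j.totient : ℝ)⁻¹ *
        ∑ s ∈ j.divisors, (moebius s : ℝ) * s * G s -
      ∑ s ∈ Icc 1 J, windowCoeff 𝒥 s * ∑ p ∈ W, (p / p.totient : ℝ) * G (p * s) := by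
  have h2 : ∑ s ∈ Icc 1 J, windowCoeff 𝒥 s * ∑ p ∈ W, (p / p.totient : ℝ) * G (p * s) =
      ∑ p ∈ W, ∑ j ∈ 𝒥, ∑ s ∈ j.divisors, (p / p.totient : ℝ) * (j.totient : ℝ)⁻¹ *
        ((moebius s : ℝ) * s * G (p * s)) := by
    have hdiv : ∀ j ∈ 𝒥, j.divisors = {s ∈ Icc 1 J | s ∣ j} := by
      intro j hj
      have hj' := mem_Icc.mp (hJ hj)
      ext s
      simp only [Nat.mem_divisors, mem_filter, mem_Icc]
      constructor
      · rintro ⟨h, _⟩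
        exact ⟨⟨Nat.pos_of_dvd_of_pos h (by omega), (Nat.le_of_dvd (by omega) h).trans hj'.2⟩, h⟩
      · rintro ⟨_, h⟩; exact ⟨h, by omega⟩
    have : ∀ p ∈ W, ∑ j ∈ 𝒥, ∑ s ∈ j.divisors, (p / p.totient : ℝ) * (j.totient : ℝ)⁻¹ *
        ((moebius s : ℝ) * s * G (p * s)) = ∑ s ∈ Icc 1 J, windowCoeff 𝒥 s *
          ((p / p.totient : ℝ) * G (p * s)) := by
      intro p _
      calc _ = ∑ j ∈ 𝒥, ∑ s ∈ Icc 1 J, if s ∣ j then (p / p.totient : ℝ) * (j.totient : ℝ)⁻¹ *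
            ((moebius s : ℝ) * s * G (p * s)) else 0 :=
            sum_congr rfl fun j hj => by rw [hdiv j hj, sum_filter]
        _ = _ := by
            rw [sum_comm]
            refine sum_congr rfl fun s _ => ?_
            unfold windowCoeff
            rw [← sum_filter, mul_sum, sum_mul]
            refine sum_congr rfl fun j _ => ?_
            ring
    rw [sum_congr rfl this, sum_comm]
    exact sum_congr rfl fun s _ => by rw [mul_sum]
  rw [h2, ← sum_sub_distrib]
  refine sum_congr rfl fun p hp => ?_
  rw [mul_sum, ← sum_sub_distrib]
  refine sum_congr rfl fun j hj => ?_
  have hpj := hWJ j hj p hp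
  have hc : p.Coprime j := (Nat.Prime.coprime_iff_not_dvd (hW p hp)).mpr hpj
  rw [sum_divisors_prime_mul (hW p hp) hpj, Nat.totient_mul hc, mul_sum, mul_sum, mul_sum,
    ← sum_sub_distrib]
  refine sum_congr rfl fun s hs => ?_
  have hcs : p.Coprime s := hc.coprime_dvd_right (Nat.dvd_of_mem_divisors hs)
  rw [isMultiplicative_moebius.map_mul_of_coprime hcs, moebius_apply_prime (hW p hp)]
  push_cast
  rw [mul_inv]
  ring

lemma prime_div_totient_le_two {p : ℕ} (hp : p.Prime) : (p / p.totient : ℝ) ≤ 2 := by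
  rw [Nat.totient_prime hp]
  have h2 : (2 : ℝ) ≤ p := by exact_mod_cast hp.two_le
  rw [Nat.cast_pred hp.pos, div_le_iff₀ (by linarith)]
  linarith

lemma sum_inv_totient_prime_le {W : Finset ℕ} {P : ℕ} {H : ℝ}
    (hW : ∀ p ∈ W, p.Prime ∧ p ≤ P) (hH : ∑ n ∈ Icc 1 P, (n : ℝ)⁻¹ ≤ H) :
    ∑ p ∈ W, (p.totient : ℝ)⁻¹ ≤ 2 * H := by
  calc _ ≤ ∑ p ∈ W, 2 * (p : ℝ)⁻¹ := sum_le_sum fun p hp => by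
        have h := prime_div_totient_le_two (hW p hp).1
        have h0 : (0 : ℝ) < p := by exact_mod_cast (hW p hp).1.pos
        rw [div_eq_mul_inv] at h
        rw [← div_eq_mul_inv, le_div_iff₀ h0]; linarith
    _ = 2 * ∑ p ∈ W, (p : ℝ)⁻¹ := by rw [mul_sum]
    _ ≤ 2 * ∑ n ∈ Icc 1 P, (n : ℝ)⁻¹ := by
        gcongr
        exact fun p hp => mem_Icc.mpr ⟨(hW p hp).1.pos, (hW p hp).2⟩
    _ ≤ _ := by gcongr

lemma abs_sum_le_card_mul {s : Finset ℕ} {f : ℕ → ℝ} {C : ℝ} (h : ∀ i ∈ s, |f i| ≤ C) :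
    |∑ i ∈ s, f i| ≤ #s * C := by
  refine (abs_sum_le_sum_abs _ _).trans ?_
  rw [← nsmul_eq_mul]
  exact sum_le_card_nsmul _ _ _ h

/-- The contribution of the divisors `s ∣ j` not involving the window prime. -/
lemma window_first_part_le {W 𝒥 : Finset ℕ} {P J : ℕ} {D H g : ℝ}
    (hW : ∀ p ∈ W, p.Prime ∧ p ≤ P) (hJ : 𝒥 ⊆ Icc 1 J)
    (hD : ∀ n ∈ Icc 1 J, (#n.divisors : ℝ) ≤ D) (hD0 : 0 ≤ D) (hg0 : 0 ≤ g)
    (hH : ∑ n ∈ Icc 1 P, (n : ℝ)⁻¹ ≤ H) {G : ℕ → ℝ} (hG : ∀ s, 0 < s → |G s| ≤ g) :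
    |∑ p ∈ W, (p.totient : ℝ)⁻¹ * ∑ j ∈ 𝒥, (j.totient : ℝ)⁻¹ *
        ∑ s ∈ j.divisors, (moebius s : ℝ) * s * G s| ≤ 2 * H * (J * (D ^ 2 * g)) := by
  rw [← sum_mul, abs_mul, abs_of_nonneg (sum_nonneg fun _ _ => by positivity)]
  refine mul_le_mul (sum_inv_totient_prime_le hW hH) ?_ (abs_nonneg _)
    ((sum_nonneg fun _ _ => by positivity).trans (sum_inv_totient_prime_le hW hH))
  have hc : (#𝒥 : ℝ) ≤ J := by
    have := card_le_card hJ; rw [Nat.card_Icc, Nat.add_sub_cancel] at this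
    exact_mod_cast this
  refine (abs_sum_le_card_mul (C := D ^ 2 * g) fun j hj => ?_).trans (by gcongr)
  have hj1 := mem_Icc.mp (hJ hj)
  have hj0 : (0 : ℝ) < j := by exact_mod_cast (by omega : 0 < j)
  rw [abs_mul, abs_of_nonneg (by positivity)]
  have h1 : |∑ s ∈ j.divisors, (moebius s : ℝ) * s * G s| ≤ D * (j * g) := by
    refine (abs_sum_le_card_mul (C := j * g) fun s hs => ?_).trans
      (by gcongr; exact hD j (hJ hj))
    have hs0 := Nat.pos_of_mem_divisors hs
    rw [abs_mul, abs_mul, Nat.abs_cast]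
    have h2 : (s : ℝ) ≤ j := by exact_mod_cast Nat.divisor_le hs
    calc _ ≤ 1 * (j : ℝ) * g := by
          gcongr
          · exact abs_moebius_le_one_real s
          · exact hG s hs0
      _ = _ := by ring
  calc _ ≤ D * (j : ℝ)⁻¹ * (D * (j * g)) := by
        gcongr
        exact inv_totient_le (by omega) (hD j (hJ hj))
    _ = _ := by field_simp

/-- The part of the window error term attached to a fixed common divisor `f = c g` of the two
remaining variables. -/
noncomputable def gcdPart (R κ α β : ℕ → ℝ) (W : Finset ℕ) (J Z f g : ℕ) : ℝ :=
  ∑ s ∈ Icc 1 J with f ∣ s, ∑ p ∈ W, ∑ e ∈ Icc 1 Z with f ∣ e,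
    κ s * (α p * if p ∣ e then 0 else β e) * R (p * (s * e / g))

lemma lcm_prime_mul_eq {p s e : ℕ} (hp : p.Prime) (hpe : ¬ p ∣ e) :
    Nat.lcm (p * s) e = p * (s * e / Nat.gcd s e) := by
  have hc : p.Coprime e := (Nat.Prime.coprime_iff_not_dvd hp).mpr hpe
  rw [Nat.lcm, hc.gcd_mul_left_cancel, mul_assoc,
    Nat.mul_div_assoc _ ((Nat.gcd_dvd_left s e).mul_right e)]

lemma sum_coprime_part_eq {R κ α β : ℕ → ℝ} {W : Finset ℕ} {J Z : ℕ}
    (hW : ∀ p ∈ W, p.Prime) :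
    ∑ s ∈ Icc 1 J, ∑ p ∈ W, ∑ e ∈ Icc 1 Z,
      κ s * (α p * if p ∣ e then 0 else β e) * R (Nat.lcm (p * s) e) =
    ∑ f ∈ Icc 1 J, ∑ x ∈ f.divisorsAntidiagonal,
      (moebius x.1 : ℝ) * gcdPart R κ α β W J Z f x.2 := by
  have h1 : ∀ s ∈ Icc 1 J, ∀ p ∈ W, ∀ e ∈ Icc 1 Z,
      κ s * (α p * if p ∣ e then 0 else β e) * R (Nat.lcm (p * s) e) =
      ∑ f ∈ Icc 1 J, if f ∣ s then (if f ∣ e then ∑ x ∈ f.divisorsAntidiagonal,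
        (moebius x.1 : ℝ) * (κ s * (α p * if p ∣ e then 0 else β e) * R (p * (s * e / x.2)))
        else 0) else 0 := by
    intro s hs p hp e he
    rw [mem_Icc] at hs he
    split_ifs with hpe
    · simp
    · have hg : 0 < Nat.gcd s e := Nat.gcd_pos_of_pos_left _ (by omega)
      rw [lcm_prime_mul_eq (hW p hp) hpe, eq_sum_moebius_gcd (fun n => R (p * (s * e / n))) hg]
      have hset : (Nat.gcd s e).divisors = {f ∈ Icc 1 J | f ∣ s ∧ f ∣ e} := by
        ext f
        simp only [Nat.mem_divisors, mem_filter, mem_Icc, Nat.dvd_gcd_iff]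
        constructor
        · rintro ⟨h, _⟩
          exact ⟨⟨Nat.pos_of_dvd_of_pos h.1 (by omega), (Nat.le_of_dvd (by omega) h.1).trans hs.2⟩,
            h⟩
        · rintro ⟨_, h⟩; exact ⟨h, hg.ne'⟩
      simp_rw [← ite_and]
      rw [hset, ← sum_filter, mul_sum]
      refine sum_congr rfl fun f _ => ?_
      rw [mul_sum]
      exact sum_congr rfl fun x _ => by ring
  have h2 : ∀ f ∈ Icc 1 J, ∑ x ∈ f.divisorsAntidiagonal,
      (moebius x.1 : ℝ) * gcdPart R κ α β W J Z f x.2 =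
      ∑ s ∈ Icc 1 J, ∑ p ∈ W, ∑ e ∈ Icc 1 Z, if f ∣ s then (if f ∣ e then
        ∑ x ∈ f.divisorsAntidiagonal, (moebius x.1 : ℝ) *
          (κ s * (α p * if p ∣ e then 0 else β e) * R (p * (s * e / x.2))) else 0) else 0 := by
    intro f _
    unfold gcdPart
    simp_rw [mul_sum]
    rw [sum_comm, sum_filter]
    refine sum_congr rfl fun s _ => ?_
    split_ifs with hfs
    · rw [sum_comm]
      refine sum_congr rfl fun p _ => ?_
      rw [sum_comm, sum_filter]
    · simp
  rw [sum_congr rfl h2]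
  conv_rhs => rw [sum_comm]
  refine sum_congr rfl fun s hs => ?_
  conv_rhs => rw [sum_comm]
  refine sum_congr rfl fun p hp => ?_
  conv_rhs => rw [sum_comm]
  exact sum_congr rfl fun e he => h1 s hs p hp e he

lemma card_filter_dvd_Icc (f J : ℕ) : #{s ∈ Icc 1 J | f ∣ s} = J / f := by
  rw [show Icc 1 J = Ioc 0 J from rfl, Nat.Ioc_filter_dvd_card_eq_div]

lemma abs_gcdPart_le {R κ α β : ℕ → ℝ} {W : Finset ℕ} {P J Z f g : ℕ} {k0 b : ℝ}
    (hR : ∀ d, |R d| ≤ 2) (hκ : ∀ s, 0 < s → |κ s| ≤ k0) (hα : ∀ p ∈ W, |α p| ≤ 2)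
    (hb : 0 ≤ b) (hβ : ∀ e ∈ Icc 1 Z, |β e| ≤ b) (hW : #W ≤ P) :
    |gcdPart R κ α β W J Z f g| ≤ 4 * k0 * b * (J * P * Z) / (f : ℝ) ^ 2 := by
  have hk0 : 0 ≤ k0 := (abs_nonneg _).trans (hκ 1 one_pos)
  unfold gcdPart
  have hterm : ∀ s ∈ {s ∈ Icc 1 J | f ∣ s}, ∀ p ∈ W, ∀ e ∈ {e ∈ Icc 1 Z | f ∣ e},
      |κ s * (α p * if p ∣ e then 0 else β e) * R (p * (s * e / g))| ≤ k0 * (2 * b) * 2 := by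
    intro s hs p hp e he
    rw [mem_filter, mem_Icc] at hs
    rw [mem_filter] at he
    rw [abs_mul, abs_mul, abs_mul]
    have : |if p ∣ e then 0 else β e| ≤ b := by
      split_ifs
      · simpa using hb
      · exact hβ e he.1
    gcongr
    · exact hκ s (by omega)
    · exact hα p hp
    · exact hR _
  have h1 := abs_sum_le_card_mul fun s hs => abs_sum_le_card_mul fun p hp =>
    abs_sum_le_card_mul fun e he => hterm s hs p hp e he
  refine h1.trans ?_
  rw [card_filter_dvd_Icc, card_filter_dvd_Icc]
  have h2 : ((J / f : ℕ) : ℝ) ≤ J / f := Nat.cast_div_le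
  have h3 : ((Z / f : ℕ) : ℝ) ≤ Z / f := Nat.cast_div_le
  have h4 : (#W : ℝ) ≤ P := by exact_mod_cast hW
  calc _ ≤ (J / f : ℝ) * (P * ((Z / f : ℝ) * (k0 * (2 * b) * 2))) := by gcongr
    _ = _ := by ring

lemma abs_gcdPart_le_of_bilinear {R κ α β : ℕ → ℝ} {W : Finset ℕ} {P J Z f c g F : ℕ}
    {k0 b D K : ℝ} (hκ : ∀ s, 0 < s → |κ s| ≤ k0) (hk0 : 0 < k0) (hα : ∀ p ∈ W, |α p| ≤ 2)
    (hb : 0 < b) (hβ : ∀ e ∈ Icc 1 Z, |β e| ≤ b) (hW : ∀ p ∈ W, p.Prime ∧ p ≤ P)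
    (hf : f = c * g) (hf0 : 0 < f) (hfF : f ≤ F) (hD1 : 0 < D)
    (hD : ∀ n ∈ Icc 1 (P * Z), (#n.divisors : ℝ) ≤ D)
    (hK : ∀ t, 1 ≤ t → t ≤ F ^ 2 → ∀ a c : ℕ → ℝ, (∀ u, |a u| ≤ 1) → (∀ v, |c v| ≤ 1) →
      |∑ u ∈ Icc 1 (P * Z), ∑ v ∈ Icc 1 J, a u * c v * R (t * (u * v))| ≤ K) :
    |gcdPart R κ α β W J Z f g| ≤ 2 * b * D * k0 * K := by
  have hc0 : 0 < c := Nat.pos_of_ne_zero (by rintro rfl; simp at hf; omega)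
  have hg0 : 0 < g := Nat.pos_of_ne_zero (by rintro rfl; simp at hf; omega)
  set γ : ℕ → ℕ → ℝ := fun p n => α p * if p ∣ f * n then 0 else β (f * n) with hγ
  set A : ℕ → ℝ := fun u => ∑ z ∈ W ×ˢ Icc 1 (Z / f) with z.1 * z.2 = u, γ z.1 z.2 with hA
  set C : ℕ → ℝ := fun v => if v ∈ Icc 1 (J / f) then κ (f * v) else 0 with hC
  have hmem : ∀ n ∈ Icc 1 (Z / f), f * n ∈ Icc 1 Z := by
    intro n hn
    rw [mem_Icc] at hn ⊢
    exact ⟨Nat.mul_pos hf0 hn.1, (Nat.mul_le_mul_left _ hn.2).trans (Nat.mul_div_le _ _)⟩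
  have hAb : ∀ u, |A u| ≤ 2 * b * D := by
    intro u
    simp only [hA]
    have hγb : ∀ z ∈ {z ∈ W ×ˢ Icc 1 (Z / f) | z.1 * z.2 = u}, |γ z.1 z.2| ≤ 2 * b := by
      intro z hz
      rw [mem_filter, mem_product] at hz
      simp only [hγ]
      rw [abs_mul]
      have : |if z.1 ∣ f * z.2 then 0 else β (f * z.2)| ≤ b := by
        split_ifs
        · simpa using hb.le
        · exact hβ _ (hmem _ hz.1.2)
      gcongr
      exact hα _ hz.1.1
    rcases ({z ∈ W ×ˢ Icc 1 (Z / f) | z.1 * z.2 = u}).eq_empty_or_nonempty with he | ⟨z0, hz0⟩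
    · rw [he, sum_empty, abs_zero]; positivity
    · rw [mem_filter, mem_product] at hz0
      have hu : u ∈ Icc 1 (P * Z) := by
        rw [← hz0.2, mem_Icc]
        have h1 := hW _ hz0.1.1
        have h2 := mem_Icc.mp hz0.1.2
        exact ⟨Nat.mul_pos h1.1.pos h2.1, Nat.mul_le_mul h1.2 (h2.2.trans (Nat.div_le_self _ _))⟩
      have hu0 : u ≠ 0 := by have := mem_Icc.mp hu; omega
      have hcard : #{z ∈ W ×ˢ Icc 1 (Z / f) | z.1 * z.2 = u} ≤ #u.divisors := by
        refine card_le_card_of_injOn (fun z => z.1) ?_ ?_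
        · intro z hz
          simp only [coe_filter, Set.mem_ofPred_eq] at hz
          exact Nat.mem_divisors.mpr ⟨⟨z.2, hz.2.symm⟩, hu0⟩
        · rintro ⟨p, n⟩ hz ⟨p', n'⟩ hz' h
          simp only [coe_filter, Set.mem_ofPred_eq] at hz hz' h
          subst h
          have hp0 : p ≠ 0 := by rintro rfl; apply hu0; rw [← hz.2]; simp
          have := Nat.eq_of_mul_eq_mul_left (Nat.pos_of_ne_zero hp0) (hz.2.trans hz'.2.symm)
          rw [this]
      refine (abs_sum_le_sum_abs _ _).trans ?_
      refine (sum_le_card_nsmul _ _ _ hγb).trans ?_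
      rw [nsmul_eq_mul]
      have : (#{z ∈ W ×ˢ Icc 1 (Z / f) | z.1 * z.2 = u} : ℝ) ≤ D :=
        le_trans (by exact_mod_cast hcard) (hD u hu)
      nlinarith
  have hCb : ∀ v, |C v| ≤ k0 := by
    intro v
    simp only [hC]
    split_ifs with hv
    · exact hκ _ (Nat.mul_pos hf0 (mem_Icc.mp hv).1)
    · simpa using hk0.le
  have hform : gcdPart R κ α β W J Z f g =
      ∑ u ∈ Icc 1 (P * Z), ∑ v ∈ Icc 1 J, A u * C v * R (f * c * (u * v)) := by
    have r1 : gcdPart R κ α β W J Z f g = ∑ m ∈ Icc 1 (J / f), ∑ z ∈ W ×ˢ Icc 1 (Z / f),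
        κ (f * m) * γ z.1 z.2 * R (f * c * (z.1 * z.2 * m)) := by
      unfold gcdPart
      rw [sum_Icc_filter_dvd hf0]
      refine sum_congr rfl fun m _ => ?_
      rw [sum_product]
      refine sum_congr rfl fun p _ => ?_
      rw [sum_Icc_filter_dvd hf0]
      refine sum_congr rfl fun n _ => ?_
      simp only [hγ]
      congr 2
      have : f * m * (f * n) / g = f * c * (m * n) := by
        rw [show f * m * (f * n) = f * c * (m * n) * g by rw [hf]; ring]
        exact Nat.mul_div_cancel _ hg0
      rw [this]; ring
    rw [r1, sum_comm]
    have hmaps : ∀ z ∈ W ×ˢ Icc 1 (Z / f), z.1 * z.2 ∈ Icc 1 (P * Z) := by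
      intro z hz
      rw [mem_product] at hz
      have h1 := hW _ hz.1
      have h2 := mem_Icc.mp hz.2
      exact mem_Icc.mpr ⟨Nat.mul_pos h1.1.pos h2.1,
        Nat.mul_le_mul h1.2 (h2.2.trans (Nat.div_le_self _ _))⟩
    refine (sum_fiberwise_of_maps_to (M := ℝ) hmaps _).symm.trans ?_
    refine sum_congr rfl fun u _ => ?_
    have r2 : ∑ v ∈ Icc 1 J, A u * C v * R (f * c * (u * v)) =
        ∑ v ∈ Icc 1 (J / f), A u * κ (f * v) * R (f * c * (u * v)) := by
      refine (sum_subset (M := ℝ) (Icc_subset_Icc_right (Nat.div_le_self J f)) ?_).symm.trans ?_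
      · intro v _ hv; simp only [hC, hv, if_false]; ring
      · exact sum_congr rfl fun v hv => by simp only [hC, hv, if_true]
    rw [r2, sum_comm]
    refine sum_congr rfl fun v _ => ?_
    simp only [hA]
    rw [sum_mul, sum_mul]
    refine sum_congr rfl fun z hz => ?_
    rw [(mem_filter.mp hz).2]; ring
  have ht : f * c ≤ F ^ 2 := by
    have : c ≤ f := Nat.le_of_dvd hf0 ⟨g, hf⟩
    rw [sq]; exact Nat.mul_le_mul hfF (this.trans hfF)
  have hx : 0 < 2 * b * D := by positivity
  have h := hK (f * c) (Nat.mul_pos hf0 hc0) ht (fun u => A u / (2 * b * D)) (fun v => C v / k0)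
    (fun u => by rw [abs_div, abs_of_pos hx, div_le_one hx]; exact hAb u)
    (fun v => by rw [abs_div, abs_of_pos hk0, div_le_one hk0]; exact hCb v)
  have e : ∑ u ∈ Icc 1 (P * Z), ∑ v ∈ Icc 1 J, A u / (2 * b * D) * (C v / k0) *
      R (f * c * (u * v)) = gcdPart R κ α β W J Z f g / (2 * b * D * k0) := by
    rw [hform]
    simp_rw [sum_div]
    refine sum_congr (M := ℝ) rfl fun u _ => sum_congr (M := ℝ) rfl fun v _ => ?_
    field_simp
  rw [e, abs_div, abs_of_pos (by positivity : 0 < 2 * b * D * k0), div_le_iff₀ (by positivity)] at h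
  linarith

lemma abs_sum_antidiagonal_le {f : ℕ} {D B : ℝ} (hD : (#f.divisors : ℝ) ≤ D) (hB : 0 ≤ B)
    {G : ℕ → ℝ} (hG : ∀ x ∈ f.divisorsAntidiagonal, |G x.2| ≤ B) :
    |∑ x ∈ f.divisorsAntidiagonal, (moebius x.1 : ℝ) * G x.2| ≤ D * B := by
  refine (abs_sum_le_sum_abs _ _).trans ?_
  refine (sum_le_card_nsmul _ _ B fun x hx => ?_).trans ?_
  · rw [abs_mul]
    calc _ ≤ 1 * B := by
          gcongr
          · exact abs_moebius_le_one_real _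
          · exact hG x hx
      _ = B := one_mul B
  · rw [nsmul_eq_mul, ← Nat.map_div_right_divisors, card_map]
    gcongr

lemma sum_inv_sq_le {F J : ℕ} (hF : 1 ≤ F) {H : ℝ} (hH : ∑ n ∈ Icc 1 J, (n : ℝ)⁻¹ ≤ H) :
    ∑ f ∈ Icc 1 J with ¬ f ≤ F, ((f : ℝ) ^ 2)⁻¹ ≤ H / F := by
  have hF0 : (0 : ℝ) < F := by exact_mod_cast hF
  calc _ ≤ ∑ f ∈ Icc 1 J with ¬ f ≤ F, (F : ℝ)⁻¹ * (f : ℝ)⁻¹ := sum_le_sum fun f hf => by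
        rw [mem_filter, not_le] at hf
        have h : (F : ℝ) ≤ f := by exact_mod_cast hf.2.le
        have h0 : (0 : ℝ) < f := hF0.trans_le h
        rw [sq, mul_inv]
        gcongr
    _ ≤ ∑ f ∈ Icc 1 J, (F : ℝ)⁻¹ * (f : ℝ)⁻¹ :=
        sum_le_sum_of_subset_of_nonneg (filter_subset _ _) fun _ _ _ => by positivity
    _ ≤ _ := by rw [← mul_sum, div_eq_inv_mul]; gcongr

lemma abs_coprime_part_le {R κ α β : ℕ → ℝ} {W : Finset ℕ} {P J Z F : ℕ} {k0 b D H K : ℝ}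
    (hR : ∀ d, |R d| ≤ 2) (hκ : ∀ s, 0 < s → |κ s| ≤ k0) (hk0 : 0 < k0)
    (hα : ∀ p ∈ W, |α p| ≤ 2) (hb : 0 < b) (hβ : ∀ e ∈ Icc 1 Z, |β e| ≤ b)
    (hW : ∀ p ∈ W, p.Prime ∧ p ≤ P) (hD0 : 0 < D)
    (hDJ : ∀ n ∈ Icc 1 J, (#n.divisors : ℝ) ≤ D)
    (hDZ : ∀ n ∈ Icc 1 (P * Z), (#n.divisors : ℝ) ≤ D)
    (hHJ : ∑ n ∈ Icc 1 J, (n : ℝ)⁻¹ ≤ H) (hF : 1 ≤ F)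
    (hK : ∀ t, 1 ≤ t → t ≤ F ^ 2 → ∀ a c : ℕ → ℝ, (∀ u, |a u| ≤ 1) → (∀ v, |c v| ≤ 1) →
      |∑ u ∈ Icc 1 (P * Z), ∑ v ∈ Icc 1 J, a u * c v * R (t * (u * v))| ≤ K) :
    |∑ s ∈ Icc 1 J, ∑ p ∈ W, ∑ e ∈ Icc 1 Z,
      κ s * (α p * if p ∣ e then 0 else β e) * R (Nat.lcm (p * s) e)| ≤
      F * (D * (2 * b * D * k0 * K)) + D * (4 * k0 * b * (J * P * Z)) * (H / F) := by
  have hK0 : 0 ≤ K := (abs_nonneg _).trans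
    (hK 1 le_rfl (Nat.one_le_pow _ _ hF) (fun _ => 0) (fun _ => 0) (by simp) (by simp))
  have hcW : #W ≤ P := by
    have : W ⊆ Icc 1 P := fun p hp => mem_Icc.mpr ⟨(hW p hp).1.pos, (hW p hp).2⟩
    simpa using card_le_card this
  rw [sum_coprime_part_eq fun p hp => (hW p hp).1, ← sum_filter_add_sum_filter_not _ (· ≤ F)]
  refine (abs_add_le _ _).trans (add_le_add ?_ ?_)
  · refine (abs_sum_le_card_mul (C := D * (2 * b * D * k0 * K)) fun f hf => ?_).trans ?_
    · rw [mem_filter] at hf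
      have hf1 := mem_Icc.mp hf.1
      refine abs_sum_antidiagonal_le (hDJ f hf.1) (by positivity) fun x hx => ?_
      exact abs_gcdPart_le_of_bilinear hκ hk0 hα hb hβ hW
        (Nat.mem_divisorsAntidiagonal.mp hx).1.symm (by omega) hf.2 hD0 hDZ hK
    · have : #{f ∈ Icc 1 J | f ≤ F} ≤ F := by
        have : {f ∈ Icc 1 J | f ≤ F} ⊆ Icc 1 F := fun f hf => by
          rw [mem_filter, mem_Icc] at hf
          exact mem_Icc.mpr ⟨hf.1.1, hf.2⟩
        simpa using card_le_card this
      have : (#{f ∈ Icc 1 J | f ≤ F} : ℝ) ≤ F := by exact_mod_cast this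
      gcongr
  · refine (abs_sum_le_sum_abs _ _).trans ?_
    calc _ ≤ ∑ f ∈ Icc 1 J with ¬ f ≤ F, D * (4 * k0 * b * (J * P * Z)) * ((f : ℝ) ^ 2)⁻¹ :=
          sum_le_sum fun f hf => by
            rw [mem_filter] at hf
            rw [mul_assoc, ← div_eq_mul_inv]
            refine abs_sum_antidiagonal_le (hDJ f hf.1) (by positivity) fun x hx => ?_
            exact abs_gcdPart_le hR hκ hα hb.le hβ hcW
      _ ≤ _ := by
          rw [← mul_sum]
          gcongr
          exact sum_inv_sq_le hF hHJ

lemma abs_dvd_part_le {R κ α β : ℕ → ℝ} {W : Finset ℕ} {P J Z : ℕ} {k0 b H : ℝ}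
    (hR : ∀ d, |R d| ≤ 2) (hκ : ∀ s, 0 < s → |κ s| ≤ k0) (hk0 : 0 < k0)
    (hα : ∀ p ∈ W, |α p| ≤ 2) (hb : 0 < b) (hβ : ∀ e ∈ Icc 1 Z, |β e| ≤ b)
    (hW : ∀ p ∈ W, p.Prime ∧ p ≤ P) (hHP : ∑ n ∈ Icc 1 P, (n : ℝ)⁻¹ ≤ H) :
    |∑ s ∈ Icc 1 J, ∑ p ∈ W, ∑ e ∈ Icc 1 Z,
      κ s * (α p * if p ∣ e then β e else 0) * R (Nat.lcm (p * s) e)| ≤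
      4 * k0 * b * (J * Z) * H := by
  have h1 : ∀ s ∈ Icc 1 J, |∑ p ∈ W, ∑ e ∈ Icc 1 Z,
      κ s * (α p * if p ∣ e then β e else 0) * R (Nat.lcm (p * s) e)| ≤
      4 * k0 * b * (Z * H) := by
    intro s hs
    refine (abs_sum_le_sum_abs _ _).trans ?_
    calc _ ≤ ∑ p ∈ W, 4 * k0 * b * (#{e ∈ Icc 1 Z | p ∣ e} : ℝ) := sum_le_sum fun p hp => by
          have : ∑ e ∈ Icc 1 Z, κ s * (α p * if p ∣ e then β e else 0) * R (Nat.lcm (p * s) e) =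
              ∑ e ∈ Icc 1 Z with p ∣ e, κ s * (α p * β e) * R (Nat.lcm (p * s) e) := by
            rw [sum_filter]
            exact sum_congr rfl fun e _ => by split_ifs <;> simp
          rw [this, mul_comm (4 * k0 * b)]
          refine abs_sum_le_card_mul fun e he => ?_
          rw [abs_mul, abs_mul, abs_mul]
          calc _ ≤ k0 * (2 * b) * 2 := by
                gcongr
                · exact hκ s (mem_Icc.mp hs).1
                · exact hα p hp
                · exact hβ e (mem_filter.mp he).1
                · exact hR _
            _ = _ := by ring
      _ ≤ ∑ p ∈ Icc 1 P, 4 * k0 * b * (#{e ∈ Icc 1 Z | p ∣ e} : ℝ) :=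
          sum_le_sum_of_subset_of_nonneg
            (fun p hp => mem_Icc.mpr ⟨(hW p hp).1.pos, (hW p hp).2⟩) fun _ _ _ => by positivity
      _ ≤ _ := by
          rw [← mul_sum]
          gcongr
          refine (sum_inv_dvd_le Z).trans ?_
          gcongr
  refine (abs_sum_le_card_mul h1).trans (le_of_eq ?_)
  rw [Nat.card_Icc, Nat.add_sub_cancel]; ring

/-- The contribution to the sieve error term of the part of the sieve weights supported on
products `p j` with `p ∈ W`, `j ∈ 𝒥`. -/
noncomputable def windowError (R β : ℕ → ℝ) (W 𝒥 : Finset ℕ) (Z : ℕ) : ℝ :=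
  ∑ p ∈ W, ∑ j ∈ 𝒥, ((p * j).totient : ℝ)⁻¹ * ∑ d ∈ (p * j).divisors,
    (moebius d : ℝ) * d * ∑ e ∈ Icc 1 Z, β e * R (Nat.lcm d e)

lemma abs_windowError_le {R β : ℕ → ℝ} {W 𝒥 : Finset ℕ} {P J Z F : ℕ} {b D H K : ℝ}
    (hR : ∀ d, |R d| ≤ 2) (hb : 0 < b) (hβ : ∀ e ∈ Icc 1 Z, |β e| ≤ b)
    (hW : ∀ p ∈ W, p.Prime ∧ p ≤ P) (hJ : 𝒥 ⊆ Icc 1 J) (hWJ : ∀ j ∈ 𝒥, ∀ p ∈ W, ¬ p ∣ j)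
    (hD0 : 0 < D) (hDJ : ∀ n ∈ Icc 1 J, (#n.divisors : ℝ) ≤ D)
    (hDZ : ∀ n ∈ Icc 1 (P * Z), (#n.divisors : ℝ) ≤ D) (hH : 0 < H)
    (hHJ : ∑ n ∈ Icc 1 J, (n : ℝ)⁻¹ ≤ H) (hHP : ∑ n ∈ Icc 1 P, (n : ℝ)⁻¹ ≤ H) (hF : 1 ≤ F)
    (hK : ∀ t, 1 ≤ t → t ≤ F ^ 2 → ∀ a c : ℕ → ℝ, (∀ u, |a u| ≤ 1) → (∀ v, |c v| ≤ 1) →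
      |∑ u ∈ Icc 1 (P * Z), ∑ v ∈ Icc 1 J, a u * c v * R (t * (u * v))| ≤ K) :
    |windowError R β W 𝒥 Z| ≤ 2 * H * (J * (D ^ 2 * (Z * (b * 2)))) +
      (F * (D * (2 * b * D * (D * H) * K)) + D * (4 * (D * H) * b * (J * P * Z)) * (H / F) +
        4 * (D * H) * b * (J * Z) * H) := by
  unfold windowError
  rw [window_sum_eq (fun p hp => (hW p hp).1) hJ hWJ
    (fun d => ∑ e ∈ Icc 1 Z, β e * R (Nat.lcm d e))]
  have hκ : ∀ s, 0 < s → |windowCoeff 𝒥 s| ≤ D * H := fun s hs =>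
    abs_windowCoeff_le hJ hDJ hD0.le hHJ hs
  have hα : ∀ p ∈ W, |(p / p.totient : ℝ)| ≤ 2 := fun p hp => by
    rw [abs_of_nonneg (by positivity)]; exact prime_div_totient_le_two (hW p hp).1
  refine (abs_sub _ _).trans (add_le_add ?_ ?_)
  · refine window_first_part_le hW hJ hDJ hD0.le (by positivity) hHP fun s _ => ?_
    refine (abs_sum_le_card_mul (C := b * 2) fun e he => ?_).trans (by simp)
    rw [abs_mul]
    gcongr
    · exact hβ e he
    · exact hR _
  · have hsplit : ∑ s ∈ Icc 1 J, windowCoeff 𝒥 s * ∑ p ∈ W, (p / p.totient : ℝ) *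
        ∑ e ∈ Icc 1 Z, β e * R (Nat.lcm (p * s) e) =
        ∑ s ∈ Icc 1 J, ∑ p ∈ W, ∑ e ∈ Icc 1 Z, windowCoeff 𝒥 s *
          ((p / p.totient : ℝ) * if p ∣ e then 0 else β e) * R (Nat.lcm (p * s) e) +
        ∑ s ∈ Icc 1 J, ∑ p ∈ W, ∑ e ∈ Icc 1 Z, windowCoeff 𝒥 s *
          ((p / p.totient : ℝ) * if p ∣ e then β e else 0) * R (Nat.lcm (p * s) e) := by
      simp_rw [← sum_add_distrib, mul_sum]
      refine sum_congr (M := ℝ) rfl fun s _ => sum_congr (M := ℝ) rfl fun p _ =>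
        sum_congr (M := ℝ) rfl fun e _ => ?_
      split_ifs <;> ring
    rw [hsplit]
    exact (abs_add_le _ _).trans (add_le_add
      (abs_coprime_part_le (α := fun p => (p / p.totient : ℝ)) hR hκ (by positivity) hα hb hβ hW
        hD0 hDJ hDZ hHJ hF hK)
      (abs_dvd_part_le (α := fun p => (p / p.totient : ℝ)) hR hκ (by positivity) hα hb hβ hW hHP))

end

section

open Filter

/-- The error in counting the `n ≤ x` with `n ≡ a (mod q)` and `d ∣ n`. -/
noncomputable def apError (q : ℕ) (a : ZMod q) (x : ℝ) (d : ℕ) : ℝ :=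
  apCount q (a * (d : ZMod q)⁻¹) (x / d) - x / d / q

lemma abs_apError_le {q : ℕ} [NeZero q] (a : ZMod q) {x : ℝ} (hx : 0 ≤ x) (d : ℕ) :
    |apError q a x d| ≤ 2 := abs_apCount_sub_le _ (by positivity)

lemma eventually_card_divisors_le {e : ℝ} (he : 0 < e) :
    ∀ᶠ N : ℝ in atTop, ∀ n : ℕ, n ≠ 0 → (n : ℝ) ≤ N → (#n.divisors : ℝ) ≤ N ^ e := by
  obtain ⟨C, hC, h⟩ := card_divisors_le_rpow (half_pos he)
  filter_upwards [eventually_const_le_rpow C (half_pos he), eventually_gt_atTop 0] with N hN hN0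
  intro n hn hnN
  calc _ ≤ C * (n : ℝ) ^ (e / 2) := h n hn
    _ ≤ N ^ (e / 2) * N ^ (e / 2) := by gcongr
    _ = _ := by rw [← Real.rpow_add hN0]; ring_nf

lemma eventually_sum_inv_le {e : ℝ} (he : 0 < e) :
    ∀ᶠ N : ℝ in atTop, ∀ U : ℕ, (U : ℝ) ≤ N → ∑ n ∈ Icc 1 U, (n : ℝ)⁻¹ ≤ N ^ e := by
  filter_upwards [eventually_one_add_mul_log_le_rpow 1 he, eventually_ge_atTop 1] with N hN hN1
  intro U hU
  refine (sum_inv_le_one_add_log (Subset.refl _)).trans (le_trans ?_ hN)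
  rw [one_mul]
  gcongr 1 + ?_
  rcases Nat.eq_zero_or_pos U with rfl | h
  · simpa using Real.log_nonneg hN1
  · exact Real.log_le_log (by exact_mod_cast h) hU

lemma apError_mul {q : ℕ} [Fact q.Prime] (a : ZMod q) (x : ℝ) (t u v : ℕ) :
    apError q a x (t * (u * v)) =
      apCount q (a * (t : ZMod q)⁻¹ * (u : ZMod q)⁻¹ * (v : ZMod q)⁻¹) (x / t / (u * v)) -
        x / t / (u * v) / q := by
  unfold apError
  push_cast
  rw [mul_inv, mul_inv, ← mul_assoc a, ← mul_assoc (a * _), ← div_div x (t : ℝ)]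

lemma eventually_abs_windowError_le {s A δ μ : ℝ} {k l : ℕ} (hk : 1 ≤ k) (hl : 1 ≤ l)
    (hδ : 0 < δ) (hδ1 : 5 * δ ≤ 1) (hA : 3 * δ ≤ A) (hA1 : A ≤ 1 / 2)
    (h1 : (2 * k - 1) * (A + (1 / 2 + δ)) < s) (h2 : (2 * l - 1) * (1 / 2 - A + δ) < s)
    (hμ : s + μ ≤ k * (A + (1 / 2 + δ)) + l * (1 / 2 - A + δ)) (h3 : 16 * δ < μ / (2 * k * l))
    (h4 : 6 * δ < s) :
    ∀ᶠ N : ℝ in atTop, ∀ q : ℕ, ∀ _ : Fact q.Prime, (q : ℝ) = N ^ s → ∀ a : ZMod q, a ≠ 0 →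
      ∀ (W 𝒥 : Finset ℕ) (β : ℕ → ℝ), (∀ p ∈ W, p.Prime ∧ p ≤ ⌊N ^ A⌋₊) →
      𝒥 ⊆ Icc 1 ⌊N ^ (1 / 2 - A + δ)⌋₊ → (∀ j ∈ 𝒥, ∀ p ∈ W, ¬ p ∣ j) →
      (∀ e ∈ Icc 1 ⌊N ^ (1 / 2 + δ)⌋₊, |β e| ≤ N ^ (δ / 8)) →
      |windowError (apError q a (q * N)) β W 𝒥 ⌊N ^ (1 / 2 + δ)⌋₊| ≤ N ^ (1 - δ / 8) := by
  have hu : 0 < A + (1 / 2 + δ) := by linarith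
  have hv : 0 < 1 / 2 - A + δ := by linarith
  have hε : 0 < δ / 8 := by positivity
  have hεq : 0 < δ / 8 / 4 := by positivity
  filter_upwards [eventually_norm_bilinear_remainder_le (ρ := 4 * δ) (ξ := 5 * δ) hk hl hu hv h1 h2
    hμ (by linarith) hδ1 (by linarith) (by linarith) (by linarith),
    (tendsto_rpow_atTop (two_pos : (0 : ℝ) < 2)).eventually (eventually_card_divisors_le
      (half_pos hε)),
    eventually_sum_inv_le hε, eventually_ge_atTop 1, eventually_const_le_rpow 18 hε,
    eventually_gt_atTop 1]
    with N hB hdiv hsum hN1 hN18 hN1'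
  intro q hq hqN a ha W 𝒥 β hW hJ hWJ hβ
  have hN0 : 0 < N := by linarith
  have floor_le : ∀ w : ℝ, (⌊N ^ w⌋₊ : ℝ) ≤ N ^ w := fun w => Nat.floor_le (by positivity)
  set P := ⌊N ^ A⌋₊ with hP
  set Z := ⌊N ^ (1 / 2 + δ)⌋₊ with hZ
  set J := ⌊N ^ (1 / 2 - A + δ)⌋₊ with hJd
  set F := ⌊N ^ (3 * δ)⌋₊ with hFd
  have hF1 : 1 ≤ F := by
    rw [hFd, Nat.one_le_floor_iff]; exact Real.one_le_rpow hN1 (by linarith)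
  have hpow1 : ∀ w : ℝ, w ≤ 1 → N ^ w ≤ N := fun w hw => by
    simpa using Real.rpow_le_rpow_of_exponent_le hN1 hw
  have hpow2 : ∀ w : ℝ, w ≤ 2 → N ^ w ≤ N ^ (2 : ℝ) := fun w hw =>
    Real.rpow_le_rpow_of_exponent_le hN1 hw
  have hPZ : (P * Z : ℝ) ≤ N ^ (A + (1 / 2 + δ)) := by
    rw [Real.rpow_add hN0]; gcongr <;> exact floor_le _
  have hPZ' : P * Z ≤ ⌊N ^ (A + (1 / 2 + δ))⌋₊ := Nat.le_floor (by push_cast; exact hPZ)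
  have hdiv' : ∀ w : ℝ, w ≤ 2 → ∀ n ∈ Icc 1 ⌊N ^ w⌋₊, (#n.divisors : ℝ) ≤ N ^ (δ / 8) := by
    intro w hw n hn
    rw [mem_Icc] at hn
    have hn' : (n : ℝ) ≤ N ^ w := (Nat.cast_le.mpr hn.2).trans (floor_le w)
    have := hdiv n (by omega) (hn'.trans (hpow2 w hw))
    rwa [← Real.rpow_mul hN0.le, mul_div_cancel₀ _ two_ne_zero] at this
  have hq0 : (0 : ℝ) < q := by exact_mod_cast hq.out.pos
  have key := abs_windowError_le (R := apError q a (q * N)) (β := β) (W := W) (𝒥 := 𝒥) (P := P)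
    (J := J) (Z := Z) (F := F) (b := N ^ (δ / 8)) (D := N ^ (δ / 8)) (H := N ^ (δ / 8))
    (K := N ^ (1 - 4 * δ))
    (fun d => abs_apError_le a (by positivity) d) (by positivity) hβ hW hJ hWJ (by positivity)
    (hdiv' _ (by linarith))
    (fun n hn => hdiv' _ (by linarith) n (Icc_subset_Icc_right hPZ' hn)) (by positivity)
    (hsum _ ((floor_le _).trans (hpow1 _ (by linarith))))
    (hsum _ ((floor_le _).trans (hpow1 _ (by linarith)))) hF1 ?_
  · have e1 : ∀ w w' : ℝ, N ^ w * N ^ w' = N ^ (w + w') := fun w w' => (Real.rpow_add hN0 _ _).symm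
    have hJZ : (J * Z : ℝ) ≤ N ^ (1 - δ) := by
      calc _ ≤ N ^ (1 / 2 - A + δ) * N ^ (1 / 2 + δ) := by gcongr <;> exact floor_le _
        _ = N ^ (1 - A + 2 * δ) := by rw [e1]; ring_nf
        _ ≤ _ := Real.rpow_le_rpow_of_exponent_le hN1 (by linarith)
    have hJPZ : (J * P * Z : ℝ) ≤ N ^ (1 + 2 * δ) := by
      calc _ ≤ N ^ (1 / 2 - A + δ) * N ^ A * N ^ (1 / 2 + δ) := by gcongr <;> exact floor_le _
        _ = N ^ (1 + 2 * δ) := by rw [e1, e1]; ring_nf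
    have hFl : N ^ (3 * δ) / 2 ≤ F := by
      have h1 := Nat.lt_floor_add_one (N ^ (3 * δ))
      have h2 : (1 : ℝ) ≤ F := by exact_mod_cast hF1
      linarith
    set E := N ^ (δ / 8) with hE
    have hE1 : 1 ≤ E := Real.one_le_rpow hN1 hε.le
    have hM : N ^ (1 - δ / 8) = N ^ (1 - δ) * E ^ 7 := by
      rw [hE, ← Real.rpow_natCast, ← Real.rpow_mul hN0.le, e1]; congr 1; push_cast; ring
    have t1 : 2 * E * (J * (E ^ 2 * (Z * (E * 2)))) ≤ 4 * (N ^ (1 - δ) * E ^ 6) := by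
      calc _ = 4 * ((J * Z) * E ^ 4) := by ring
        _ ≤ _ := by gcongr; norm_num
    have t2 : F * (E * (2 * E * E * (E * E) * N ^ (1 - 4 * δ))) ≤ 2 * (N ^ (1 - δ) * E ^ 6) := by
      calc _ ≤ N ^ (3 * δ) * (E * (2 * E * E * (E * E) * N ^ (1 - 4 * δ))) := by
            gcongr; exact floor_le _
        _ = 2 * ((N ^ (3 * δ) * N ^ (1 - 4 * δ)) * E ^ 5) := by ring
        _ = 2 * (N ^ (1 - δ) * E ^ 5) := by rw [e1]; ring_nf
        _ ≤ _ := by gcongr; norm_num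
    have t3 : E * (4 * (E * E) * E * (J * P * Z)) * (E / F) ≤ 8 * (N ^ (1 - δ) * E ^ 6) := by
      calc _ ≤ E * (4 * (E * E) * E * N ^ (1 + 2 * δ)) * (E / (N ^ (3 * δ) / 2)) := by gcongr
        _ = 8 * ((N ^ (1 + 2 * δ) * (N ^ (3 * δ))⁻¹) * E ^ 5) := by
            rw [div_div_eq_mul_div]; ring
        _ = 8 * (N ^ (1 - δ) * E ^ 5) := by rw [← Real.rpow_neg hN0.le, e1]; ring_nf
        _ ≤ _ := by gcongr; norm_num
    have t4 : 4 * (E * E) * E * (J * Z) * E ≤ 4 * (N ^ (1 - δ) * E ^ 6) := by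
      calc _ = 4 * ((J * Z) * E ^ 4) := by ring
        _ ≤ _ := by gcongr; norm_num
    rw [hM]
    have : 18 * (N ^ (1 - δ) * E ^ 6) ≤ N ^ (1 - δ) * E ^ 7 := by
      have : 0 ≤ N ^ (1 - δ) * E ^ 6 := by positivity
      nlinarith
    linarith
  · intro t ht1 htF α γ hα hγ
    have htq : t < q := by
      have : (t : ℝ) < q := by
        calc (t : ℝ) ≤ (F : ℝ) ^ 2 := by exact_mod_cast htF
          _ ≤ (N ^ (3 * δ)) ^ 2 := by gcongr; exact floor_le _
          _ = N ^ (6 * δ) := by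
              rw [← Real.rpow_natCast, ← Real.rpow_mul hN0.le]; congr 1; push_cast; ring
          _ < N ^ s := Real.rpow_lt_rpow_of_exponent_lt hN1' h4
          _ = q := hqN.symm
      exact_mod_cast this
    have ht0 : (t : ZMod q) ≠ 0 := by
      rw [Ne, ZMod.natCast_eq_zero_iff]
      exact fun h => absurd (Nat.le_of_dvd ht1 h) (by omega)
    have ht1' : (1 : ℝ) ≤ t := by exact_mod_cast ht1
    have h := hB q hq hqN (a * (t : ZMod q)⁻¹) (mul_ne_zero ha (inv_ne_zero ht0))
      (q * N / t) (by positivity) (div_le_self (by positivity) ht1') (Icc 1 (P * Z)) (Icc 1 J)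
      (Icc_subset_Icc_right hPZ') (Subset.refl _) (fun u => α u) (fun v => γ v)
      (fun u _ => by simpa using hα u) (fun v _ => by simpa using hγ v)
    have e : ((∑ u ∈ Icc 1 (P * Z), ∑ v ∈ Icc 1 J,
        α u * γ v * apError q a (q * N) (t * (u * v)) : ℝ) : ℂ) =
        ∑ u ∈ Icc 1 (P * Z), ∑ v ∈ Icc 1 J, (α u : ℂ) * γ v *
        ((apCount q (a * (t : ZMod q)⁻¹ * (u : ZMod q)⁻¹ * (v : ZMod q)⁻¹)
          (q * N / t / (u * v)) : ℝ) - (q * N / t / (u * v) / q : ℝ) : ℂ) := by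
      rw [Complex.ofReal_sum]
      refine sum_congr rfl fun u _ => ?_
      rw [Complex.ofReal_sum]
      refine sum_congr rfl fun v _ => ?_
      rw [apError_mul]
      push_cast
      ring
    rw [← e, Complex.norm_real] at h
    exact h

end

section

open ArithmeticFunction

/-- The sieve weights `λ_d = μ(d) d ∑_{l ≤ Z, d ∣ l} y_l / φ(l)`. -/
noncomputable def selbergWeight (y : ℕ → ℝ) (Z d : ℕ) : ℝ :=
  moebius d * d * ∑ l ∈ Icc 1 Z with d ∣ l, y l / l.totient

/-- The bilinear form `∑_{d, e ≤ Z} β_d γ_e R([d, e])`. -/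
noncomputable def lcmForm (R β γ : ℕ → ℝ) (Z : ℕ) : ℝ :=
  ∑ d ∈ Icc 1 Z, ∑ e ∈ Icc 1 Z, β d * γ e * R (Nat.lcm d e)

lemma lcmForm_comm (R β γ : ℕ → ℝ) (Z : ℕ) : lcmForm R β γ Z = lcmForm R γ β Z := by
  unfold lcmForm
  rw [sum_comm]
  refine sum_congr rfl fun d _ => sum_congr rfl fun e _ => ?_
  rw [Nat.lcm_comm]; ring

lemma divisors_eq_filter_Icc {l Z : ℕ} (h1 : 1 ≤ l) (h : l ≤ Z) :
    l.divisors = {d ∈ Icc 1 Z | d ∣ l} := by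
  ext s
  simp only [Nat.mem_divisors, mem_filter, mem_Icc]
  constructor
  · rintro ⟨h', _⟩
    exact ⟨⟨Nat.pos_of_dvd_of_pos h' (by omega), (Nat.le_of_dvd (by omega) h').trans h⟩, h'⟩
  · rintro ⟨_, h'⟩; exact ⟨h', by omega⟩

lemma sum_selbergWeight_mul (y G : ℕ → ℝ) (Z : ℕ) :
    ∑ d ∈ Icc 1 Z, selbergWeight y Z d * G d =
      ∑ l ∈ Icc 1 Z, y l / l.totient * ∑ d ∈ l.divisors, (moebius d : ℝ) * d * G d := by
  have h1 : ∀ d ∈ Icc 1 Z, selbergWeight y Z d * G d =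
      ∑ l ∈ Icc 1 Z, if d ∣ l then y l / l.totient * ((moebius d : ℝ) * d * G d) else 0 := by
    intro d _
    unfold selbergWeight
    rw [← sum_filter, mul_sum, sum_mul]
    exact sum_congr rfl fun l _ => by ring
  rw [sum_congr rfl h1, sum_comm]
  refine sum_congr rfl fun l hl => ?_
  have hl' := mem_Icc.mp hl
  rw [divisors_eq_filter_Icc hl'.1 hl'.2, ← sum_filter, mul_sum]

lemma lcmForm_selbergWeight (R y β : ℕ → ℝ) (Z : ℕ) :
    lcmForm R (selbergWeight y Z) β Z = ∑ l ∈ Icc 1 Z, y l / l.totient *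
      ∑ d ∈ l.divisors, (moebius d : ℝ) * d * ∑ e ∈ Icc 1 Z, β e * R (Nat.lcm d e) := by
  rw [← sum_selbergWeight_mul]
  unfold lcmForm
  refine sum_congr rfl fun d _ => ?_
  rw [mul_sum]
  exact sum_congr rfl fun e _ => by ring

lemma abs_selbergWeight_le {y : ℕ → ℝ} {Z : ℕ} {D H : ℝ} (hy : ∀ l, |y l| ≤ 1)
    (hD : ∀ n ∈ Icc 1 Z, (#n.divisors : ℝ) ≤ D) (hD0 : 0 ≤ D)
    (hH : ∑ n ∈ Icc 1 Z, (n : ℝ)⁻¹ ≤ H) {d : ℕ} (hd : 0 < d) :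
    |selbergWeight y Z d| ≤ D * H := by
  refine le_trans ?_ (mul_sum_inv_totient_le hD hD0 hH hd)
  unfold selbergWeight
  rw [abs_mul, abs_mul, Nat.abs_cast]
  calc _ ≤ 1 * d * ∑ l ∈ Icc 1 Z with d ∣ l, |y l / l.totient| := by
        gcongr
        · exact abs_moebius_le_one_real d
        · exact abs_sum_le_sum_abs _ _
    _ ≤ _ := by
        rw [one_mul]
        gcongr with l hl
        rw [abs_div, Nat.abs_cast, div_eq_mul_inv]
        exact mul_le_of_le_one_left (by positivity) (hy l)

lemma sum_divisors_moebius_filter_dvd {l g : ℕ} (hl : Squarefree l) (hg : g ∣ l) :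
    ∑ d ∈ l.divisors with g ∣ d, (moebius d : ℝ) = if g = l then (moebius g : ℝ) else 0 := by
  have hl0 := hl.ne_zero
  obtain ⟨m, rfl⟩ := hg
  have hg0 : g ≠ 0 := by rintro rfl; simp at hl0
  have hm0 : m ≠ 0 := by rintro rfl; simp at hl0
  have hset : {d ∈ (g * m).divisors | g ∣ d} = m.divisors.image (g * ·) := by
    ext d
    simp only [mem_filter, Nat.mem_divisors, mem_image]
    constructor
    · rintro ⟨⟨h, _⟩, k, rfl⟩
      exact ⟨k, ⟨Nat.dvd_of_mul_dvd_mul_left (Nat.pos_of_ne_zero hg0) h, hm0⟩, rfl⟩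
    · rintro ⟨k, ⟨h, _⟩, rfl⟩
      exact ⟨⟨mul_dvd_mul_left g h, hl0⟩, dvd_mul_right _ _⟩
  rw [hset, sum_image fun a _ b _ h => Nat.eq_of_mul_eq_mul_left (Nat.pos_of_ne_zero hg0) h]
  have hc : g.Coprime m := Nat.coprime_of_squarefree_mul hl
  have h1 : ∀ k ∈ m.divisors, (moebius (g * k) : ℝ) = moebius g * (moebius k : ℝ) := by
    intro k hk
    rw [isMultiplicative_moebius.map_mul_of_coprime
      (hc.coprime_dvd_right (Nat.dvd_of_mem_divisors hk))]
    push_cast; rfl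
  rw [sum_congr rfl h1, ← mul_sum]
  have h2 : ∑ k ∈ m.divisors, (moebius k : ℝ) = if m = 1 then 1 else 0 := by
    have := congrArg (fun f : ArithmeticFunction ℤ => f m) moebius_mul_coe_zeta
    simp only [coe_mul_zeta_apply, one_apply] at this
    exact_mod_cast this
  rw [h2]
  by_cases hm : m = 1
  · simp [hm]
  · rw [if_neg hm, if_neg, mul_zero]
    intro h
    exact hm (Nat.eq_of_mul_eq_mul_left (Nat.pos_of_ne_zero hg0) (by rw [← h, mul_one]))

lemma sum_selbergWeight_div {y : ℕ → ℝ} {Z g : ℕ} (hy : ∀ l, ¬ Squarefree l → y l = 0)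
    (hg : g ∈ Icc 1 Z) :
    ∑ d ∈ Icc 1 Z with g ∣ d, selbergWeight y Z d / d = moebius g * (y g / g.totient) := by
  have h1 : ∑ d ∈ Icc 1 Z with g ∣ d, selbergWeight y Z d / d =
      ∑ d ∈ Icc 1 Z, selbergWeight y Z d * (if g ∣ d then (d : ℝ)⁻¹ else 0) := by
    rw [sum_filter]
    exact sum_congr rfl fun d _ => by split_ifs <;> simp [div_eq_mul_inv]
  rw [h1, sum_selbergWeight_mul, sum_eq_single_of_mem g hg]
  · have : ∑ d ∈ g.divisors, (moebius d : ℝ) * d * (if g ∣ d then (d : ℝ)⁻¹ else 0) =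
        moebius g := by
      have hg0 : g ≠ 0 := by have := mem_Icc.mp hg; omega
      have hg0' : (g : ℝ) ≠ 0 := by exact_mod_cast hg0
      rw [sum_eq_single_of_mem g (Nat.mem_divisors_self g hg0)]
      · simp; field_simp
      · intro d hd hne
        rw [if_neg, mul_zero]
        exact fun h => hne (Nat.dvd_antisymm (Nat.dvd_of_mem_divisors hd) h)
    rw [this, mul_comm]
  · intro l hl hne
    by_cases hsq : Squarefree l
    · have : ∑ d ∈ l.divisors, (moebius d : ℝ) * d * (if g ∣ d then (d : ℝ)⁻¹ else 0) =
          ∑ d ∈ l.divisors with g ∣ d, (moebius d : ℝ) := by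
        rw [sum_filter]
        refine sum_congr rfl fun d hd => ?_
        have : (d : ℝ) ≠ 0 := by exact_mod_cast (Nat.pos_of_mem_divisors hd).ne'
        split_ifs
        · field_simp
        · simp
      rw [this]
      by_cases hgl : g ∣ l
      · rw [sum_divisors_moebius_filter_dvd hsq hgl, if_neg hne.symm, mul_zero]
      · rw [sum_eq_zero, mul_zero]
        intro d hd
        rw [mem_filter, Nat.mem_divisors] at hd
        exact absurd (hd.2.trans hd.1.1) hgl
    · rw [hy l hsq]; simp

lemma inv_lcm_eq {d Z : ℕ} (hd : d ∈ Icc 1 Z) (e : ℕ) :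
    ((Nat.lcm d e : ℕ) : ℝ)⁻¹ = ∑ g ∈ Icc 1 Z,
      g.totient * ((if g ∣ d then (d : ℝ)⁻¹ else 0) * (if g ∣ e then (e : ℝ)⁻¹ else 0)) := by
  rw [mem_Icc] at hd
  have hg0 : 0 < Nat.gcd d e := Nat.gcd_pos_of_pos_left _ (by omega)
  have h1 : (d : ℝ) * e = Nat.gcd d e * Nat.lcm d e := by
    exact_mod_cast (Nat.gcd_mul_lcm d e).symm
  have h2 : ((Nat.lcm d e : ℕ) : ℝ)⁻¹ = Nat.gcd d e * ((d : ℝ)⁻¹ * (e : ℝ)⁻¹) := by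
    rw [← mul_inv, h1]
    have : (Nat.gcd d e : ℝ) ≠ 0 := by exact_mod_cast hg0.ne'
    rw [mul_inv, mul_inv_cancel_left₀ this]
  have h3 : (Nat.gcd d e : ℝ) = ∑ g ∈ (Nat.gcd d e).divisors, (g.totient : ℝ) := by
    exact_mod_cast (Nat.sum_totient _).symm
  rw [h2, h3, divisors_eq_filter_Icc hg0 ((Nat.gcd_le_left e (by omega)).trans hd.2), sum_filter,
    sum_mul]
  refine sum_congr rfl fun g _ => ?_
  simp only [Nat.dvd_gcd_iff]
  by_cases h : g ∣ d <;> by_cases h' : g ∣ e <;> simp [h, h']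

lemma lcmForm_selbergWeight_inv {y : ℕ → ℝ} {Z : ℕ} (hy : ∀ l, ¬ Squarefree l → y l = 0) :
    lcmForm (fun n => (n : ℝ)⁻¹) (selbergWeight y Z) (selbergWeight y Z) Z =
      ∑ g ∈ Icc 1 Z, y g ^ 2 / g.totient := by
  have h1 : lcmForm (fun n => (n : ℝ)⁻¹) (selbergWeight y Z) (selbergWeight y Z) Z =
      ∑ g ∈ Icc 1 Z, g.totient * (∑ d ∈ Icc 1 Z with g ∣ d, selbergWeight y Z d / d) ^ 2 := by
    unfold lcmForm
    calc _ = ∑ d ∈ Icc 1 Z, ∑ e ∈ Icc 1 Z, ∑ g ∈ Icc 1 Z, g.totient *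
          ((if g ∣ d then selbergWeight y Z d / d else 0) *
          (if g ∣ e then selbergWeight y Z e / e else 0)) := by
          refine sum_congr rfl fun d hd => sum_congr rfl fun e he => ?_
          beta_reduce
          rw [inv_lcm_eq hd e, mul_sum]
          refine sum_congr rfl fun g _ => ?_
          split_ifs <;> simp [div_eq_mul_inv]
          ring
      _ = _ := by
          rw [sum_congr rfl fun d _ => sum_comm, sum_comm]
          refine sum_congr rfl fun g _ => ?_
          rw [sq, sum_filter, sum_mul_sum, mul_sum]
          exact sum_congr rfl fun d _ => by rw [mul_sum]
  rw [h1]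
  refine sum_congr rfl fun g hg => ?_
  rw [sum_selbergWeight_div hy hg]
  by_cases hsq : Squarefree g
  · have : ((moebius g : ℝ)) ^ 2 = 1 := by
      have := moebius_sq_eq_one_of_squarefree hsq
      exact_mod_cast this
    have h0 : (g.totient : ℝ) ≠ 0 := by
      exact_mod_cast (Nat.totient_pos.mpr (mem_Icc.mp hg).1).ne'
    rw [mul_pow, this]
    field_simp
  · rw [hy g hsq]; simp

lemma card_filter_dvd_and_eq_apCount {q : ℕ} [Fact q.Prime] (a : ZMod q) {d : ℕ} (hd : 0 < d)
    (hdq : (d : ZMod q) ≠ 0) (x : ℝ) :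
    #{n ∈ Icc 1 ⌊x⌋₊ | ((n : ℕ) : ZMod q) = a ∧ d ∣ n} =
      apCount q (a * (d : ZMod q)⁻¹) (x / d) := by
  unfold apCount
  symm
  rw [Nat.floor_div_natCast]
  refine card_bij (fun m _ => d * m) ?_ ?_ ?_
  · intro m hm
    rw [mem_filter, mem_Icc] at hm ⊢
    refine ⟨⟨Nat.mul_pos hd hm.1.1, ?_⟩, ?_, dvd_mul_right _ _⟩
    · exact (Nat.mul_le_mul_left _ hm.1.2).trans (Nat.mul_div_le _ _)
    · push_cast
      rw [hm.2]; field_simp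
  · intro m _ m' _ h; exact Nat.eq_of_mul_eq_mul_left hd h
  · intro n hn
    rw [mem_filter, mem_Icc] at hn
    obtain ⟨⟨h1, h2⟩, h3, m, rfl⟩ := hn
    refine ⟨m, ?_, rfl⟩
    rw [mem_filter, mem_Icc]
    refine ⟨⟨Nat.pos_of_ne_zero (by rintro rfl; simp at h1),
      (Nat.le_div_iff_mul_le hd).mpr (by linarith [mul_comm m d])⟩, ?_⟩
    rw [← h3]; push_cast; field_simp

lemma selbergWeight_one (y : ℕ → ℝ) (Z : ℕ) :
    selbergWeight y Z 1 = ∑ l ∈ Icc 1 Z, y l / l.totient := by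
  simp [selbergWeight]

lemma sum_sq_eq_lcmForm {q : ℕ} [Fact q.Prime] (a : ZMod q) {x : ℝ} (w : ℕ → ℝ) {Z : ℕ}
    (hZ : Z < q) :
    ∑ n ∈ Icc 1 ⌊x⌋₊ with ((n : ℕ) : ZMod q) = a, (∑ d ∈ Icc 1 Z with d ∣ n, w d) ^ 2 =
      x / q * lcmForm (fun n => (n : ℝ)⁻¹) w w Z + lcmForm (apError q a x) w w Z := by
  have h1 : ∀ n ∈ {n ∈ Icc 1 ⌊x⌋₊ | ((n : ℕ) : ZMod q) = a},
      (∑ d ∈ Icc 1 Z with d ∣ n, w d) ^ 2 =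
      ∑ d ∈ Icc 1 Z, ∑ e ∈ Icc 1 Z, w d * w e * (if Nat.lcm d e ∣ n then 1 else 0) := by
    intro n _
    rw [sq, sum_filter, sum_mul_sum]
    refine sum_congr rfl fun d _ => sum_congr rfl fun e _ => ?_
    simp only [Nat.lcm_dvd_iff]
    by_cases h : d ∣ n <;> by_cases h' : e ∣ n <;> simp [h, h']
  rw [sum_congr rfl h1, sum_comm]
  unfold lcmForm
  rw [mul_sum, ← sum_add_distrib]
  refine sum_congr rfl fun d hd => ?_
  rw [sum_comm, mul_sum, ← sum_add_distrib]
  refine sum_congr rfl fun e he => ?_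
  rw [mem_Icc] at hd he
  have hlt : ∀ d : ℕ, 1 ≤ d → d ≤ Z → ¬ q ∣ d := fun d h1 h2 h =>
    absurd (Nat.le_of_dvd h1 h) (by omega)
  have hne : ((Nat.lcm d e : ℕ) : ZMod q) ≠ 0 := by
    rw [Ne, ZMod.natCast_eq_zero_iff]
    intro h
    rcases (Fact.out : q.Prime).dvd_mul.mp (h.trans (Nat.lcm_dvd_mul d e)) with h | h
    · exact hlt d hd.1 hd.2 h
    · exact hlt e he.1 he.2 h
  rw [← mul_sum, ← sum_filter, filter_filter, sum_const, nsmul_eq_mul, mul_one,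
    card_filter_dvd_and_eq_apCount a (Nat.lcm_pos hd.1 he.1) hne x]
  unfold apError
  ring

/-- Selberg's upper bound for the number of primes in an arithmetic progression. -/
lemma card_primes_sub_mul_sq_le {q : ℕ} [Fact q.Prime] (a : ZMod q) {x : ℝ} (hx : 0 ≤ x)
    {y : ℕ → ℝ} {Z : ℕ} (hZ : Z < q) (hy : ∀ l, ¬ Squarefree l → y l = 0) (hy0 : ∀ l, 0 ≤ y l)
    (hy1 : ∀ l, y l ≤ 1) :
    ((#{n ∈ Icc 1 ⌊x⌋₊ | n.Prime ∧ ((n : ℕ) : ZMod q) = a} : ℝ) - Z) *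
        (∑ l ∈ Icc 1 Z, y l / l.totient) ^ 2 ≤
      x / q * (∑ l ∈ Icc 1 Z, y l / l.totient) +
        lcmForm (apError q a x) (selbergWeight y Z) (selbergWeight y Z) Z := by
  set Y := ∑ l ∈ Icc 1 Z, y l / l.totient with hY
  have h1 : lcmForm (fun n => (n : ℝ)⁻¹) (selbergWeight y Z) (selbergWeight y Z) Z ≤ Y := by
    rw [lcmForm_selbergWeight_inv hy]
    refine sum_le_sum fun l _ => ?_
    gcongr
    nlinarith [hy0 l, hy1 l]
  have h2 := sum_sq_eq_lcmForm a (x := x) (selbergWeight y Z) hZ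
  set S := {n ∈ Icc 1 ⌊x⌋₊ | n.Prime ∧ ((n : ℕ) : ZMod q) = a} with hS
  have h3 : (#S : ℝ) - Z ≤ #{n ∈ S | Z < n} := by
    have e1 : #S ≤ #{n ∈ S | Z < n} + Z := by
      rw [← card_filter_add_card_filter_not (s := S) (fun n => Z < n)]
      gcongr
      have : {n ∈ S | ¬ Z < n} ⊆ Icc 1 Z := by
        intro n hn
        rw [mem_filter, hS, mem_filter, mem_Icc] at hn
        exact mem_Icc.mpr ⟨hn.1.1.1, by omega⟩
      simpa using card_le_card this
    have : (#S : ℝ) ≤ #{n ∈ S | Z < n} + Z := by exact_mod_cast e1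
    linarith
  have h4 : ∀ n ∈ {n ∈ S | Z < n}, (∑ d ∈ Icc 1 Z with d ∣ n, selbergWeight y Z d) ^ 2 = Y ^ 2 := by
    intro n hn
    rw [mem_filter, hS, mem_filter] at hn
    congr 1
    rcases Nat.eq_zero_or_pos Z with h0 | h0
    · simp [hY, h0]
    · rw [hY, ← selbergWeight_one]
      refine sum_eq_single_of_mem 1 (by simp; omega) fun d hd hd1 => ?_
      rw [mem_filter, mem_Icc] at hd
      rcases (Nat.dvd_prime hn.1.2.1).mp hd.2 with h | h
      · exact absurd h hd1
      · omega
  calc _ ≤ (#{n ∈ S | Z < n} : ℝ) * Y ^ 2 := by gcongr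
    _ = ∑ n ∈ S with Z < n, (∑ d ∈ Icc 1 Z with d ∣ n, selbergWeight y Z d) ^ 2 := by
        rw [sum_congr rfl h4, sum_const, nsmul_eq_mul]
    _ ≤ ∑ n ∈ Icc 1 ⌊x⌋₊ with ((n : ℕ) : ZMod q) = a,
          (∑ d ∈ Icc 1 Z with d ∣ n, selbergWeight y Z d) ^ 2 := by
        refine sum_le_sum_of_subset_of_nonneg ?_ fun _ _ _ => by positivity
        intro n hn
        rw [mem_filter, hS, mem_filter] at hn
        exact mem_filter.mpr ⟨hn.1.1, hn.1.2.2⟩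
    _ ≤ _ := by rw [h2]; gcongr

end

section

open ArithmeticFunction

/-- The number of representations of `l` as a product `p j` with `p ∈ W`, `j ∈ 𝒥`. -/
noncomputable def windowWeight (W 𝒥 : Finset ℕ) (l : ℕ) : ℝ :=
  #{z ∈ W ×ˢ 𝒥 | z.1 * z.2 = l}

/-- The indicator function of the squarefree `l ≤ z`. -/
noncomputable def baseWeight (z l : ℕ) : ℝ :=
  open Classical in if Squarefree l ∧ l ≤ z then 1 else 0

/-- The indicator of squarefree `l ≤ z`, perturbed by `1/10` times the window weights. -/
noncomputable def fullWeight {ι : Type*} (𝒜 : Finset ι) (W 𝒥 : ι → Finset ℕ) (z l : ℕ) : ℝ :=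
  baseWeight z l + 1 / 10 * ∑ i ∈ 𝒜, windowWeight (W i) (𝒥 i) l

lemma windowWeight_nonneg (W 𝒥 : Finset ℕ) (l : ℕ) : 0 ≤ windowWeight W 𝒥 l := Nat.cast_nonneg _

lemma baseWeight_nonneg (z l : ℕ) : 0 ≤ baseWeight z l := by
  unfold baseWeight; split_ifs <;> norm_num

lemma baseWeight_le_one (z l : ℕ) : baseWeight z l ≤ 1 := by
  unfold baseWeight; split_ifs <;> norm_num

lemma windowWeight_eq_zero {W 𝒥 : Finset ℕ} {l : ℕ} (h : ∀ p ∈ W, ∀ j ∈ 𝒥, p * j ≠ l) :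
    windowWeight W 𝒥 l = 0 := by
  unfold windowWeight
  rw [Nat.cast_eq_zero, card_eq_zero, filter_eq_empty_iff]
  intro z hz
  rw [mem_product] at hz
  exact h _ hz.1 _ hz.2

lemma sum_windowWeight {W 𝒥 : Finset ℕ} {Z : ℕ} (h : ∀ p ∈ W, ∀ j ∈ 𝒥, p * j ∈ Icc 1 Z)
    (g : ℕ → ℝ) : ∑ l ∈ Icc 1 Z, windowWeight W 𝒥 l / l.totient * g l =
      ∑ p ∈ W, ∑ j ∈ 𝒥, ((p * j).totient : ℝ)⁻¹ * g (p * j) := by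
  rw [← sum_product' (f := fun p j => ((p * j).totient : ℝ)⁻¹ * g (p * j))]
  have hmaps : ∀ z ∈ W ×ˢ 𝒥, z.1 * z.2 ∈ Icc 1 Z := fun z hz =>
    h _ (mem_product.mp hz).1 _ (mem_product.mp hz).2
  refine Eq.trans ?_ (sum_fiberwise_of_maps_to (M := ℝ) hmaps _)
  refine sum_congr rfl fun l _ => ?_
  have : ∀ z ∈ {z ∈ W ×ˢ 𝒥 | z.1 * z.2 = l}, ((z.1 * z.2).totient : ℝ)⁻¹ * g (z.1 * z.2) =
      (l.totient : ℝ)⁻¹ * g l := fun z hz => by rw [(mem_filter.mp hz).2]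
  rw [sum_congr rfl this, sum_const, nsmul_eq_mul]
  unfold windowWeight
  ring

lemma sum_fullWeight {ι : Type*} {𝒜 : Finset ι} {W 𝒥 : ι → Finset ℕ} {z Z : ℕ}
    (h : ∀ i ∈ 𝒜, ∀ p ∈ W i, ∀ j ∈ 𝒥 i, p * j ∈ Icc 1 Z) (g : ℕ → ℝ) :
    ∑ l ∈ Icc 1 Z, fullWeight 𝒜 W 𝒥 z l / l.totient * g l =
      ∑ l ∈ Icc 1 Z, baseWeight z l / l.totient * g l + 1 / 10 * ∑ i ∈ 𝒜,
        ∑ p ∈ W i, ∑ j ∈ 𝒥 i, ((p * j).totient : ℝ)⁻¹ * g (p * j) := by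
  rw [← sum_congr rfl fun i hi => sum_windowWeight (h i hi) g, sum_comm, mul_sum,
    ← sum_add_distrib]
  refine sum_congr rfl fun l _ => ?_
  unfold fullWeight
  rw [← sum_mul, ← sum_div]
  ring

lemma lcmForm_fullWeight {ι : Type*} {𝒜 : Finset ι} {W 𝒥 : ι → Finset ℕ} {z Z : ℕ}
    (h : ∀ i ∈ 𝒜, ∀ p ∈ W i, ∀ j ∈ 𝒥 i, p * j ∈ Icc 1 Z) (R β : ℕ → ℝ) :
    lcmForm R (selbergWeight (fullWeight 𝒜 W 𝒥 z) Z) β Z =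
      lcmForm R (selbergWeight (baseWeight z) Z) β Z +
        1 / 10 * ∑ i ∈ 𝒜, windowError R β (W i) (𝒥 i) Z := by
  rw [lcmForm_selbergWeight, lcmForm_selbergWeight, sum_fullWeight h]
  rfl

lemma selbergWeight_baseWeight_eq_zero {z Z d : ℕ} (hd : z < d) :
    selbergWeight (baseWeight z) Z d = 0 := by
  unfold selbergWeight
  rw [sum_eq_zero, mul_zero]
  intro l hl
  rw [mem_filter, mem_Icc] at hl
  have := Nat.le_of_dvd (by omega) hl.2
  unfold baseWeight
  rw [if_neg (by omega), zero_div]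

lemma abs_lcmForm_baseWeight_le {R : ℕ → ℝ} {z Z : ℕ} {b : ℝ} (hR : ∀ d, |R d| ≤ 2)
    (hb : ∀ d ∈ Icc 1 Z, |selbergWeight (baseWeight z) Z d| ≤ b) (hb0 : 0 ≤ b) :
    |lcmForm R (selbergWeight (baseWeight z) Z) (selbergWeight (baseWeight z) Z) Z| ≤
      2 * (z : ℝ) ^ 2 * b ^ 2 := by
  have hcard : (#{d ∈ Icc 1 Z | d ≤ z} : ℝ) ≤ z := by
    have : {d ∈ Icc 1 Z | d ≤ z} ⊆ Icc 1 z := fun d hd => by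
      rw [mem_filter, mem_Icc] at hd
      exact mem_Icc.mpr ⟨hd.1.1, hd.2⟩
    exact_mod_cast (by simpa using card_le_card this)
  have h1 : lcmForm R (selbergWeight (baseWeight z) Z) (selbergWeight (baseWeight z) Z) Z =
      ∑ d ∈ Icc 1 Z with d ≤ z, ∑ e ∈ Icc 1 Z with e ≤ z,
        selbergWeight (baseWeight z) Z d * selbergWeight (baseWeight z) Z e *
          R (Nat.lcm d e) := by
    unfold lcmForm
    rw [sum_filter]
    refine sum_congr rfl fun d _ => ?_
    split_ifs with hd
    · rw [sum_filter]
      refine sum_congr rfl fun e _ => ?_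
      split_ifs with he
      · rfl
      · rw [selbergWeight_baseWeight_eq_zero (not_le.mp he)]; ring
    · rw [selbergWeight_baseWeight_eq_zero (not_le.mp hd)]; simp
  rw [h1]
  refine (abs_sum_le_card_mul fun d hd => abs_sum_le_card_mul (C := b * b * 2)
    fun e he => ?_).trans ?_
  · rw [abs_mul, abs_mul]
    gcongr
    · exact hb d (mem_filter.mp hd).1
    · exact hb e (mem_filter.mp he).1
    · exact hR _
  · calc _ ≤ (z : ℝ) * (z * (b * b * 2)) := by gcongr
      _ = _ := by ring

lemma abs_lcmForm_fullWeight_le {ι : Type*} {𝒜 : Finset ι} {W 𝒥 : ι → Finset ℕ} {z Z : ℕ}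
    (h : ∀ i ∈ 𝒜, ∀ p ∈ W i, ∀ j ∈ 𝒥 i, p * j ∈ Icc 1 Z) {R : ℕ → ℝ} {b B : ℝ}
    (hR : ∀ d, |R d| ≤ 2) (hb : ∀ d ∈ Icc 1 Z, |selbergWeight (baseWeight z) Z d| ≤ b)
    (hb0 : 0 ≤ b)
    (hB : ∀ i ∈ 𝒜, |windowError R (selbergWeight (baseWeight z) Z) (W i) (𝒥 i) Z| ≤ B)
    (hB' : ∀ i ∈ 𝒜, |windowError R (selbergWeight (fullWeight 𝒜 W 𝒥 z) Z) (W i) (𝒥 i) Z| ≤ B) :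
    |lcmForm R (selbergWeight (fullWeight 𝒜 W 𝒥 z) Z) (selbergWeight (fullWeight 𝒜 W 𝒥 z) Z) Z| ≤
      2 * (z : ℝ) ^ 2 * b ^ 2 + #𝒜 * B := by
  have hsum : ∀ β : ℕ → ℝ, (∀ i ∈ 𝒜, |windowError R β (W i) (𝒥 i) Z| ≤ B) →
      |∑ i ∈ 𝒜, windowError R β (W i) (𝒥 i) Z| ≤ #𝒜 * B := fun β hβ => by
    refine (abs_sum_le_sum_abs _ _).trans ?_
    rw [← nsmul_eq_mul]
    exact sum_le_card_nsmul _ _ _ hβ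
  have h1 := hsum _ hB
  have h2 := hsum _ hB'
  have h3 := abs_lcmForm_baseWeight_le hR hb hb0
  rw [lcmForm_fullWeight h, lcmForm_comm R (selbergWeight (baseWeight z) Z), lcmForm_fullWeight h]
  rw [abs_le] at *
  constructor <;> linarith [h1.1, h1.2, h2.1, h2.2, h3.1, h3.2]

/-- The structural hypotheses on the windows which ensure that the weights are at most `1`. -/
structure WindowSystem {ι : Type*} (𝒜 : Finset ι) (W 𝒥 : ι → Finset ℕ) (z Z : ℕ) (N : ℝ) :
    Prop where
  prime : ∀ i ∈ 𝒜, ∀ p ∈ W i, p.Prime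
  large : ∀ i ∈ 𝒜, ∀ p ∈ W i, N ^ (1 / 10 : ℝ) < p
  disjoint : ∀ i ∈ 𝒜, ∀ i' ∈ 𝒜, ∀ p, p ∈ W i → p ∈ W i' → i = i'
  squarefree : ∀ i ∈ 𝒜, ∀ j ∈ 𝒥 i, Squarefree j
  not_dvd : ∀ i ∈ 𝒜, ∀ j ∈ 𝒥 i, ∀ p ∈ W i, ¬ p ∣ j
  lt_mul : ∀ i ∈ 𝒜, ∀ p ∈ W i, ∀ j ∈ 𝒥 i, z < p * j
  mul_le : ∀ i ∈ 𝒜, ∀ p ∈ W i, ∀ j ∈ 𝒥 i, p * j ≤ Z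

variable {ι : Type*} {𝒜 : Finset ι} {W 𝒥 : ι → Finset ℕ} {z Z : ℕ} {N : ℝ}

lemma WindowSystem.mem_Icc (h : WindowSystem 𝒜 W 𝒥 z Z N) :
    ∀ i ∈ 𝒜, ∀ p ∈ W i, ∀ j ∈ 𝒥 i, p * j ∈ Icc 1 Z := fun i hi p hp j hj =>
  Finset.mem_Icc.mpr ⟨(Nat.zero_le _).trans_lt (h.lt_mul i hi p hp j hj), h.mul_le i hi p hp j hj⟩

lemma fullWeight_nonneg (l : ℕ) : 0 ≤ fullWeight 𝒜 W 𝒥 z l :=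
  add_nonneg (baseWeight_nonneg _ _)
    (mul_nonneg (by norm_num) (sum_nonneg fun _ _ => windowWeight_nonneg _ _ _))

lemma WindowSystem.fullWeight_eq_zero (h : WindowSystem 𝒜 W 𝒥 z Z N) {l : ℕ}
    (hl : ¬ Squarefree l) : fullWeight 𝒜 W 𝒥 z l = 0 := by
  unfold fullWeight
  rw [sum_eq_zero, mul_zero, add_zero]
  · unfold baseWeight; rw [if_neg fun h => hl h.1]
  · intro i hi
    refine windowWeight_eq_zero fun p hp j hj hpj => hl ?_
    rw [← hpj]
    have hc := (Nat.Prime.coprime_iff_not_dvd (h.prime i hi p hp)).mpr (h.not_dvd i hi j hj p hp)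
    exact (Nat.squarefree_mul hc).mpr ⟨(h.prime i hi p hp).squarefree, h.squarefree i hi j hj⟩

lemma WindowSystem.sum_windowWeight_le (h : WindowSystem 𝒜 W 𝒥 z Z N) (hN : 1 < N)
    (hZ : (Z : ℝ) ≤ N) {l : ℕ} (hl : 1 ≤ l) :
    ∑ i ∈ 𝒜, windowWeight (W i) (𝒥 i) l ≤ 10 := by
  classical
  by_cases hlZ : Z < l
  · rw [sum_eq_zero]
    · norm_num
    · intro i hi
      refine windowWeight_eq_zero fun p hp j hj hpj => ?_
      have := h.mul_le i hi p hp j hj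
      omega
  have hN0 : 0 < N := by linarith
  set Q : Finset ℕ := {p ∈ l.primeFactors | N ^ (1 / 10 : ℝ) < (p : ℝ)} with hQ
  have hcard : ∑ i ∈ 𝒜, #{z ∈ W i ×ˢ 𝒥 i | z.1 * z.2 = l} ≤ #Q := by
    rw [← card_sigma]
    refine card_le_card_of_injOn (fun x => x.2.1) ?_ ?_
    · rintro ⟨i, p, j⟩ hx
      simp only [coe_sigma, Set.mem_sigma_iff, mem_coe, mem_filter, mem_product] at hx
      obtain ⟨hi, ⟨hp, hj⟩, hpj⟩ := hx
      rw [mem_coe, hQ, mem_filter, Nat.mem_primeFactors]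
      exact ⟨⟨h.prime i hi p hp, ⟨j, hpj.symm⟩, by omega⟩, h.large i hi p hp⟩
    · rintro ⟨i, p, j⟩ hx ⟨i', p', j'⟩ hx' hpp
      simp only [coe_sigma, Set.mem_sigma_iff, mem_coe, mem_filter, mem_product] at hx hx' hpp
      obtain ⟨hi, ⟨hp, hj⟩, hpj⟩ := hx
      obtain ⟨hi', ⟨hp', hj'⟩, hpj'⟩ := hx'
      subst hpp
      obtain rfl := h.disjoint i hi i' hi' p hp hp'
      have := Nat.eq_of_mul_eq_mul_left (h.prime i hi p hp).pos (hpj.trans hpj'.symm)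
      rw [this]
  have hprod : (N ^ (1 / 10 : ℝ)) ^ #Q ≤ N := by
    calc _ = ∏ _p ∈ Q, N ^ (1 / 10 : ℝ) := by rw [prod_const]
      _ ≤ ∏ p ∈ Q, (p : ℝ) := prod_le_prod (fun _ _ => by positivity)
          fun p hp => (mem_filter.mp hp).2.le
      _ ≤ l := by
          have h1 : ∏ p ∈ Q, p ∣ l := by
            refine (prod_dvd_prod_of_subset _ _ _ (filter_subset _ _)).trans
              (Nat.prod_primeFactors_dvd l)
          rw [← Nat.cast_prod]
          exact Nat.cast_le.mpr (Nat.le_of_dvd hl h1)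
      _ ≤ N := le_trans (by exact_mod_cast not_lt.mp hlZ) hZ
  have h10 : #Q ≤ 10 := by
    by_contra hlt
    rw [not_le] at hlt
    have h1 : (1 : ℝ) < N ^ (1 / 10 : ℝ) := Real.one_lt_rpow hN (by norm_num)
    have h2 : (N ^ (1 / 10 : ℝ)) ^ 10 = N := by
      rw [← Real.rpow_natCast, ← Real.rpow_mul hN0.le]; norm_num
    have h3 := pow_lt_pow_right₀ h1 hlt
    rw [h2] at h3
    linarith
  unfold windowWeight
  exact_mod_cast hcard.trans h10

lemma WindowSystem.fullWeight_le_one (h : WindowSystem 𝒜 W 𝒥 z Z N) (hN : 1 < N)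
    (hZ : (Z : ℝ) ≤ N) (l : ℕ) : fullWeight 𝒜 W 𝒥 z l ≤ 1 := by
  by_cases hl : l ≤ z
  · unfold fullWeight
    rw [sum_eq_zero, mul_zero, add_zero]
    · exact baseWeight_le_one _ _
    · intro i hi
      refine windowWeight_eq_zero fun p hp j hj hpj => ?_
      have := h.lt_mul i hi p hp j hj
      omega
  · have h0 : baseWeight z l = 0 := by unfold baseWeight; rw [if_neg fun h => hl h.2]
    have := h.sum_windowWeight_le hN hZ (l := l) (by omega)
    unfold fullWeight
    rw [h0]
    linarith

end

/-- The completely multiplicative function `n ↦ 1 / n`. -/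
noncomputable def invHom : ℕ →* ℝ where
  toFun n := (n : ℝ)⁻¹
  map_one' := by simp
  map_mul' m n := by push_cast; rw [mul_inv]

lemma hasSum_inv_factoredNumbers {l : ℕ} (hl : l ≠ 0) :
    HasSum ((Nat.factoredNumbers l.primeFactors).indicator fun m : ℕ => (m : ℝ)⁻¹)
      (l / l.totient) := by
  have h := (EulerProduct.summable_and_hasSum_factoredNumbers_prod_filter_prime_geometric
    (f := invHom) (fun {p} hp => ?_) l.primeFactors).2
  · rw [← hasSum_subtype_iff_indicator]
    convert! h using 1
    have hcast : (l.totient : ℝ) = l * ∏ p ∈ l.primeFactors, (1 - (p : ℝ)⁻¹) := by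
      have := Nat.totient_eq_mul_prod_factors l
      have h' := congrArg (Rat.cast : ℚ → ℝ) this
      push_cast at h'
      exact h'
    have hl0 : (l : ℝ) ≠ 0 := by exact_mod_cast hl
    rw [filter_true_of_mem fun p hp => Nat.prime_of_mem_primeFactors hp, hcast, prod_inv_distrib,
      ← div_div, div_self hl0, one_div]
    rfl
  · have := hp.one_lt
    change ‖(p : ℝ)⁻¹‖ < 1
    rw [norm_inv, Real.norm_natCast]
    exact inv_lt_one_of_one_lt₀ (by exact_mod_cast this)

lemma sum_inv_primeFactors_eq_le {l : ℕ} (hl : l ≠ 0) {S : Finset ℕ}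
    (hS : ∀ n ∈ S, n ≠ 0 ∧ n.primeFactors = l.primeFactors ∧ l ∣ n) :
    ∑ n ∈ S, (n : ℝ)⁻¹ ≤ (l.totient : ℝ)⁻¹ := by
  have hl0 : (l : ℝ) ≠ 0 := by exact_mod_cast hl
  have hinj : Set.InjOn (fun n => n / l) S := by
    intro n hn m hm h
    rw [← Nat.div_mul_cancel (hS n hn).2.2, ← Nat.div_mul_cancel (hS m hm).2.2]
    exact congrArg (· * l) h
  have h1 : ∑ m ∈ S.image fun n => n / l, ((Nat.factoredNumbers l.primeFactors).indicator
      fun m : ℕ => (m : ℝ)⁻¹) m ≤ l / l.totient := by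
    refine sum_le_hasSum _ (fun m _ => ?_) (hasSum_inv_factoredNumbers hl)
    exact Set.indicator_nonneg (fun m _ => by positivity) _
  rw [sum_image hinj] at h1
  have h2 : ∀ n ∈ S, ((Nat.factoredNumbers l.primeFactors).indicator
      fun m : ℕ => (m : ℝ)⁻¹) (n / l) = l * (n : ℝ)⁻¹ := by
    intro n hn
    obtain ⟨hn0, hnp, m, rfl⟩ := hS n hn
    have hm0 : m ≠ 0 := right_ne_zero_of_mul hn0
    rw [Nat.mul_div_cancel_left _ (Nat.pos_of_ne_zero hl), Set.indicator_of_mem]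
    · push_cast; field_simp
    · rw [Nat.mem_factoredNumbers_iff_primeFactors_subset]
      refine ⟨hm0, ?_⟩
      rw [← hnp]
      exact Nat.primeFactors_mono ⟨l, mul_comm _ _⟩ hn0
  rw [sum_congr rfl h2, ← mul_sum] at h1
  have hl1 : (0 : ℝ) < l := by positivity
  rw [div_eq_mul_inv] at h1
  exact le_of_mul_le_mul_left h1 hl1

lemma log_succ_le_sum_baseWeight {z Z : ℕ} (hz : z ≤ Z) :
    Real.log (z + 1) ≤ ∑ l ∈ Icc 1 Z, baseWeight z l / l.totient := by
  classical
  have h1 : Real.log (z + 1) ≤ ∑ n ∈ Icc 1 z, (n : ℝ)⁻¹ := by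
    have := log_add_one_le_harmonic z
    rw [harmonic_eq_sum_Icc] at this
    push_cast at this
    exact this
  have hmaps : ∀ n ∈ Icc 1 z, ∏ p ∈ n.primeFactors, p ∈ Icc 1 Z := fun n hn => by
    rw [mem_Icc] at hn ⊢
    have h2 := Nat.prod_primeFactors_dvd n
    exact ⟨Nat.pos_of_dvd_of_pos h2 hn.1, (Nat.le_of_dvd hn.1 h2).trans (hn.2.trans hz)⟩
  refine h1.trans ?_
  rw [← sum_fiberwise_of_maps_to (M := ℝ) hmaps]
  refine sum_le_sum fun l hl => ?_
  have hl0 : l ≠ 0 := by rw [mem_Icc] at hl; omega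
  by_cases hne : ({n ∈ Icc 1 z | ∏ p ∈ n.primeFactors, p = l} : Finset ℕ).Nonempty
  · obtain ⟨n, hn⟩ := hne
    rw [mem_filter, mem_Icc] at hn
    have hle := (Nat.le_of_dvd hn.1.1 (Nat.prod_primeFactors_dvd n)).trans hn.1.2
    rw [hn.2] at hle
    have hsq : Squarefree l := by
      rw [← hn.2]
      refine squarefree_prod_of_pairwise_isCoprime (fun p hp q hq hpq => ?_)
        fun p hp => (Nat.prime_of_mem_primeFactors hp).squarefree
      exact (Nat.coprime_iff_isRelPrime.mp ((Nat.coprime_primes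
        (Nat.prime_of_mem_primeFactors hp) (Nat.prime_of_mem_primeFactors hq)).mpr hpq))
    have hb : baseWeight z l = 1 := by unfold baseWeight; rw [if_pos ⟨hsq, hle⟩]
    rw [hb, one_div]
    refine sum_inv_primeFactors_eq_le hl0 fun m hm => ?_
    rw [mem_filter, mem_Icc] at hm
    refine ⟨by omega, ?_, ?_⟩
    · rw [← hm.2, Nat.primeFactors_prod fun p hp => Nat.prime_of_mem_primeFactors hp]
    · rw [← hm.2]; exact Nat.prod_primeFactors_dvd m
  · rw [not_nonempty_iff_eq_empty] at hne
    rw [hne, sum_empty]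
    exact div_nonneg (baseWeight_nonneg _ _) (Nat.cast_nonneg _)

lemma log_div_le_sum_inv_Ioc {L J : ℕ} (h : L ≤ J) :
    Real.log ((J + 1) / (L + 1)) ≤ ∑ m ∈ Ioc L J, (m : ℝ)⁻¹ := by
  induction J, h using Nat.le_induction with
  | base => rw [div_self (by positivity)]; simp
  | succ J h ih =>
    rw [sum_Ioc_succ_top h]
    have h1 : ((J + 1 : ℕ) + 1 : ℝ) / (L + 1) = (J + 1) / (L + 1) * (1 + ((J + 1 : ℕ) : ℝ)⁻¹) := by
      push_cast; field_simp
    rw [h1, Real.log_mul (by positivity) (by positivity)]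
    have := Real.log_le_sub_one_of_pos (x := 1 + ((J + 1 : ℕ) : ℝ)⁻¹) (by positivity)
    linarith

lemma sum_inv_Ioc_le_log_div {L J : ℕ} (hL : 1 ≤ L) (h : L ≤ J) :
    ∑ m ∈ Ioc L J, (m : ℝ)⁻¹ ≤ Real.log (J / L) := by
  have hL0 : (0 : ℝ) < L := by exact_mod_cast hL
  induction J, h using Nat.le_induction with
  | base => rw [div_self hL0.ne']; simp
  | succ J h ih =>
    rw [sum_Ioc_succ_top h]
    have hJ0 : (0 : ℝ) < J := by exact_mod_cast (by omega : 0 < J)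
    have h1 : ((J : ℝ) / L) = ((J + 1 : ℕ) : ℝ) / L * (1 - ((J + 1 : ℕ) : ℝ)⁻¹) := by
      push_cast; field_simp; ring
    have h2 : (0 : ℝ) < 1 - ((J + 1 : ℕ) : ℝ)⁻¹ := by
      rw [sub_pos]
      exact inv_lt_one_of_one_lt₀ (by push_cast; linarith)
    rw [h1, Real.log_mul (by positivity) h2.ne'] at ih
    have := Real.log_le_sub_one_of_pos h2
    linarith

lemma sum_inv_Ioc_dvd_le {L J d : ℕ} (hL : 1 ≤ L) (h : L ≤ J) (hd : 1 ≤ d) :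
    ∑ j ∈ Ioc L J with d ∣ j, (j : ℝ)⁻¹ ≤ (d : ℝ)⁻¹ * (1 + Real.log (J / L)) := by
  have hL0 : (0 : ℝ) < L := by exact_mod_cast hL
  have hd0 : (0 : ℝ) < d := by exact_mod_cast hd
  have h1 : ∑ j ∈ Ioc L J with d ∣ j, (j : ℝ)⁻¹ =
      (d : ℝ)⁻¹ * ∑ m ∈ Ioc (L / d) (J / d), (m : ℝ)⁻¹ := by
    rw [mul_sum]
    symm
    refine sum_bij (fun m _ => d * m) (fun m hm => ?_) (fun m _ m' _ hmm => ?_) (fun j hj => ?_)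
      fun m _ => ?_
    · rw [mem_Ioc, Nat.div_lt_iff_lt_mul hd, Nat.le_div_iff_mul_le hd] at hm
      rw [mem_filter, mem_Ioc, mul_comm]
      exact ⟨hm, Dvd.intro_left _ rfl⟩
    · exact Nat.eq_of_mul_eq_mul_left hd hmm
    · rw [mem_filter, mem_Ioc] at hj
      obtain ⟨hj, m, rfl⟩ := hj
      refine ⟨m, ?_, rfl⟩
      rw [mem_Ioc, Nat.div_lt_iff_lt_mul hd, Nat.le_div_iff_mul_le hd, mul_comm]
      exact hj
    · push_cast; rw [mul_inv]
  rw [h1]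
  gcongr
  have hpos := Nat.zero_le (L / d)
  have hlog : 0 ≤ Real.log (J / L) := Real.log_nonneg (by
    rw [le_div_iff₀ hL0, one_mul]; exact_mod_cast h)
  by_cases hAB : L / d + 1 ≤ J / d
  · rw [← insert_Ioc_add_one_left_eq_Ioc (by omega), sum_insert (by simp)]
    refine add_le_add
      (inv_le_one_of_one_le₀ (by push_cast; linarith [Nat.cast_nonneg (α := ℝ) (L / d)])) ?_
    refine (sum_inv_Ioc_le_log_div (by omega) hAB).trans ?_
    have hB : (0 : ℝ) < (J / d : ℕ) := by exact_mod_cast (by omega : 0 < J / d)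
    refine Real.log_le_log (by positivity) ?_
    have h2 : ((J / d : ℕ) : ℝ) * d ≤ J := by exact_mod_cast Nat.div_mul_le_self J d
    have h3 : (L : ℝ) ≤ (L / d + 1 : ℕ) * d := by
      exact_mod_cast (Nat.lt_mul_of_div_lt (Nat.lt_succ_self _) hd).le
    rw [div_le_div_iff₀ (by positivity) hL0]
    calc ((J / d : ℕ) : ℝ) * L ≤ (J / d : ℕ) * ((L / d + 1 : ℕ) * d) := by gcongr
      _ = ((J / d : ℕ) * d) * (L / d + 1 : ℕ) := by ring
      _ ≤ _ := by gcongr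
  · rw [Ioc_eq_empty (by omega), sum_empty]
    linarith

lemma sum_inv_mul_self_le (J : ℕ) : ∑ d ∈ Icc 2 J, ((d * d : ℕ) : ℝ)⁻¹ ≤ 3 / 4 := by
  by_cases hJ : 2 ≤ J
  · suffices h : ∑ d ∈ Icc 2 J, ((d * d : ℕ) : ℝ)⁻¹ ≤ 3 / 4 - (J : ℝ)⁻¹ by
      have : (0 : ℝ) ≤ (J : ℝ)⁻¹ := by positivity
      linarith
    induction J, hJ using Nat.le_induction with
    | base => norm_num
    | succ J h ih =>
      rw [sum_Icc_succ_top (by omega)]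
      have hJ0 : (0 : ℝ) < J := by exact_mod_cast (by omega : 0 < J)
      have : (((J + 1) * (J + 1) : ℕ) : ℝ)⁻¹ ≤ (J : ℝ)⁻¹ - ((J + 1 : ℕ) : ℝ)⁻¹ := by
        push_cast
        rw [inv_sub_inv hJ0.ne' (by positivity), inv_eq_one_div,
          div_le_div_iff₀ (by positivity) (by positivity)]
        nlinarith
      linarith
  · rw [Icc_eq_empty (by omega)]; norm_num

open Classical in
/-- The squarefree integers in `(L, J]` without prime factor in `W`. -/
noncomputable def cofactors (W : Finset ℕ) (L J : ℕ) : Finset ℕ :=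
  {j ∈ Ioc L J | Squarefree j ∧ ∀ p ∈ W, ¬ p ∣ j}

lemma mem_cofactors {W : Finset ℕ} {L J j : ℕ} :
    j ∈ cofactors W L J ↔ (L < j ∧ j ≤ J) ∧ Squarefree j ∧ ∀ p ∈ W, ¬ p ∣ j := by
  rw [cofactors, mem_filter, mem_Ioc]

lemma le_sum_inv_cofactors {W : Finset ℕ} {L J : ℕ} (hW : ∀ p ∈ W, 1 ≤ p) (hL : 1 ≤ L)
    (h : L ≤ J) : Real.log ((J + 1) / (L + 1)) -
      (3 / 4 + ∑ p ∈ W, (p : ℝ)⁻¹) * (1 + Real.log (J / L)) ≤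
        ∑ j ∈ cofactors W L J, (j : ℝ)⁻¹ := by
  have hL0 : (0 : ℝ) < L := by exact_mod_cast hL
  have hlog : 0 ≤ Real.log (J / L) := Real.log_nonneg (by
    rw [le_div_iff₀ hL0, one_mul]; exact_mod_cast h)
  have hpt : ∀ j ∈ Ioc L J, (j : ℝ)⁻¹ ≤ (if j ∈ cofactors W L J then (j : ℝ)⁻¹ else 0) +
      ∑ d ∈ Icc 2 J, (if d * d ∣ j then (j : ℝ)⁻¹ else 0) +
      ∑ p ∈ W, (if p ∣ j then (j : ℝ)⁻¹ else 0) := by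
    intro j hj
    have hj0 : (0 : ℝ) ≤ (j : ℝ)⁻¹ := by positivity
    have hn1 : ∀ d ∈ Icc 2 J, (0 : ℝ) ≤ (if d * d ∣ j then (j : ℝ)⁻¹ else 0) := fun d _ => by
      split_ifs <;> simp
    have hn2 : ∀ p ∈ W, (0 : ℝ) ≤ (if p ∣ j then (j : ℝ)⁻¹ else 0) := fun d _ => by
      split_ifs <;> simp
    have hs1 := sum_nonneg hn1
    have hs2 := sum_nonneg hn2
    by_cases hjc : j ∈ cofactors W L J
    · rw [if_pos hjc]; linarith
    rw [if_neg hjc]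
    have hj' := mem_Ioc.mp hj
    by_cases hsq : Squarefree j
    · have : ∃ p ∈ W, p ∣ j := by
        by_contra! hcon
        exact hjc (mem_cofactors.mpr ⟨hj', hsq, hcon⟩)
      obtain ⟨p, hp, hpj⟩ := this
      have := single_le_sum hn2 hp
      rw [if_pos hpj] at this
      linarith
    · rw [Nat.squarefree_iff_prime_squarefree] at hsq
      push Not at hsq
      obtain ⟨p, hp, hpj⟩ := hsq
      have hpJ : p ∈ Icc 2 J := mem_Icc.mpr ⟨hp.two_le,
        ((Nat.le_mul_self p).trans (Nat.le_of_dvd (by omega) hpj)).trans hj'.2⟩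
      have := single_le_sum hn1 hpJ
      rw [if_pos hpj] at this
      linarith
  have hsum := sum_le_sum hpt
  rw [sum_add_distrib, sum_add_distrib, ← sum_filter, sum_comm, sum_comm (s := Ioc L J) (t := W)]
    at hsum
  have hc : {j ∈ Ioc L J | j ∈ cofactors W L J} = cofactors W L J := by
    ext j
    rw [mem_filter, mem_Ioc, mem_cofactors]
    tauto
  rw [hc] at hsum
  have hA : ∑ d ∈ Icc 2 J, ∑ j ∈ Ioc L J, (if d * d ∣ j then (j : ℝ)⁻¹ else 0) ≤
      3 / 4 * (1 + Real.log (J / L)) := by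
    calc _ ≤ ∑ d ∈ Icc 2 J, ((d * d : ℕ) : ℝ)⁻¹ * (1 + Real.log (J / L)) := by
          refine sum_le_sum fun d hd => ?_
          rw [← sum_filter]
          exact sum_inv_Ioc_dvd_le hL h (Nat.mul_pos (by rw [mem_Icc] at hd; omega)
            (by rw [mem_Icc] at hd; omega))
      _ ≤ _ := by
          rw [← sum_mul]
          gcongr
          exact sum_inv_mul_self_le J
  have hB : ∑ p ∈ W, ∑ j ∈ Ioc L J, (if p ∣ j then (j : ℝ)⁻¹ else 0) ≤
      (∑ p ∈ W, (p : ℝ)⁻¹) * (1 + Real.log (J / L)) := by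
    rw [sum_mul]
    refine sum_le_sum fun p hp => ?_
    rw [← sum_filter]
    exact sum_inv_Ioc_dvd_le hL h (hW p hp)
  have := log_div_le_sum_inv_Ioc h
  linarith

section

open Filter

lemma eventually_le_sum_inv_cofactors {l j : ℝ} (hl : 0 < l) (hlj : l < j) :
    ∀ᶠ N : ℝ in atTop, ∀ W : Finset ℕ, (∀ p ∈ W, 1 ≤ p) → ∑ p ∈ W, (p : ℝ)⁻¹ ≤ 1 / 20 →
      (j - l) / 10 * Real.log N ≤ ∑ m ∈ cofactors W ⌊N ^ l⌋₊ ⌊N ^ j⌋₊, (m : ℝ)⁻¹ := by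
  have hbig : ∀ᶠ N : ℝ in atTop, 21 / (j - l) ≤ Real.log N :=
    Real.tendsto_log_atTop.eventually_ge_atTop _
  filter_upwards [hbig, eventually_gt_atTop 1] with N hN hN1 W hW hW'
  have hN0 : 0 < N := by linarith
  have hLam : 21 ≤ (j - l) * Real.log N := by
    rw [div_le_iff₀ (by linarith)] at hN; linarith
  have h1l : 1 ≤ N ^ l := Real.one_le_rpow hN1.le hl.le
  have hle : N ^ l ≤ N ^ j := Real.rpow_le_rpow_of_exponent_le hN1.le hlj.le
  have hL1 : 1 ≤ ⌊N ^ l⌋₊ := Nat.le_floor (by simpa using h1l)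
  have hLJ : ⌊N ^ l⌋₊ ≤ ⌊N ^ j⌋₊ := Nat.floor_le_floor hle
  have hL1' : (1 : ℝ) ≤ ⌊N ^ l⌋₊ := by exact_mod_cast hL1
  have hLu := Nat.floor_le (zero_le_one.trans h1l)
  have hLl := Nat.lt_floor_add_one (N ^ l)
  have hJu := Nat.floor_le (by positivity : 0 ≤ N ^ j)
  have hJl := Nat.lt_floor_add_one (N ^ j)
  have hJ1' : (1 : ℝ) ≤ ⌊N ^ j⌋₊ := hL1'.trans (by exact_mod_cast hLJ)
  have hdiv : N ^ j / N ^ l = N ^ (j - l) := (Real.rpow_sub hN0 _ _).symm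
  have hlogdiv : Real.log (N ^ (j - l)) = (j - l) * Real.log N := Real.log_rpow hN0 _
  have hlow : (j - l) * Real.log N - Real.log 2 ≤
      Real.log ((⌊N ^ j⌋₊ + 1) / (⌊N ^ l⌋₊ + 1)) := by
    rw [← hlogdiv, ← hdiv, ← Real.log_div (by positivity) (by norm_num)]
    refine Real.log_le_log (by positivity) ?_
    rw [div_div]
    gcongr
    linarith
  have hup : Real.log (⌊N ^ j⌋₊ / ⌊N ^ l⌋₊) ≤ (j - l) * Real.log N + Real.log 2 := by
    rw [← hlogdiv, ← hdiv, ← Real.log_mul (by positivity) (by norm_num)]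
    refine Real.log_le_log (by positivity) ?_
    rw [div_mul_eq_mul_div, div_le_div_iff₀ (by linarith) (by linarith)]
    calc (⌊N ^ j⌋₊ : ℝ) * N ^ l ≤ N ^ j * (2 * ⌊N ^ l⌋₊) := by
          gcongr; linarith
      _ = _ := by ring
  have hup0 : 0 ≤ Real.log (⌊N ^ j⌋₊ / ⌊N ^ l⌋₊ : ℝ) := Real.log_nonneg (by
    rw [le_div_iff₀ (by linarith), one_mul]; exact_mod_cast hLJ)
  have hmain := le_sum_inv_cofactors hW hL1 hLJ
  have hlog2 := Real.log_two_lt_d9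
  have : (3 / 4 + ∑ p ∈ W, (p : ℝ)⁻¹) * (1 + Real.log (⌊N ^ j⌋₊ / ⌊N ^ l⌋₊)) ≤
      4 / 5 * (1 + ((j - l) * Real.log N + Real.log 2)) := by
    gcongr
    linarith
  linarith

lemma eventually_le_theta_sub_theta :
    ∀ᶠ x : ℝ in atTop, x / 4 ≤ Chebyshev.theta x - Chebyshev.theta (x / 4) := by
  have hlo := (isLittleO_log_rpow_atTop (r := 1 / 2) (by norm_num)).bound
    (c := 1 / 100) (by norm_num)
  filter_upwards [hlo, eventually_ge_atTop 20] with x hx hx20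
  have hlog : 0 ≤ Real.log x := Real.log_nonneg (by linarith)
  rw [← Real.sqrt_eq_rpow, Real.norm_of_nonneg hlog, Real.norm_of_nonneg (Real.sqrt_nonneg _)] at hx
  have h1 := Chebyshev.theta_ge' (x := x) (by linarith)
  have h2 := Chebyshev.theta_le_log4_mul_x (x := x / 4) (by linarith)
  have hlog4 : Real.log 4 = 2 * Real.log 2 := by
    rw [show (4 : ℝ) = 2 ^ 2 by norm_num, Real.log_pow]; norm_num
  rw [hlog4] at h2
  have hl1 := Real.log_two_gt_d9
  have hl2 := Real.log_two_lt_d9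
  have hs : √x * √x = x := Real.mul_self_sqrt (by linarith)
  have h3 : √x * Real.log x ≤ 1 / 100 * x := by
    calc _ ≤ √x * (1 / 100 * √x) := by gcongr
      _ = _ := by rw [mul_left_comm, hs]
  have hsx : √x ≤ x := by
    rw [Real.sqrt_le_left (by linarith)]; nlinarith
  have h4 : Real.log (x + 2) ≤ 1 / 50 * x := by
    have : Real.log (x + 2) ≤ Real.log (x ^ 2) := Real.log_le_log (by linarith) (by nlinarith)
    rw [Real.log_pow] at this
    push_cast at this
    linarith
  nlinarith

/-- The primes in `(t, u]`. -/
noncomputable def primesIoc (t u : ℝ) : Finset ℕ := {p ∈ Ioc ⌊t⌋₊ ⌊u⌋₊ | p.Prime}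

lemma mem_primesIoc {t u : ℝ} (ht : 0 ≤ t) (hu : 0 ≤ u) {p : ℕ} :
    p ∈ primesIoc t u ↔ (t < p ∧ (p : ℝ) ≤ u) ∧ p.Prime := by
  rw [primesIoc, mem_filter, mem_Ioc, Nat.floor_lt ht, Nat.le_floor_iff hu]

lemma sum_primesIoc_add {t u v : ℝ} (htu : t ≤ u) (huv : u ≤ v) (f : ℕ → ℝ) :
    ∑ p ∈ primesIoc t u, f p + ∑ p ∈ primesIoc u v, f p = ∑ p ∈ primesIoc t v, f p := by
  unfold primesIoc
  simp only [sum_filter]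
  exact sum_Ioc_consecutive _ (Nat.floor_le_floor htu) (Nat.floor_le_floor huv)

lemma theta_sub_theta {t u : ℝ} (htu : t ≤ u) :
    Chebyshev.theta u - Chebyshev.theta t = ∑ p ∈ primesIoc t u, Real.log p := by
  unfold primesIoc Chebyshev.theta
  simp only [sum_filter]
  rw [← sum_Ioc_consecutive _ (Nat.zero_le _) (Nat.floor_le_floor htu)]
  ring

lemma exists_le_sum_inv_primesIoc : ∃ t₀ : ℝ, 1 < t₀ ∧ ∀ t, t₀ ≤ t → ∀ K : ℕ,
    K / (4 * Real.log (4 ^ K * t)) ≤ ∑ p ∈ primesIoc t (4 ^ K * t), (p : ℝ)⁻¹ := by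
  obtain ⟨t₁, ht₁⟩ := eventually_atTop.mp eventually_le_theta_sub_theta
  refine ⟨max t₁ 2, by simp, fun t ht K => ?_⟩
  have ht1 : t₁ ≤ t := (le_max_left _ _).trans ht
  have ht2 : 2 ≤ t := (le_max_right _ _).trans ht
  induction K with
  | zero => simp [sum_nonneg]
  | succ K ih =>
    have hpow : (1 : ℝ) ≤ 4 ^ K := one_le_pow₀ (by norm_num)
    have hu : t ≤ 4 ^ K * t := by nlinarith
    set u := 4 ^ K * t with hudef
    have hv : (4 : ℝ) ^ (K + 1) * t = 4 * u := by rw [hudef]; ring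
    rw [hv, ← sum_primesIoc_add hu (by linarith : u ≤ 4 * u)]
    have hlogu : 0 < Real.log u := Real.log_pos (by linarith)
    have hlogv : Real.log u ≤ Real.log (4 * u) := Real.log_le_log (by linarith) (by linarith)
    have hstep : 1 / (4 * Real.log (4 * u)) ≤ ∑ p ∈ primesIoc u (4 * u), (p : ℝ)⁻¹ := by
      have h := ht₁ (4 * u) (by linarith)
      rw [mul_div_cancel_left₀ _ (by norm_num), theta_sub_theta (by linarith)] at h
      have h' : ∑ p ∈ primesIoc u (4 * u), Real.log p ≤
          ∑ p ∈ primesIoc u (4 * u), (4 * u * Real.log (4 * u)) * (p : ℝ)⁻¹ := by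
        refine sum_le_sum fun p hp => ?_
        rw [mem_primesIoc (by linarith) (by linarith)] at hp
        have hp0 : (0 : ℝ) < p := by linarith [hp.1.1]
        rw [← div_eq_mul_inv, le_div_iff₀ hp0, mul_comm]
        exact mul_le_mul hp.1.2 (Real.log_le_log hp0 hp.1.2)
          (Real.log_nonneg (by linarith [hp.1.1])) (by linarith)
      rw [← mul_sum] at h'
      rw [div_le_iff₀ (by linarith)]
      have hu0 : 0 < u := by linarith
      refine le_of_mul_le_mul_left ?_ hu0
      linarith
    have : (K : ℝ) / (4 * Real.log (4 * u)) ≤ K / (4 * Real.log u) := by gcongr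
    push_cast
    rw [add_div]
    linarith

lemma exists_subset_sum_mem_Icc {S : Finset ℕ} {f : ℕ → ℝ} {c e : ℝ} (hc : 0 ≤ c) (he : 0 ≤ e)
    (hf : ∀ n ∈ S, f n ≤ e) (hS : c ≤ ∑ n ∈ S, f n) :
    ∃ W ⊆ S, c ≤ ∑ n ∈ W, f n ∧ ∑ n ∈ W, f n ≤ c + e := by
  classical
  induction S using Finset.induction_on with
  | empty => exact ⟨∅, by simp, hS, by simp; linarith⟩
  | insert a S ha ih =>
    by_cases h : c ≤ ∑ n ∈ S, f n
    · obtain ⟨W, hW, h1⟩ := ih (fun n hn => hf n (mem_insert_of_mem hn)) h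
      exact ⟨W, hW.trans (subset_insert _ _), h1⟩
    · refine ⟨_, Subset.rfl, hS, ?_⟩
      rw [sum_insert ha]
      have := hf a (mem_insert_self _ _)
      linarith

lemma eventually_exists_primes {A ω : ℝ} (hω : 0 < ω) (hω1 : ω ≤ 1 / 10) (hA : 1 / 10 ≤ A - ω)
    (hA' : A ≤ 1 / 5) : ∀ᶠ N : ℝ in atTop, ∃ W : Finset ℕ,
      (∀ p ∈ W, p.Prime ∧ N ^ (A - ω) < p ∧ (p : ℝ) ≤ N ^ A) ∧
      ω / 3 ≤ ∑ p ∈ W, (p : ℝ)⁻¹ ∧ ∑ p ∈ W, (p : ℝ)⁻¹ ≤ 1 / 20 := by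
  obtain ⟨t₀, ht₀1, ht₀⟩ := exists_le_sum_inv_primesIoc
  filter_upwards [(tendsto_rpow_atTop (by linarith : 0 < A - ω)).eventually_ge_atTop (max t₀ 100),
    Real.tendsto_log_atTop.eventually_ge_atTop (4 / ω), eventually_gt_atTop 1] with N hN hN' hN1
  have hN0 : 0 < N := by linarith
  have hlog4 : Real.log 4 = 2 * Real.log 2 := by
    rw [show (4 : ℝ) = 2 ^ 2 by norm_num, Real.log_pow]; norm_num
  have hl1 := Real.log_two_gt_d9
  have hl2 := Real.log_two_lt_d9
  set t := N ^ (A - ω) with ht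
  have htt : t₀ ≤ t := (le_max_left _ _).trans hN
  have ht100 : 100 ≤ t := (le_max_right _ _).trans hN
  have hlN : 4 ≤ ω * Real.log N := by rw [div_le_iff₀ hω] at hN'; linarith
  set K := ⌊ω * Real.log N / Real.log 4⌋₊ with hK
  have hKu : K * Real.log 4 ≤ ω * Real.log N := by
    rw [← le_div_iff₀ (by linarith)]
    exact Nat.floor_le (div_nonneg (by linarith) (by linarith))
  have hKl : ω * Real.log N ≤ 2 * K * Real.log 4 := by
    have := Nat.lt_floor_add_one (ω * Real.log N / Real.log 4)
    rw [div_lt_iff₀ (by linarith), ← hK] at this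
    have : (1 : ℝ) ≤ K := by
      rw [hK]
      exact_mod_cast Nat.le_floor (by
        rw [Nat.cast_one, le_div_iff₀ (by linarith)]; linarith)
    nlinarith
  have hu : 4 ^ K * t ≤ N ^ A := by
    rw [← Real.log_le_log_iff (by positivity) (by positivity),
      Real.log_mul (by positivity) (by positivity), Real.log_pow, ht, Real.log_rpow hN0,
      Real.log_rpow hN0]
    nlinarith
  have hpow : (1 : ℝ) ≤ 4 ^ K := one_le_pow₀ (by norm_num)
  have hsum : ω / 3 ≤ ∑ p ∈ primesIoc t (4 ^ K * t), (p : ℝ)⁻¹ := by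
    refine le_trans ?_ (ht₀ t htt K)
    have hlt : 0 < Real.log (4 ^ K * t) := Real.log_pos (by nlinarith)
    have hlu : Real.log (4 ^ K * t) ≤ 1 / 5 * Real.log N := by
      refine (Real.log_le_log (by positivity) hu).trans ?_
      rw [Real.log_rpow hN0]
      gcongr
      exact (Real.log_pos hN1).le
    rw [div_le_div_iff₀ (by norm_num) (by linarith)]
    nlinarith [Nat.cast_nonneg (α := ℝ) K]
  have hsmall : ∀ p ∈ primesIoc t (4 ^ K * t), (p : ℝ)⁻¹ ≤ 1 / 100 := by
    intro p hp
    rw [mem_primesIoc (by linarith) (by positivity)] at hp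
    rw [inv_eq_one_div]
    exact one_div_le_one_div_of_le (by norm_num) (by linarith [hp.1.1])
  obtain ⟨W, hW, h1, h2⟩ := exists_subset_sum_mem_Icc (by linarith) (by norm_num) hsmall hsum
  refine ⟨W, fun p hp => ?_, h1, by linarith⟩
  have := hW hp
  rw [mem_primesIoc (by linarith) (by positivity)] at this
  exact ⟨this.2, this.1.1, this.1.2.trans hu⟩

/-- The conditions on a window exponent `A` under which `eventually_abs_windowError_le` applies
to the primes in `(N ^ (A - ω), N ^ A]`. -/
structure AdmissibleExponent (s δ ω A : ℝ) : Prop where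
  ge : 1 / 10 ≤ A - ω
  le : A ≤ 1 / 5
  exists_orders : ∃ k l : ℕ, 1 ≤ k ∧ 1 ≤ l ∧ (2 * k - 1) * (A + (1 / 2 + δ)) < s ∧
    (2 * l - 1) * (1 / 2 - A + δ) < s ∧
    s + 1 / 20 ≤ k * (A + (1 / 2 + δ)) + l * (1 / 2 - A + δ) ∧ 16 * δ < 1 / 20 / (2 * k * l)

lemma windowSystem_of_rpow {𝒜 : Finset ℝ} {W : ℝ → Finset ℕ} {N δ ω η : ℝ} (hN : 1 < N)
    (hlow : ∀ A ∈ 𝒜, 1 / 10 ≤ A - ω) (hsep : ∀ A ∈ 𝒜, ∀ A' ∈ 𝒜, A < A' → A + ω ≤ A')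
    (hW : ∀ A ∈ 𝒜, ∀ p ∈ W A, p.Prime ∧ N ^ (A - ω) < p ∧ (p : ℝ) ≤ N ^ A) :
    WindowSystem 𝒜 W
      (fun A => cofactors (W A) ⌊N ^ (1 / 2 - η - A + ω)⌋₊ ⌊N ^ (1 / 2 - A + δ)⌋₊)
      ⌊N ^ (1 / 2 - η)⌋₊ ⌊N ^ (1 / 2 + δ)⌋₊ N := by
  have hN0 : 0 < N := by linarith
  have hdisj : ∀ A ∈ 𝒜, ∀ A' ∈ 𝒜, ∀ p, p ∈ W A → p ∈ W A' → ¬ A < A' := by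
    intro A hA A' hA' p hp hp' hlt
    have h1 := (hW A hA p hp).2.2
    have h2 := (hW A' hA' p hp').2.1
    have h3 : N ^ A ≤ N ^ (A' - ω) :=
      Real.rpow_le_rpow_of_exponent_le hN.le (by linarith [hsep A hA A' hA' hlt])
    linarith
  constructor
  · exact fun A hA p hp => (hW A hA p hp).1
  · exact fun A hA p hp => lt_of_le_of_lt
      (Real.rpow_le_rpow_of_exponent_le hN.le (hlow A hA)) (hW A hA p hp).2.1
  · intro A hA A' hA' p hp hp'
    exact le_antisymm (not_lt.mp (hdisj A' hA' A hA p hp' hp))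
      (not_lt.mp (hdisj A hA A' hA' p hp hp'))
  · exact fun A hA j hj => (mem_cofactors.mp hj).2.1
  · exact fun A hA j hj => (mem_cofactors.mp hj).2.2
  · intro A hA p hp j hj
    rw [mem_cofactors, Nat.floor_lt (by positivity)] at hj
    rw [Nat.floor_lt (by positivity), Nat.cast_mul]
    calc N ^ (1 / 2 - η) = N ^ (A - ω) * N ^ (1 / 2 - η - A + ω) := by
          rw [← Real.rpow_add hN0]; congr 1; ring
      _ < p * j := mul_lt_mul'' (hW A hA p hp).2.1 hj.1.1 (by positivity) (by positivity)
  · intro A hA p hp j hj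
    rw [mem_cofactors, Nat.le_floor_iff (by positivity)] at hj
    rw [Nat.le_floor_iff (by positivity), Nat.cast_mul]
    calc (p : ℝ) * j ≤ N ^ A * N ^ (1 / 2 - A + δ) :=
          mul_le_mul (hW A hA p hp).2.2 hj.1.2 (by positivity) (by positivity)
      _ = _ := by rw [← Real.rpow_add hN0]; congr 1; ring

lemma WindowSystem.le_sum_fullWeight {𝒜 : Finset ℝ} {W 𝒥 : ℝ → Finset ℕ} {z Z : ℕ} {N c e : ℝ}
    (h : WindowSystem 𝒜 W 𝒥 z Z N) (hzZ : z ≤ Z) (hc : 0 ≤ c) (he : 0 ≤ e)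
    (hW : ∀ A ∈ 𝒜, c ≤ ∑ p ∈ W A, (p : ℝ)⁻¹) (hJ : ∀ A ∈ 𝒜, e ≤ ∑ j ∈ 𝒥 A, (j : ℝ)⁻¹) :
    Real.log (z + 1) + #𝒜 * (c * e) / 10 ≤
      ∑ l ∈ Icc 1 Z, fullWeight 𝒜 W 𝒥 z l / l.totient := by
  have h1 := sum_fullWeight (z := z) h.mem_Icc (fun _ => 1)
  simp only [mul_one] at h1
  have h2 : #𝒜 * (c * e) ≤ ∑ A ∈ 𝒜, ∑ p ∈ W A, ∑ j ∈ 𝒥 A, ((p * j).totient : ℝ)⁻¹ := by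
    rw [← nsmul_eq_mul]
    refine card_nsmul_le_sum _ _ _ fun A hA => ?_
    calc c * e ≤ (∑ p ∈ W A, (p : ℝ)⁻¹) * ∑ j ∈ 𝒥 A, (j : ℝ)⁻¹ :=
          mul_le_mul (hW A hA) (hJ A hA) he (hc.trans (hW A hA))
      _ = ∑ p ∈ W A, ∑ j ∈ 𝒥 A, ((p * j : ℕ) : ℝ)⁻¹ := by
          rw [sum_mul_sum]
          refine sum_congr rfl fun p _ => sum_congr rfl fun j _ => ?_
          push_cast; rw [mul_inv]
      _ ≤ _ := by
          refine sum_le_sum fun p hp => sum_le_sum fun j hj => ?_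
          have hpos : 0 < p * j := (Nat.zero_le _).trans_lt (h.lt_mul A hA p hp j hj)
          refine inv_anti₀ (by exact_mod_cast Nat.totient_pos.mpr hpos) ?_
          exact_mod_cast Nat.totient_le _
  have := log_succ_le_sum_baseWeight hzZ
  linarith

lemma le_of_sub_mul_sq_le {P Z Y N L T M K η : ℝ} (hη : 0 < η) (hη1 : η ≤ 1 / 2) (hK : 0 ≤ K)
    (hN0 : 0 < N) (hT0 : 0 < T) (hL : 2 ≤ L) (hY : (1 / 2 + η) * L ≤ Y) (hZ : Z ≤ T)
    (hP : (P - Z) * Y ^ 2 ≤ N * Y + (2 + K) * T) (hM : (3 + K) / η * L ≤ M) (hTM : T * M = N) :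
    P ≤ (2 - η) * (N / L) := by
  have hL0 : 0 < L := by linarith
  have hY1 : 1 ≤ Y := by nlinarith
  have hPle : P ≤ N / Y + (3 + K) * T := by
    have h1 : (P - Z) * Y ^ 2 ≤ (N / Y + (2 + K) * T) * Y ^ 2 := by
      have h2 : N / Y * Y ^ 2 = N * Y := by field_simp
      have h3 : (2 + K) * T * 1 ≤ (2 + K) * T * Y ^ 2 :=
        mul_le_mul_of_nonneg_left (one_le_pow₀ hY1) (by positivity)
      rw [add_mul, h2]
      linarith
    have := le_of_mul_le_mul_right h1 (by positivity)
    linarith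
  have hNY : N / Y ≤ (2 - 2 * η) * (N / L) := by
    rw [← mul_div_assoc, div_le_div_iff₀ (by linarith) hL0]
    have h1 : 1 ≤ (2 - 2 * η) * (1 / 2 + η) := by nlinarith
    calc N * L ≤ N * L * ((2 - 2 * η) * (1 / 2 + η)) :=
          le_mul_of_one_le_right (by positivity) h1
      _ = (2 - 2 * η) * N * ((1 / 2 + η) * L) := by ring
      _ ≤ _ := mul_le_mul_of_nonneg_left hY (mul_nonneg (by linarith) hN0.le)
  have hTle : (3 + K) * T ≤ η * (N / L) := by
    rw [← mul_div_assoc, le_div_iff₀ hL0]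
    rw [div_mul_eq_mul_div, div_le_iff₀ hη] at hM
    calc (3 + K) * T * L = T * ((3 + K) * L) := by ring
      _ ≤ T * (M * η) := by gcongr
      _ = _ := by rw [← mul_assoc, hTM, mul_comm]
  linarith

lemma eventually_card_primes_le {s δ ω η : ℝ} {𝒜 : Finset ℝ} (hδ : 0 < δ) (hδ1 : δ ≤ 1 / 100)
    (hs : 1 ≤ s) (hω : 0 < ω) (hω1 : ω ≤ δ / 2) (hη : 0 < η) (hη1 : η ≤ δ / 8)
    (h𝒜 : ∀ A ∈ 𝒜, AdmissibleExponent s δ ω A)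
    (hsep : ∀ A ∈ 𝒜, ∀ A' ∈ 𝒜, A < A' → A + ω ≤ A') (hcard : 1200 * η ≤ #𝒜 * ω * δ) :
    ∀ᶠ N : ℝ in atTop, ∀ q : ℕ, ∀ _ : Fact q.Prime, (q : ℝ) = N ^ s → ∀ a : ZMod q, a ≠ 0 →
      (#{n ∈ Icc 1 ⌊(q * N : ℝ)⌋₊ | n.Prime ∧ ((n : ℕ) : ZMod q) = a} : ℝ) ≤
        (2 - η) * (N / Real.log N) := by
  have herr : ∀ᶠ N : ℝ in atTop, ∀ A ∈ 𝒜, ∀ q : ℕ, ∀ _ : Fact q.Prime, (q : ℝ) = N ^ s →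
      ∀ a : ZMod q, a ≠ 0 →
      ∀ (W 𝒥 : Finset ℕ) (β : ℕ → ℝ), (∀ p ∈ W, p.Prime ∧ p ≤ ⌊N ^ A⌋₊) →
      𝒥 ⊆ Icc 1 ⌊N ^ (1 / 2 - A + δ)⌋₊ → (∀ j ∈ 𝒥, ∀ p ∈ W, ¬ p ∣ j) →
      (∀ e ∈ Icc 1 ⌊N ^ (1 / 2 + δ)⌋₊, |β e| ≤ N ^ (δ / 8)) →
      |windowError (apError q a (q * N)) β W 𝒥 ⌊N ^ (1 / 2 + δ)⌋₊| ≤ N ^ (1 - δ / 8) := by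
    refine (eventually_all_finset _).mpr fun A hA => ?_
    obtain ⟨k, l, hk, hl, h1, h2, h3, h4⟩ := (h𝒜 A hA).exists_orders
    have := (h𝒜 A hA).ge
    have := (h𝒜 A hA).le
    exact eventually_abs_windowError_le hk hl hδ (by linarith) (by linarith) (by linarith)
      h1 h2 h3 h4 (by linarith)
  have hprimes : ∀ᶠ N : ℝ in atTop, ∀ A ∈ 𝒜, ∃ W : Finset ℕ,
      (∀ p ∈ W, p.Prime ∧ N ^ (A - ω) < p ∧ (p : ℝ) ≤ N ^ A) ∧
      ω / 3 ≤ ∑ p ∈ W, (p : ℝ)⁻¹ ∧ ∑ p ∈ W, (p : ℝ)⁻¹ ≤ 1 / 20 :=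
    (eventually_all_finset _).mpr fun A hA =>
      eventually_exists_primes hω (by linarith) (h𝒜 A hA).ge (h𝒜 A hA).le
  have hcof : ∀ᶠ N : ℝ in atTop, ∀ A ∈ 𝒜, ∀ W : Finset ℕ, (∀ p ∈ W, 1 ≤ p) →
      ∑ p ∈ W, (p : ℝ)⁻¹ ≤ 1 / 20 →
      ((1 / 2 - A + δ) - (1 / 2 - η - A + ω)) / 10 * Real.log N ≤
        ∑ m ∈ cofactors W ⌊N ^ (1 / 2 - η - A + ω)⌋₊ ⌊N ^ (1 / 2 - A + δ)⌋₊, (m : ℝ)⁻¹ :=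
    (eventually_all_finset _).mpr fun A hA => by
      have := (h𝒜 A hA).le
      exact eventually_le_sum_inv_cofactors (by linarith) (by linarith)
  filter_upwards [herr, hprimes, hcof, eventually_card_divisors_le (e := η / 4) (by linarith),
    eventually_sum_inv_le (e := η / 4) (by linarith),
    eventually_one_add_mul_log_le_rpow ((3 + #𝒜) / η) hη,
    Real.tendsto_log_atTop.eventually_ge_atTop 2, eventually_gt_atTop 1]
    with N herr hprimes hcof hdiv hharm hfin hlog2 hN1 q hq hqs a ha
  have hN0 : 0 < N := by linarith
  have hmono : ∀ {u v : ℝ}, u ≤ v → N ^ u ≤ N ^ v := fun h =>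
    Real.rpow_le_rpow_of_exponent_le hN1.le h
  choose! W hW hWl hWu using hprimes
  set 𝒥 : ℝ → Finset ℕ := fun A =>
    cofactors (W A) ⌊N ^ (1 / 2 - η - A + ω)⌋₊ ⌊N ^ (1 / 2 - A + δ)⌋₊ with h𝒥
  set z := ⌊N ^ (1 / 2 - η)⌋₊ with hz
  set Z := ⌊N ^ (1 / 2 + δ)⌋₊ with hZ
  have hsys : WindowSystem 𝒜 W 𝒥 z Z N :=
    windowSystem_of_rpow hN1 (fun A hA => (h𝒜 A hA).ge) hsep hW
  have hzZ : z ≤ Z := Nat.floor_le_floor (hmono (by linarith))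
  have hZle : (Z : ℝ) ≤ N ^ (1 / 2 + δ) := Nat.floor_le (by positivity)
  have hzle : (z : ℝ) ≤ N ^ (1 / 2 - η) := Nat.floor_le (by positivity)
  have hZN : (Z : ℝ) ≤ N := hZle.trans ((hmono (by linarith)).trans_eq (Real.rpow_one N))
  have hZη : (Z : ℝ) ≤ N ^ (1 - η) := hZle.trans (hmono (by linarith))
  have hZq : Z < q := by
    have : (Z : ℝ) < q := by
      rw [hqs]
      exact lt_of_le_of_lt hZle (Real.rpow_lt_rpow_of_exponent_lt hN1 (by linarith))
    exact_mod_cast this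
  set y := fullWeight 𝒜 W 𝒥 z with hy
  set Y := ∑ l ∈ Icc 1 Z, y l / l.totient with hY
  have hYlow : (1 / 2 + η) * Real.log N ≤ Y := by
    have h1 := hsys.le_sum_fullWeight (c := ω / 3) (e := δ / 20 * Real.log N) hzZ (by linarith)
      (mul_nonneg (by linarith) (by linarith)) hWl (fun A hA => by
        refine le_trans ?_ (hcof A hA (W A) (fun p hp => (hW A hA p hp).1.one_lt.le) (hWu A hA))
        exact mul_le_mul_of_nonneg_right (by linarith) (by linarith))
    have h2 : (1 / 2 - η) * Real.log N ≤ Real.log (z + 1) := by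
      rw [← Real.log_rpow hN0]
      exact Real.log_le_log (by positivity) (Nat.lt_floor_add_one _).le
    have h3 : 2 * η * Real.log N ≤ #𝒜 * (ω / 3 * (δ / 20 * Real.log N)) / 10 := by
      have := mul_le_mul_of_nonneg_right hcard (by linarith : 0 ≤ Real.log N)
      linarith
    linarith
  have hb : ∀ y' : ℕ → ℝ, (∀ l, 0 ≤ y' l) → (∀ l, y' l ≤ 1) →
      ∀ d ∈ Icc 1 Z, |selbergWeight y' Z d| ≤ N ^ (η / 2) := by
    intro y' h0 h1 d hd
    have hn : ∀ n ∈ Icc 1 Z, (#n.divisors : ℝ) ≤ N ^ (η / 4) := fun n hn => by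
      rw [mem_Icc] at hn
      exact hdiv n (by omega) (le_trans (by exact_mod_cast hn.2) hZN)
    refine (abs_selbergWeight_le (fun l => abs_le.mpr ⟨by linarith [h0 l], h1 l⟩) hn (by positivity)
      (hharm Z hZN) (mem_Icc.mp hd).1).trans_eq ?_
    rw [← Real.rpow_add hN0]; congr 1; ring
  have hb1 := hb _ (baseWeight_nonneg z) (baseWeight_le_one z)
  have hb2 := hb y (fun l => fullWeight_nonneg l) (hsys.fullWeight_le_one hN1 hZN)
  have hq0 : (0 : ℝ) < q := by rw [hqs]; positivity
  have hx0 : 0 ≤ (q * N : ℝ) := by positivity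
  have hwin : ∀ β : ℕ → ℝ, (∀ d ∈ Icc 1 Z, |β d| ≤ N ^ (η / 2)) → ∀ A ∈ 𝒜,
      |windowError (apError q a (q * N)) β (W A) (𝒥 A) Z| ≤ N ^ (1 - δ / 8) := by
    intro β hβ A hA
    refine herr A hA q hq hqs a ha (W A) (𝒥 A) β
      (fun p hp => ⟨(hW A hA p hp).1, Nat.le_floor (hW A hA p hp).2.2⟩) (fun j hj => ?_)
      (fun j hj p hp => (mem_cofactors.mp hj).2.2 p hp)
      fun d hd => (hβ d hd).trans (hmono (by linarith))
    have := (mem_cofactors.mp hj).1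
    exact mem_Icc.mpr ⟨by omega, this.2⟩
  have hE := abs_lcmForm_fullWeight_le hsys.mem_Icc (abs_apError_le a hx0) hb1 (by positivity)
    (hwin _ hb1) (hwin _ hb2)
  have hE' : lcmForm (apError q a (q * N)) (selbergWeight y Z) (selbergWeight y Z) Z ≤
      (2 + #𝒜) * N ^ (1 - η) := by
    refine (le_abs_self _).trans (hE.trans ?_)
    have h1 : (z : ℝ) ^ 2 * (N ^ (η / 2)) ^ 2 ≤ N ^ (1 - η) := by
      calc _ ≤ (N ^ (1 / 2 - η)) ^ 2 * (N ^ (η / 2)) ^ 2 := by gcongr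
        _ = _ := by
          rw [← mul_pow, ← Real.rpow_add hN0, ← Real.rpow_natCast, ← Real.rpow_mul hN0.le]
          congr 1; push_cast; ring
    have h2 : #𝒜 * N ^ (1 - δ / 8) ≤ #𝒜 * N ^ (1 - η) :=
      mul_le_mul_of_nonneg_left (hmono (by linarith)) (by positivity)
    linarith
  have hmain := card_primes_sub_mul_sq_le a hx0 hZq (fun l hl => hsys.fullWeight_eq_zero hl)
    (fun l => fullWeight_nonneg l) (hsys.fullWeight_le_one hN1 hZN)
  rw [mul_div_cancel_left₀ _ hq0.ne'] at hmain
  set P : ℝ := (#{n ∈ Icc 1 ⌊(q * N : ℝ)⌋₊ | n.Prime ∧ ((n : ℕ) : ZMod q) = a} : ℝ) with hP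
  set T := N ^ (1 - η) with hT
  have hT0 : 0 < T := by positivity
  refine le_of_sub_mul_sq_le (K := #𝒜) (M := N ^ η) (T := T) hη (by linarith) (Nat.cast_nonneg _)
    hN0 hT0 hlog2 hYlow hZη
    (hmain.trans (by linarith)) (by linarith) ?_
  rw [hT, ← Real.rpow_add hN0, sub_add_cancel, Real.rpow_one]

end

lemma admissibleExponent_sub {s t ω : ℝ} {k : ℕ} (hs : 100 ≤ s) (hk : (2 * k - 1) * (31 / 50) ≤ s)
    (hk' : s ≤ (2 * k - 1) * (7 / 10)) (ht : 0 < t) (ht' : t ≤ 1 / (20 * s)) (hω : 0 < ω)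
    (hω' : ω ≤ 1 / 200) :
    AdmissibleExponent s (1 / (1600 * s ^ 2)) ω
      (s / (2 * k - 1) - 1 / 2 - 1 / (1600 * s ^ 2) - t) := by
  have hs0 : 0 < s := by linarith
  have hk0 : (0 : ℝ) < 2 * k - 1 := by linarith
  set δ := 1 / (1600 * s ^ 2) with hδ
  have hδ0 : 0 < δ := by positivity
  have hδ1 : δ ≤ 1 / 1000 := by
    rw [hδ]; exact one_div_le_one_div_of_le (by norm_num) (by nlinarith)
  have ht1 : t ≤ 1 / 1000 :=
    ht'.trans (one_div_le_one_div_of_le (by norm_num) (by linarith))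
  set r := s / (2 * k - 1) with hr
  have hr1 : 31 / 50 ≤ r := by rw [hr, le_div_iff₀ hk0]; linarith
  have hr2 : r ≤ 7 / 10 := by rw [hr, div_le_iff₀ hk0]; linarith
  have hrk : (2 * k - 1) * r = s := mul_div_cancel₀ _ hk0.ne'
  set A := r - 1 / 2 - δ - t with hA
  have hts : t * s ≤ 1 / 20 := by
    rw [le_div_iff₀ (by positivity)] at ht'; linarith
  have htk : (2 * k - 1) * t ≤ 5 / 62 := by nlinarith
  refine ⟨by linarith, by linarith, k, ⌈(s / (1 / 2 - A + δ) - 1) / 2⌉₊, ?_⟩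
  set v := 1 / 2 - A + δ with hv
  have hv1 : 3 / 10 ≤ v := by linarith
  have hv2 : v ≤ 1 / 2 := by linarith
  have hv0 : 0 < v := by linarith
  have hsv : 1 < s / v := by rw [lt_div_iff₀ hv0]; linarith
  have hl1 := Nat.le_ceil ((s / v - 1) / 2)
  have hl2 := Nat.ceil_lt_add_one (a := (s / v - 1) / 2) (by linarith)
  have hl3 : 0 < ⌈(s / v - 1) / 2⌉₊ := Nat.ceil_pos.mpr (by linarith)
  set l := ⌈(s / v - 1) / 2⌉₊
  have hk1 : 1 ≤ k := by
    by_contra h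
    have : k = 0 := by omega
    subst this
    norm_num at hk0
  have hsv' : s / v * v = s := div_mul_cancel₀ _ hv0.ne'
  have hl0 : (1 : ℝ) ≤ l := by exact_mod_cast hl3
  have hlu : (2 * l - 1 : ℝ) * v < s := by
    rw [← hsv']; exact mul_lt_mul_of_pos_right (by linarith) hv0
  have hll : s ≤ (2 * l + 1 : ℝ) * v := by
    rw [← hsv']; exact mul_le_mul_of_nonneg_right (by linarith) hv0.le
  have hu : A + (1 / 2 + δ) = r - t := by rw [hA]; ring
  refine ⟨hk1, hl3, ?_, hlu, ?_, ?_⟩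
  · rw [hu, mul_sub, hrk]
    linarith [mul_pos hk0 ht]
  · rw [hu]
    have : (k : ℝ) * (r - t) = (s - (2 * k - 1) * t + (r - t)) / 2 := by rw [← hrk]; ring
    linarith
  · have hk2 : (k : ℝ) ≤ 82 / 100 * s := by linarith
    have hl4 : (l : ℝ) ≤ 168 / 100 * s + 1 / 2 := by
      have : (2 * l - 1 : ℝ) * (3 / 10) ≤ s :=
        (mul_le_mul_of_nonneg_left hv1 (by linarith)).trans hlu.le
      linarith
    have hkl : (k : ℝ) * l ≤ 2 * s ^ 2 := by
      calc (k : ℝ) * l ≤ (82 / 100 * s) * (2 * s) :=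
            mul_le_mul hk2 (by linarith) (by linarith) (by linarith)
        _ ≤ _ := by nlinarith
    have hk3 : (1 : ℝ) ≤ k := by exact_mod_cast hk1
    rw [hδ, lt_div_iff₀ (by positivity), mul_one_div, div_mul_eq_mul_div,
      div_lt_iff₀ (by positivity)]
    nlinarith

/-- A finite family of reals indexed by `range m ×ˢ range n` whose lexicographic steps decrease by
at least `ω`. -/
lemma card_image_and_separated {m n : ℕ} {ω : ℝ} (hω : 0 < ω) {f : ℕ × ℕ → ℝ}
    (h1 : ∀ i i' j j', i < i' → i' < m → j < n → j' < n → f (i', j') + ω ≤ f (i, j))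
    (h2 : ∀ i j j', i < m → j < j' → j' < n → f (i, j') + ω ≤ f (i, j)) :
    #((range m ×ˢ range n).image f) = m * n ∧
      ∀ A ∈ (range m ×ˢ range n).image f, ∀ A' ∈ (range m ×ˢ range n).image f,
        A < A' → A + ω ≤ A' := by
  have key : ∀ p ∈ range m ×ˢ range n, ∀ p' ∈ range m ×ˢ range n,
      p = p' ∨ f p + ω ≤ f p' ∨ f p' + ω ≤ f p := by
    rintro ⟨i, j⟩ h ⟨i', j'⟩ h'
    simp only [mem_product, mem_range] at h h'
    rcases lt_trichotomy i i' with hi | rfl | hi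
    · exact Or.inr (Or.inr (h1 _ _ _ _ hi h'.1 h.2 h'.2))
    · rcases lt_trichotomy j j' with hj | rfl | hj
      · exact Or.inr (Or.inr (h2 _ _ _ h.1 hj h'.2))
      · exact Or.inl rfl
      · exact Or.inr (Or.inl (h2 _ _ _ h.1 hj h.2))
    · exact Or.inr (Or.inl (h1 _ _ _ _ hi h.1 h'.2 h.2))
  constructor
  · rw [card_image_of_injOn, card_product, card_range, card_range]
    intro p hp p' hp' hpp
    rcases key p hp p' hp' with h | h | h
    · exact h
    · linarith
    · linarith
  · intro A hA A' hA' hlt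
    obtain ⟨p, hp, rfl⟩ := mem_image.mp hA
    obtain ⟨p', hp', rfl⟩ := mem_image.mp hA'
    rcases key p hp p' hp' with rfl | h | h
    · exact absurd hlt (lt_irrefl _)
    · exact h
    · linarith

lemma exists_admissibleExponents {s : ℝ} (hs : 100 ≤ s) :
    ∃ ω : ℝ, 0 < ω ∧ ω ≤ 1 / (1600 * s ^ 2) / 2 ∧ ∃ 𝒜 : Finset ℝ,
      (∀ A ∈ 𝒜, AdmissibleExponent s (1 / (1600 * s ^ 2)) ω A) ∧
      (∀ A ∈ 𝒜, ∀ A' ∈ 𝒜, A < A' → A + ω ≤ A') ∧ 1 / 400 ≤ #𝒜 * ω := by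
  have hs0 : 0 < s := by linarith
  set n := ⌈160 * s⌉₊ with hn
  set m := ⌈s / 20⌉₊ with hm
  set k₀ := ⌈(s / (7 / 10) + 1) / 2⌉₊ with hk₀
  have hn1 : 160 * s ≤ n := Nat.le_ceil _
  have hm1 : s / 20 ≤ m := Nat.le_ceil _
  have hm2 : (m : ℝ) < s / 20 + 1 := Nat.ceil_lt_add_one (by positivity)
  have hk1 : (s / (7 / 10) + 1) / 2 ≤ k₀ := Nat.le_ceil _
  have hk2 : (k₀ : ℝ) < (s / (7 / 10) + 1) / 2 + 1 := Nat.ceil_lt_add_one (by positivity)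
  have hn0 : (0 : ℝ) < n := by linarith
  set ω := 1 / (20 * s) / n with hω
  have hω0 : 0 < ω := by positivity
  have hnω : n * ω = 1 / (20 * s) := by rw [hω]; field_simp
  have hωle : ω ≤ 1 / (1600 * s ^ 2) / 2 := by
    rw [hω, div_div, div_div]
    exact one_div_le_one_div_of_le (by positivity) (by nlinarith)
  have hω2 : ω ≤ 1 / 200 := by
    refine hωle.trans ?_
    rw [div_div]
    exact one_div_le_one_div_of_le (by norm_num) (by nlinarith)
  let f : ℕ × ℕ → ℝ := fun p =>
    s / (2 * (k₀ + p.1 : ℕ) - 1) - 1 / 2 - 1 / (1600 * s ^ 2) - (p.2 + 1) * ω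
  have hj : ∀ j < n, ((j : ℝ) + 1) * ω ≤ 1 / (20 * s) := fun j hj => by
    rw [← hnω]
    exact mul_le_mul_of_nonneg_right (by exact_mod_cast hj) hω0.le
  have hkm : ∀ i < m, (2 * ((k₀ + i : ℕ) : ℝ) - 1) * (31 / 50) ≤ s := fun i hi => by
    have : (i : ℝ) ≤ m := by exact_mod_cast hi.le
    push_cast
    linarith
  have hkm' : ∀ i, s ≤ (2 * ((k₀ + i : ℕ) : ℝ) - 1) * (7 / 10) := fun i => by
    have : (0 : ℝ) ≤ i := Nat.cast_nonneg _
    push_cast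
    linarith
  obtain ⟨hcard, hsep⟩ := card_image_and_separated (m := m) (n := n) hω0 (f := f)
    (fun i i' j j' hi hi' hj1 hj1' => by
      have h1 := hkm i' hi'
      have h2 := hkm' i
      have hii : ((k₀ + i : ℕ) : ℝ) + 1 ≤ (k₀ + i' : ℕ) := by exact_mod_cast (by omega)
      have h3 := hj j hj1
      have h4 : 0 ≤ (j' : ℝ) * ω := by positivity
      simp only [f]
      set c : ℝ := 2 * ((k₀ + i : ℕ) : ℝ) - 1
      set c' : ℝ := 2 * ((k₀ + i' : ℕ) : ℝ) - 1
      have hcc : c + 2 ≤ c' := by simp only [c, c']; linarith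
      have hc0 : 0 < c := by linarith
      have hc0' : 0 < c' := by linarith
      have h5 : 1 / (20 * s) ≤ s / c - s / c' := by
        rw [div_sub_div _ _ hc0.ne' hc0'.ne', div_le_div_iff₀ (by positivity) (by positivity)]
        have : c * c' ≤ (s / (31 / 50)) * (s / (31 / 50)) :=
          mul_le_mul (by linarith) (by linarith) hc0'.le (by positivity)
        have h6 : s * 2 ≤ s * c' - c * s := by nlinarith
        nlinarith
      linarith)
    (fun i j j' hi hjj _ => by
      have : (j : ℝ) + 1 ≤ j' := by exact_mod_cast hjj
      have := mul_le_mul_of_nonneg_right this hω0.le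
      simp only [f]
      linarith)
  refine ⟨ω, hω0, hωle, _, fun A hA => ?_, hsep, ?_⟩
  · obtain ⟨⟨i, j⟩, hp, rfl⟩ := mem_image.mp hA
    simp only [mem_product, mem_range] at hp
    exact admissibleExponent_sub hs (hkm i hp.1) (hkm' i) (by positivity) (hj j hp.2) hω0 hω2
  · rw [hcard, Nat.cast_mul, mul_assoc, hnω, mul_one_div, le_div_iff₀ (by positivity)]
    linarith

section

open Filter

lemma eventually_card_primes_lt {s η : ℝ} (hs : 100 ≤ s) (hη : η * s ^ 2 = 1 / 768000000) :
    ∀ᶠ N : ℝ in atTop, ∀ q : ℕ, ∀ _ : Fact q.Prime, (q : ℝ) = N ^ s → ∀ a : ZMod q, a ≠ 0 →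
      (#{n ∈ Icc 1 ⌊(q * N : ℝ)⌋₊ | n.Prime ∧ ((n : ℕ) : ZMod q) = a} : ℝ) ≤
        (2 - η) * (N / Real.log N) := by
  obtain ⟨ω, hω, hω1, 𝒜, h𝒜, hsep, hcard⟩ := exists_admissibleExponents hs
  have hs0 : 0 < s := by linarith
  have hδ0 : 0 < 1 / (1600 * s ^ 2) := by positivity
  have hηδ : η = 1 / (1600 * s ^ 2) / 480000 := by
    field_simp
    linarith
  refine eventually_card_primes_le hδ0 ?_ (by linarith) hω hω1 (by rw [hηδ]; positivity)
    (by rw [hηδ]; linarith) h𝒜 hsep ?_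
  · exact one_div_le_one_div_of_le (by norm_num) (by nlinarith)
  · have := mul_le_mul_of_nonneg_right hcard hδ0.le
    rw [hηδ]
    linarith

end

end BrunTitchmarsh

/-- there are absolute constants `c_1 > 0` and `θ_0 ∈ (0,1)` such that for
every `θ ∈ [θ_0, 1)` there is `x_0 = x_0(θ)` so that for all `x ≥ x_0`, every prime `q`
with `log q / log x = θ` and every `a` coprime to `q`,
`π(x; q, a) < (2 − c_1(1−θ)²)·x/(φ(q)·log(x/q))`. -/
theorem stmt_18 :
    ∃ c1 : ℝ, 0 < c1 ∧ ∃ θ0 : ℝ, θ0 ∈ Set.Ioo (0 : ℝ) 1 ∧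
      ∀ θ : ℝ, θ0 ≤ θ → θ < 1 →
        ∃ x0 : ℝ, ∀ x : ℝ, x0 ≤ x →
          ∀ q : ℕ, q.Prime → Real.log q / Real.log x = θ →
            ∀ a : ℤ, Int.gcd a q = 1 →
              (primesInAP x q a : ℝ) <
                (2 - c1 * (1 - θ) ^ 2) * x / ((Nat.totient q : ℝ) * Real.log (x / q)) := by
  refine ⟨1 / 1000000000, by norm_num, 100 / 101, by norm_num, fun θ hθ hθ1 => ?_⟩
  have hκ : 0 < 1 - θ := by linarith
  set κ := 1 - θ with hκθ
  set s := θ / κ with hs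
  have hsκ : s * κ = θ := div_mul_cancel₀ _ hκ.ne'
  have hs100 : 100 ≤ s := by rw [hs, le_div_iff₀ hκ]; linarith
  have hs0 : 0 < s := by linarith
  obtain ⟨η, hη⟩ : ∃ η : ℝ, η * s ^ 2 = 1 / 768000000 := ⟨1 / 768000000 / s ^ 2, by field_simp⟩
  have hηκ : 1 / 1000000000 * κ ^ 2 < η := by
    have h1 : (s * κ) ^ 2 ≤ 1 := by
      rw [hsκ]; exact pow_le_one₀ (by linarith) hθ1.le
    refine lt_of_mul_lt_mul_right ?_ (sq_nonneg s)
    rw [hη]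
    nlinarith
  obtain ⟨x₀, hx₀⟩ := Filter.eventually_atTop.mp
    ((tendsto_rpow_atTop hκ).eventually (BrunTitchmarsh.eventually_card_primes_lt hs100 hη))
  refine ⟨max x₀ 2, fun x hx q hq hlog a ha => ?_⟩
  have hx2 : 2 ≤ x := (le_max_right _ _).trans hx
  have hx0 : 0 < x := by linarith
  have hlogx : 0 < Real.log x := Real.log_pos (by linarith)
  have hq1 : (1 : ℝ) < q := by exact_mod_cast hq.one_lt
  have hqθ : (q : ℝ) = x ^ θ := by
    rw [Real.rpow_def_of_pos hx0, ← hlog, mul_div_cancel₀ _ hlogx.ne', Real.exp_log (by linarith)]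
  have hqs : (q : ℝ) = (x ^ κ) ^ s := by rw [← Real.rpow_mul hx0.le, mul_comm, hsκ, hqθ]
  have hqN : (q : ℝ) * x ^ κ = x := by
    rw [hqθ, ← Real.rpow_add hx0, hκθ, add_sub_cancel, Real.rpow_one]
  have hN : x / q = x ^ κ := by rw [div_eq_iff (by linarith), mul_comm, hqN]
  have := Fact.mk hq
  have ha0 : (a : ZMod q) ≠ 0 := by
    rw [Ne, ZMod.intCast_zmod_eq_zero_iff_dvd]
    intro h
    have h1 : (q : ℤ) ∣ (Int.gcd a q : ℤ) := Int.dvd_coe_gcd h dvd_rfl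
    rw [ha] at h1
    exact hq.one_lt.ne' (by exact_mod_cast Int.eq_one_of_dvd_one (by positivity) h1)
  have hcard := hx₀ x ((le_max_left _ _).trans hx) q this hqs a ha0
  rw [hqN] at hcard
  have hL : 0 < Real.log (x ^ κ) := by
    rw [Real.log_rpow hx0]; positivity
  refine hcard.trans_lt ?_
  rw [hN, Nat.totient_prime hq, Nat.cast_sub hq.one_lt.le, Nat.cast_one, mul_div_assoc]
  have hκ1 : κ ^ 2 ≤ 1 := pow_le_one₀ hκ.le (by linarith)
  have hNle : x ^ κ / Real.log (x ^ κ) ≤ x / ((q - 1) * Real.log (x ^ κ)) := by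
    rw [← div_div]
    refine div_le_div_of_nonneg_right ?_ hL.le
    rw [le_div_iff₀ (by linarith)]
    nlinarith [Real.rpow_pos_of_pos hx0 κ]
  have hN0 : 0 < x ^ κ / Real.log (x ^ κ) := by positivity
  calc (2 - η) * (x ^ κ / Real.log (x ^ κ))
      < (2 - 1 / 1000000000 * κ ^ 2) * (x ^ κ / Real.log (x ^ κ)) :=
        mul_lt_mul_of_pos_right (by linarith) hN0
    _ ≤ _ := mul_le_mul_of_nonneg_left hNle (by linarith)
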